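/- Let n ≥ 3, let 2 ≤ k ≤ n - 1, let K be a convex body in ℝⁿ and let p be a point of ℝⁿ. Suppose that for every k-dimensional affine subspace H through p, the section H ∩ K is centrally symmetric (with the convention that the empty set is symmetric). Then either p is a centre of symmetry of K, or K is an ellipsoid. -/

import Mathlib

/-- A set is centrally symmetric with center `c` if its reflection through `c` equals itself.
Note the empty set satisfies this for any `c`, matching the convention that ∅ is symmetric. -/
def SymmWith {n : ℕ} (A : Set (EuclideanSpace ℝ (Fin n))) (c : EuclideanSpace ℝ (Fin n)) : Prop :=
  (fun x => (2 : ℝ) • c - x) '' A = A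

open Filter Topology Set

/-- The right derivative at `0` of `t ↦ ‖e + t • v‖`, for a unit vector `e`. -/
noncomputable def normSlope {E : Type*} [NormedAddCommGroup E] [NormedSpace ℝ E] (e v : E) : ℝ :=
  sInf ((fun t : ℝ => (‖e + t • v‖ - 1) / t) '' Ioi 0)

section NormSlope

variable {E : Type*} [NormedAddCommGroup E] [NormedSpace ℝ E] {e : E}

theorem normSlope_bddBelow (he : ‖e‖ = 1) (v : E) :
    BddBelow ((fun t : ℝ => (‖e + t • v‖ - 1) / t) '' Ioi 0) := by
  refine ⟨-‖v‖, ?_⟩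
  rintro _ ⟨t, ht, rfl⟩
  have ht : 0 < t := ht
  simp only
  rw [le_div_iff₀ ht]
  have h1 : ‖e‖ ≤ ‖e + t • v‖ + ‖t • v‖ := by
    simpa using norm_sub_le (e + t • v) (t • v)
  rw [norm_smul, Real.norm_eq_abs, abs_of_pos ht] at h1
  linarith

theorem one_add_mul_normSlope_le (he : ‖e‖ = 1) (v : E) {t : ℝ} (ht : 0 ≤ t) :
    1 + t * normSlope e v ≤ ‖e + t • v‖ := by
  rcases ht.eq_or_lt with rfl | ht
  · simp [he]
  have : normSlope e v ≤ (‖e + t • v‖ - 1) / t :=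
    csInf_le (normSlope_bddBelow he v) ⟨t, ht, rfl⟩
  rw [le_div_iff₀ ht] at this
  linarith

theorem exists_norm_add_smul_le (he : ‖e‖ = 1) (v : E) {ε : ℝ} (hε : 0 < ε) :
    ∃ t₀ > 0, ∀ t, 0 ≤ t → t ≤ t₀ → ‖e + t • v‖ ≤ 1 + t * (normSlope e v + ε) := by
  have hne : ((fun t : ℝ => (‖e + t • v‖ - 1) / t) '' Ioi 0).Nonempty :=
    ⟨_, 1, by simp, rfl⟩
  obtain ⟨_, ⟨t₀, ht₀, rfl⟩, h⟩ := Real.lt_sInf_add_pos hne hε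
  have ht₀ : 0 < t₀ := ht₀
  refine ⟨t₀, ht₀, fun t ht htt => ?_⟩
  have h' : (‖e + t₀ • v‖ - 1) / t₀ < normSlope e v + ε := h
  rw [div_lt_iff₀ ht₀] at h'
  have key : e + t • v = (t / t₀) • (e + t₀ • v) + (1 - t / t₀) • e := by
    have : t = t / t₀ * t₀ := by field_simp
    nth_rewrite 1 [this]
    module
  have h1 : t / t₀ ≤ 1 := (div_le_one ht₀).2 htt
  have h0 : 0 ≤ t / t₀ := by positivity
  rw [key]
  refine (norm_add_le _ _).trans ?_
  rw [norm_smul, norm_smul, he, Real.norm_of_nonneg h0, Real.norm_of_nonneg (by linarith)]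
  have : t = t / t₀ * t₀ := by field_simp
  nth_rewrite 3 [this]
  nlinarith

theorem normSlope_le_of_eventually (he : ‖e‖ = 1) {v : E} {C : ℝ}
    (h : ∀ ε > 0, ∃ t > 0, ‖e + t • v‖ ≤ 1 + t * (C + ε)) : normSlope e v ≤ C := by
  refine le_of_forall_pos_le_add fun ε hε => ?_
  obtain ⟨t, ht, h1⟩ := h ε hε
  have h2 := one_add_mul_normSlope_le he v ht.le
  have : t * normSlope e v ≤ t * (C + ε) := by linarith
  exact le_of_mul_le_mul_left this ht

theorem normSlope_le_norm (he : ‖e‖ = 1) (v : E) : normSlope e v ≤ ‖v‖ := by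
  have h := one_add_mul_normSlope_le he v zero_le_one
  have := norm_add_le e v
  simp at h
  linarith

theorem normSlope_add_le (he : ‖e‖ = 1) (v w : E) :
    normSlope e (v + w) ≤ normSlope e v + normSlope e w := by
  refine normSlope_le_of_eventually he fun ε hε => ?_
  obtain ⟨t₁, ht₁, h1⟩ := exists_norm_add_smul_le he v (half_pos hε)
  obtain ⟨t₂, ht₂, h2⟩ := exists_norm_add_smul_le he w (half_pos hε)
  set s := min t₁ t₂ with hs
  have hs0 : 0 < s := lt_min ht₁ ht₂
  refine ⟨s / 2, by positivity, ?_⟩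
  have a1 := h1 s hs0.le (min_le_left _ _)
  have a2 := h2 s hs0.le (min_le_right _ _)
  have key : e + (s / 2) • (v + w) = (1 / 2 : ℝ) • (e + s • v) + (1 / 2 : ℝ) • (e + s • w) := by
    module
  rw [key]
  refine (norm_add_le _ _).trans ?_
  rw [norm_smul, norm_smul, Real.norm_of_nonneg (by norm_num)]
  linarith

theorem normSlope_zero (he : ‖e‖ = 1) : normSlope e (0 : E) = 0 := by
  refine le_antisymm (by simpa using normSlope_le_norm he (0 : E)) ?_
  have := normSlope_add_le he (0 : E) 0
  simp at this
  linarith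

theorem normSlope_smul_le (he : ‖e‖ = 1) {c : ℝ} (hc : 0 < c) (v : E) :
    normSlope e (c • v) ≤ c * normSlope e v := by
  refine normSlope_le_of_eventually he fun ε hε => ?_
  obtain ⟨t₁, ht₁, h1⟩ := exists_norm_add_smul_le he v (div_pos hε hc)
  refine ⟨t₁ / c, by positivity, ?_⟩
  have := h1 t₁ ht₁.le le_rfl
  have e1 : (t₁ / c) • c • v = t₁ • v := by
    rw [smul_smul]; congr 1; field_simp
  rw [e1]
  refine this.trans (le_of_eq ?_)
  field_simp

theorem normSlope_smul (he : ‖e‖ = 1) {c : ℝ} (hc : 0 ≤ c) (v : E) :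
    normSlope e (c • v) = c * normSlope e v := by
  rcases hc.eq_or_lt with rfl | hc
  · simp [normSlope_zero he]
  refine le_antisymm (normSlope_smul_le he hc v) ?_
  have := normSlope_smul_le he (inv_pos.2 hc) (c • v)
  rw [inv_smul_smul₀ hc.ne'] at this
  rw [inv_mul_eq_div, le_div_iff₀ hc] at this
  linarith

theorem normSlope_smul_self (he : ‖e‖ = 1) (c : ℝ) : normSlope e (c • e) = c := by
  have h1 : normSlope e e ≤ 1 := he ▸ normSlope_le_norm he e
  have h2 : normSlope e (-e) ≤ -1 := by
    refine normSlope_le_of_eventually he fun ε hε => ⟨1, one_pos, ?_⟩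
    simp; linarith
  have h3 := normSlope_add_le he e (-e)
  rw [add_neg_cancel, normSlope_zero he] at h3
  rcases le_total 0 c with hc | hc
  · rw [normSlope_smul he hc]
    have : normSlope e e = 1 := by linarith
    rw [this, mul_one]
  · have : c • e = (-c) • (-e) := by module
    rw [this, normSlope_smul he (by linarith)]
    have : normSlope e (-e) = -1 := by linarith
    rw [this]; ring

theorem normSlope_add_smul_self (he : ‖e‖ = 1) (v : E) (c : ℝ) :
    normSlope e (v + c • e) = normSlope e v + c := by
  have h1 := normSlope_add_le he v (c • e)
  have h2 := normSlope_add_le he (v + c • e) ((-c) • e)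
  rw [normSlope_smul_self he] at h1 h2
  have : v + c • e + (-c) • e = v := by module
  rw [this] at h2
  linarith

theorem normSlope_le_add_norm_sub (he : ‖e‖ = 1) (v w : E) :
    normSlope e v ≤ normSlope e w + ‖v - w‖ := by
  have h1 := normSlope_add_le he w (v - w)
  have h2 := normSlope_le_norm he (v - w)
  rw [add_sub_cancel] at h1
  linarith

theorem continuous_normSlope (he : ‖e‖ = 1) : Continuous (normSlope e) := by
  have : LipschitzWith 1 (normSlope e) := by
    refine LipschitzWith.of_le_add fun v w => ?_
    rw [dist_eq_norm]
    exact normSlope_le_add_norm_sub he v w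
  exact this.continuous

/-- Points `e + δ • v'` with `v'` near `v` are in the unit ball for small `δ > 0`
if the slope is negative. -/
theorem eventually_norm_add_smul_le_one (he : ‖e‖ = 1) {v : E} (hv : normSlope e v < 0)
    {δ : ℕ → ℝ} (hδ0 : ∀ j, 0 < δ j) (hδ : Tendsto δ atTop (𝓝 0)) {v' : ℕ → E}
    (hv' : Tendsto v' atTop (𝓝 v)) : ∀ᶠ j in atTop, ‖e + δ j • v' j‖ ≤ 1 := by
  obtain ⟨t₀, ht₀, h⟩ := exists_norm_add_smul_le he v (ε := -normSlope e v / 2) (by linarith)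
  have h1 : ∀ᶠ j in atTop, ‖v' j - v‖ < -normSlope e v / 2 := by
    have : Tendsto (fun j => ‖v' j - v‖) atTop (𝓝 0) :=
      tendsto_iff_norm_sub_tendsto_zero.1 hv'
    exact this.eventually (gt_mem_nhds (by linarith))
  filter_upwards [h1, hδ.eventually (gt_mem_nhds ht₀)] with j h2 h3
  have h4 := h (δ j) (hδ0 j).le h3.le
  have h5 : e + δ j • v' j = (e + δ j • v) + δ j • (v' j - v) := by module
  rw [h5]
  refine (norm_add_le _ _).trans ?_
  rw [norm_smul, Real.norm_of_nonneg (hδ0 j).le]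
  have := mul_le_mul_of_nonneg_left h2.le (hδ0 j).le
  linarith

theorem normSlope_nonpos_of_eventually (he : ‖e‖ = 1) {v : E}
    {δ : ℕ → ℝ} (hδ0 : ∀ j, 0 < δ j) {v' : ℕ → E}
    (hv' : Tendsto v' atTop (𝓝 v)) (h : ∀ᶠ j in atTop, ‖e + δ j • v' j‖ ≤ 1) :
    normSlope e v ≤ 0 := by
  have h1 : Tendsto (fun j => normSlope e (v' j)) atTop (𝓝 (normSlope e v)) :=
    ((continuous_normSlope he).tendsto v).comp hv'
  refine le_of_tendsto h1 ?_
  filter_upwards [h] with j hj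
  have := one_add_mul_normSlope_le he (v' j) (hδ0 j).le
  by_contra! hc
  have := mul_pos (hδ0 j) hc
  linarith

end NormSlope

/-- Every plane section of the unit ball through `P • e`, in the chart used for pencils of
planes around the `y`-direction, is symmetric. -/
def FalseCentre {E : Type*} [NormedAddCommGroup E] [NormedSpace ℝ E] (e : E) (P : ℝ) : Prop :=
  ∀ y z : E, LinearIndependent ℝ ![e, y, z] → ∀ δ : ℝ, |δ| * P * ‖z‖ < 1 →
    ∃ rd sd : ℝ, ∀ r s : ℝ, ‖r • y + s • e + (δ * (P - s)) • z‖ ≤ 1 →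
      ‖(2 * rd - r) • y + (2 * sd - s) • e + (δ * (P - (2 * sd - s))) • z‖ ≤ 1

theorem exists_dual_of_linearIndependent {E ι : Type*} [NormedAddCommGroup E] [NormedSpace ℝ E]
    [FiniteDimensional ℝ E] [DecidableEq ι] {v : ι → E} (hv : LinearIndependent ℝ v) :
    ∃ f : ι → (E →L[ℝ] ℝ), ∀ i j, f i (v j) = if i = j then 1 else 0 := by
  have : ∀ i, ∃ f : E →ₗ[ℝ] ℝ, ∀ j, f (v j) = if i = j then 1 else 0 := by
    intro i
    obtain ⟨f, hf⟩ := LinearMap.exists_extend ((Module.Basis.span hv).coord i)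
    refine ⟨f, fun j => ?_⟩
    have h1 : f (v j) = (Module.Basis.span hv).coord i (Module.Basis.span hv j) := by
      rw [← hf]
      simp [Module.Basis.span_apply]
    rw [h1]
    simp [Finsupp.single_apply, eq_comm]
  choose f hf using this
  exact ⟨fun i => LinearMap.toContinuousLinearMap (f i), fun i j => hf i j⟩

theorem limit_centre_orthogonal {E : Type*} [NormedAddCommGroup E] [NormedSpace ℝ E]
    {e y z w : E} {P : ℝ} {δ lam : ℕ → ℝ} {d : ℕ → E}
    (hδ : Tendsto δ atTop (𝓝 0)) (hlam : ∀ j, 0 < lam j)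
    (hd : ∀ (j : ℕ) (r s : ℝ), ‖r • y + s • e + (δ j * (P - s)) • z‖ ≤ 1 →
      ‖(2 : ℝ) • d j - (r • y + s • e + (δ j * (P - s)) • z)‖ ≤ 1)
    (hw : Tendsto (fun j => lam j • d j) atTop (𝓝 w)) (r s T : ℝ) :
    ‖r • y + s • e‖ ≤ ‖r • y + s • e + T • w‖ := by
  have key : ∀ r s T : ℝ, 0 ≤ T → ‖r • y + s • e‖ = 1 → 1 ≤ ‖r • y + s • e + T • w‖ := by
    intro r s T hT hx
    set x := r • y + s • e with hxdef
    refine le_of_forall_pos_le_add fun η' hη' => ?_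
    obtain ⟨η, hη, hη1, hηη⟩ : ∃ η : ℝ, 0 < η ∧ η < 1 ∧ 2 * η ≤ η' :=
      ⟨min (η' / 2) (1 / 2), by positivity, by
        have := min_le_right (η' / 2) (1 / 2); linarith, by
        have := min_le_left (η' / 2) (1 / 2); linarith⟩
    have hlim : Tendsto (fun j => ‖x + T • (lam j • d j)‖ + 2 * η) atTop
        (𝓝 (‖x + T • w‖ + 2 * η)) := by
      exact ((tendsto_const_nhds.add (hw.const_smul T)).norm).add tendsto_const_nhds
    have hge : ∀ᶠ j in atTop, 1 ≤ ‖x + T • (lam j • d j)‖ + 2 * η := by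
      have hsmall : ∀ᶠ j in atTop, |δ j| * ((|P| + 2 * |s|) * ‖z‖) < η := by
        have : Tendsto (fun j => |δ j| * ((|P| + 2 * |s|) * ‖z‖)) atTop (𝓝 0) := by
          simpa using (hδ.abs).mul_const ((|P| + 2 * |s|) * ‖z‖)
        exact this.eventually (gt_mem_nhds hη)
      filter_upwards [hsmall] with j hj
      let g : ℝ → E := fun τ => (τ * r) • y + (τ * s) • e + (δ j * (P - τ * s)) • z
      have hg : Continuous g := by fun_prop
      have hgx : ∀ τ, g τ = τ • x + (δ j * (P - τ * s)) • z := by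
        intro τ; simp only [g, hxdef]; module
      have herr : ∀ τ, 0 ≤ τ → τ ≤ 2 → ‖(δ j * (P - τ * s)) • z‖ < η := by
        intro τ h0 h2
        rw [norm_smul, Real.norm_eq_abs, abs_mul]
        refine lt_of_le_of_lt ?_ hj
        rw [mul_assoc]
        refine mul_le_mul_of_nonneg_left ?_ (abs_nonneg _)
        refine mul_le_mul_of_nonneg_right ?_ (norm_nonneg _)
        refine (abs_sub _ _).trans ?_
        rw [abs_mul, abs_of_nonneg h0]
        have := mul_le_mul_of_nonneg_right h2 (abs_nonneg s)
        linarith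
      have hlow : ‖g (1 - η)‖ ≤ 1 := by
        rw [hgx]
        have h1 := norm_add_le ((1 - η) • x) ((δ j * (P - (1 - η) * s)) • z)
        have h2 := herr (1 - η) (by linarith) (by linarith)
        rw [norm_smul (1 - η) x, hx, Real.norm_of_nonneg (by linarith)] at h1
        linarith
      have hhigh : 1 ≤ ‖g (1 + η)‖ := by
        rw [hgx]
        have h1 := norm_sub_le ((1 + η) • x + (δ j * (P - (1 + η) * s)) • z)
          ((δ j * (P - (1 + η) * s)) • z)
        have h2 := herr (1 + η) (by linarith) (by linarith)
        rw [add_sub_cancel_right, norm_smul (1 + η) x, hx, Real.norm_of_nonneg (by linarith)] at h1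
        linarith
      obtain ⟨τ, ⟨hτ1, hτ2⟩, hτ⟩ := intermediate_value_Icc (by linarith : 1 - η ≤ 1 + η)
        hg.norm.continuousOn ⟨hlow, hhigh⟩
      simp only at hτ
      have hrefl := hd j (τ * r) (τ * s) hτ.le
      change ‖(2 : ℝ) • d j - g τ‖ ≤ 1 at hrefl
      set t := T * lam j with ht
      have ht0 : 0 ≤ t := mul_nonneg hT (hlam j).le
      have h1 : ‖g τ + t • d j‖ ≥ 1 := by
        have e1 : (2 + t) • g τ = (2 : ℝ) • (g τ + t • d j) - t • ((2 : ℝ) • d j - g τ) := by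
          module
        have h2 := norm_sub_le ((2 : ℝ) • (g τ + t • d j)) (t • ((2 : ℝ) • d j - g τ))
        rw [← e1, norm_smul, norm_smul, norm_smul, hτ, Real.norm_of_nonneg ht0,
          Real.norm_of_nonneg (by linarith), Real.norm_of_nonneg (by norm_num)] at h2
        have := mul_le_mul_of_nonneg_left hrefl ht0
        linarith
      have h3 : g τ + t • d j = (x + T • (lam j • d j)) +
          ((τ - 1) • x + (δ j * (P - τ * s)) • z) := by
        rw [hgx, ht]; module
      have h4 := norm_add_le (x + T • (lam j • d j)) ((τ - 1) • x + (δ j * (P - τ * s)) • z)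
      have h5 := norm_add_le ((τ - 1) • x) ((δ j * (P - τ * s)) • z)
      have h6 := herr τ (by linarith) (by linarith)
      rw [norm_smul (τ - 1) x, hx, Real.norm_eq_abs] at h5
      have h7 : |τ - 1| ≤ η := abs_le.2 ⟨by linarith, by linarith⟩
      rw [h3] at h1
      linarith
    have := ge_of_tendsto hlim hge
    linarith
  have key2 : ∀ r s T : ℝ, ‖r • y + s • e‖ = 1 → 1 ≤ ‖r • y + s • e + T • w‖ := by
    intro r s T hx
    rcases le_total 0 T with hT | hT
    · exact key r s T hT hx
    · have := key (-r) (-s) (-T) (by linarith) (by rw [← hx, ← norm_neg]; congr 1; module)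
      refine this.trans (le_of_eq ?_)
      rw [← norm_neg]; congr 1; module
  by_cases h0 : ‖r • y + s • e‖ = 0
  · rw [h0]; exact norm_nonneg _
  set N := ‖r • y + s • e‖ with hN
  have hNpos : 0 < N := lt_of_le_of_ne (norm_nonneg _) (Ne.symm h0)
  have := key2 (N⁻¹ * r) (N⁻¹ * s) (N⁻¹ * T) (by
    have : (N⁻¹ * r) • y + (N⁻¹ * s) • e = N⁻¹ • (r • y + s • e) := by module
    rw [this, norm_smul, Real.norm_of_nonneg (by positivity), ← hN]
    field_simp)
  have e2 : (N⁻¹ * r) • y + (N⁻¹ * s) • e + (N⁻¹ * T) • w =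
    N⁻¹ • (r • y + s • e + T • w) := by module
  rw [e2, norm_smul, Real.norm_of_nonneg (by positivity), inv_mul_eq_div, le_div_iff₀ hNpos] at this
  linarith

theorem linearIndependent_triple_iff {E : Type*} [AddCommGroup E] [Module ℝ E] {x y z : E} :
    LinearIndependent ℝ ![x, y, z] ↔
      ∀ a b c : ℝ, a • x + b • y + c • z = 0 → a = 0 ∧ b = 0 ∧ c = 0 := by
  rw [Fintype.linearIndependent_iff]
  constructor
  · intro h a b c h1
    have := h ![a, b, c] (by simpa [Fin.sum_univ_three] using h1)
    exact ⟨this 0, this 1, this 2⟩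
  · intro h g hg i
    have := h (g 0) (g 1) (g 2) (by simpa [Fin.sum_univ_three] using hg)
    fin_cases i <;> simp [this]

theorem exists_linearIndependent_triple {E : Type*} [AddCommGroup E] [Module ℝ E]
    [FiniteDimensional ℝ E] (hE : 3 ≤ Module.finrank ℝ E) {x y : E}
    (h : ∀ a b : ℝ, a • x + b • y = 0 → a = 0 ∧ b = 0) : ∃ z, LinearIndependent ℝ ![x, y, z] := by
  have hspan : Submodule.span ℝ {x, y} ≠ ⊤ := by
    intro htop
    have h1 : Module.finrank ℝ (Submodule.span ℝ ({x, y} : Set E)) = Module.finrank ℝ E := by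
      rw [htop, finrank_top]
    classical
    have h2 : Module.finrank ℝ (Submodule.span ℝ (({x, y} : Finset E) : Set E)) ≤ 2 :=
      (finrank_span_finset_le_card _).trans Finset.card_le_two
    rw [Finset.coe_pair] at h2
    omega
  obtain ⟨z, -, hz⟩ := SetLike.exists_of_lt (lt_top_iff_ne_top.2 hspan)
  refine ⟨z, linearIndependent_triple_iff.2 fun a b c habc => ?_⟩
  have hc : c = 0 := by
    by_contra hc
    apply hz
    rw [Submodule.mem_span_pair]
    refine ⟨-(a / c), -(b / c), ?_⟩
    have : z = c⁻¹ • (c • z) := by rw [inv_smul_smul₀ hc]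
    have h2 : c • z = -(a • x + b • y) := by
      rw [eq_neg_iff_add_eq_zero, ← habc]; abel
    rw [this, h2, smul_neg, smul_add, smul_smul, smul_smul]
    rw [div_eq_inv_mul, div_eq_inv_mul, neg_smul, neg_smul]; abel
  rw [hc, zero_smul, add_zero] at habc
  exact ⟨(h a b habc).1, (h a b habc).2, hc⟩

section Smooth

variable {E : Type*} [NormedAddCommGroup E] [NormedSpace ℝ E] {e : E} {P : ℝ}

theorem FalseCentre.exists_limit [FiniteDimensional ℝ E] (h : FalseCentre e P) (he : ‖e‖ = 1) (hP : 0 < P) {y z : E}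
    (hyz : LinearIndependent ℝ ![e, y, z]) :
    ∃ a b : ℝ, (∀ r s T : ℝ, ‖r • y + s • e‖ ≤
        ‖r • y + s • e + T • (P • z + a • y + b • e)‖) ∧
      ∀ k : ℝ, normSlope e ((k - 2 * a) • y - (P + 1) • z) =
        normSlope e (k • y + (P - 1) • z) + 2 * b := by
  obtain ⟨f, hf⟩ := exists_dual_of_linearIndependent hyz
  set δ' : ℕ → ℝ := fun j => 1 / ((j : ℝ) + 1 + P * ‖z‖) with hδ'
  have hden : ∀ j : ℕ, 0 < (j : ℝ) + 1 + P * ‖z‖ := fun j => by positivity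
  have hδ'0 : ∀ j, 0 < δ' j := fun j => one_div_pos.2 (hden j)
  have hδ'lim : Tendsto δ' atTop (𝓝 0) := by
    have h1 : Tendsto (fun j : ℕ => (j : ℝ) + 1 + P * ‖z‖) atTop atTop := by
      simp_rw [add_assoc]
      exact tendsto_atTop_add_const_right _ _ tendsto_natCast_atTop_atTop
    exact h1.inv_tendsto_atTop.congr fun j => by simp [hδ']
  have hδ'1 : ∀ j, |δ' j| * P * ‖z‖ < 1 := by
    intro j
    rw [abs_of_pos (hδ'0 j), mul_assoc, hδ', div_mul_eq_mul_div, one_mul, div_lt_one (hden j)]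
    have : (0 : ℝ) ≤ j := Nat.cast_nonneg j
    linarith
  choose rd' sd' hd' using fun j => h y z hyz (δ' j) (hδ'1 j)
  set d' : ℕ → E := fun j => rd' j • y + sd' j • e + (δ' j * (P - sd' j)) • z with hd'def
  set m : ℕ → E × ℝ := fun j => ((‖d' j‖ + δ' j)⁻¹ • d' j, (‖d' j‖ + δ' j)⁻¹ * δ' j) with hm
  have hpos' : ∀ j, 0 < ‖d' j‖ + δ' j := fun j => add_pos_of_nonneg_of_pos (norm_nonneg _) (hδ'0 j)
  have hmem : ∀ j, m j ∈ Metric.closedBall (0 : E) 1 ×ˢ Icc (0 : ℝ) 1 := by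
    intro j
    refine ⟨?_, ?_, ?_⟩
    · rw [mem_closedBall_zero_iff]
      simp only [hm]
      rw [norm_smul, Real.norm_of_nonneg (inv_nonneg.2 (hpos' j).le), inv_mul_eq_div,
        div_le_one (hpos' j)]
      have := hδ'0 j; linarith
    · exact mul_nonneg (inv_nonneg.2 (hpos' j).le) (hδ'0 j).le
    · simp only [hm]
      rw [inv_mul_eq_div, div_le_one (hpos' j)]
      have := norm_nonneg (d' j); linarith
  obtain ⟨⟨w, q⟩, -, φ, hφ, hlim⟩ :=
    ((isCompact_closedBall (0 : E) 1).prod isCompact_Icc).tendsto_subseq hmem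
  set δ : ℕ → ℝ := δ' ∘ φ with hδ
  set d : ℕ → E := d' ∘ φ with hdd
  set lam : ℕ → ℝ := fun j => (‖d j‖ + δ j)⁻¹ with hlam
  have hδ0 : ∀ j, 0 < δ j := fun j => hδ'0 _
  have hδlim : Tendsto δ atTop (𝓝 0) := hδ'lim.comp hφ.tendsto_atTop
  have hpos : ∀ j, 0 < ‖d j‖ + δ j := fun j => hpos' _
  have hlam0 : ∀ j, 0 < lam j := fun j => inv_pos.2 (hpos j)
  have hw : Tendsto (fun j => lam j • d j) atTop (𝓝 w) :=
    (continuous_fst.tendsto _).comp hlim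
  have hq : Tendsto (fun j => lam j * δ j) atTop (𝓝 q) :=
    (continuous_snd.tendsto _).comp hlim
  have hdref : ∀ (j : ℕ) (r s : ℝ), ‖r • y + s • e + (δ j * (P - s)) • z‖ ≤ 1 →
      ‖(2 : ℝ) • d j - (r • y + s • e + (δ j * (P - s)) • z)‖ ≤ 1 := by
    intro j r s hrs
    refine (le_of_eq ?_).trans (hd' (φ j) r s hrs)
    congr 1
    simp only [hdd, hδ, hd'def, Function.comp]
    module
  have hL := limit_centre_orthogonal (y := y) (z := z) (e := e) (P := P) hδlim hlam0 hdref hw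
  have hcoef : ∀ i, f i e = (if i = 0 then 1 else 0) ∧ f i y = (if i = 1 then 1 else 0) ∧
      f i z = (if i = 2 then 1 else 0) := fun i => ⟨hf i 0, hf i 1, hf i 2⟩
  set sd : ℕ → ℝ := sd' ∘ φ with hsd
  set rd : ℕ → ℝ := rd' ∘ φ with hrd
  have hdj : ∀ j, d j = rd j • y + sd j • e + (δ j * (P - sd j)) • z := fun j => rfl
  have hfe : Tendsto (fun j => lam j * sd j) atTop (𝓝 (f 0 w)) := by
    refine (((f 0).continuous.tendsto w).comp hw).congr fun j => ?_
    simp [hdj, hcoef]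
  have hfy : Tendsto (fun j => lam j * rd j) atTop (𝓝 (f 1 w)) := by
    refine (((f 1).continuous.tendsto w).comp hw).congr fun j => ?_
    simp [hdj, hcoef]
  have hfz : Tendsto (fun j => lam j * (δ j * (P - sd j))) atTop (𝓝 (q * P)) := by
    have : Tendsto (fun j => (lam j * δ j) * P - δ j * (lam j * sd j)) atTop
        (𝓝 (q * P - 0 * f 0 w)) := (hq.mul_const P).sub (hδlim.mul hfe)
    rw [zero_mul, sub_zero] at this
    exact this.congr fun j => by ring
  have hweq : w = f 1 w • y + f 0 w • e + (q * P) • z := by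
    refine tendsto_nhds_unique hw ?_
    refine (((hfy.smul_const y).add (hfe.smul_const e)).add (hfz.smul_const z)).congr fun j => ?_
    rw [hdj]; module
  have hnorm : ‖w‖ + q = 1 := by
    refine tendsto_nhds_unique (hw.norm.add hq) ?_
    refine tendsto_const_nhds.congr fun j => ?_
    rw [norm_smul, Real.norm_of_nonneg (hlam0 j).le, ← mul_add]
    exact (inv_mul_cancel₀ (hpos j).ne').symm
  have hq0 : 0 ≤ q := ge_of_tendsto' hq fun j => mul_nonneg (hlam0 j).le (hδ0 j).le
  have hq1 : 0 < q := by
    refine lt_of_le_of_ne hq0 fun hq => ?_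
    rw [← hq, add_zero] at hnorm
    rw [← hq, zero_mul, zero_smul, add_zero] at hweq
    have := hL (f 1 w) (f 0 w) (-1)
    rw [← hweq, hnorm] at this
    simp at this
    linarith
  have hWlim : Tendsto (fun j => (δ j)⁻¹ • d j) atTop (𝓝 (q⁻¹ • w)) := by
    refine ((hq.inv₀ hq1.ne').smul hw).congr fun j => ?_
    rw [smul_smul, mul_inv]
    congr 1
    have := (hlam0 j).ne'
    field_simp
  set a := q⁻¹ * f 1 w with ha
  set b := q⁻¹ * f 0 w with hb
  have hW : q⁻¹ • w = P • z + a • y + b • e := by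
    rw [hweq, smul_add, smul_add, smul_smul, smul_smul, smul_smul, inv_mul_cancel_left₀ hq1.ne']
    rw [ha, hb]; abel
  rw [hW] at hWlim
  refine ⟨a, b, fun r s T => ?_, fun k => le_antisymm ?_ ?_⟩
  · rw [← hW, smul_smul]
    exact hL r s (T * q⁻¹)
  · refine le_of_forall_pos_le_add fun ε hε => ?_
    set c := -normSlope e (k • y + (P - 1) • z) - ε with hc
    set x : ℕ → E := fun j => k • y + (P - 1) • z + c • e - (δ j * c) • z with hx
    have hxlim : Tendsto x atTop (𝓝 (k • y + (P - 1) • z + c • e)) := by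
      have := (tendsto_const_nhds (x := k • y + (P - 1) • z + c • e)).sub
        ((hδlim.mul_const c).smul_const z)
      simpa using this
    have h1 := eventually_norm_add_smul_le_one he (v := k • y + (P - 1) • z + c • e)
      (by rw [normSlope_add_smul_self he, hc]; linarith) hδ0 hδlim hxlim
    have h2 : ∀ᶠ j in atTop, ‖e + δ j • (x j - (2 : ℝ) • ((δ j)⁻¹ • d j))‖ ≤ 1 := by
      filter_upwards [h1] with j hj
      have e1 : e + δ j • x j = (δ j * k) • y + (1 + δ j * c) • e +
          (δ j * (P - (1 + δ j * c))) • z := by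
        simp only [hx]; module
      rw [e1] at hj
      have := hdref j _ _ hj
      rw [← e1] at this
      rw [← norm_neg]
      refine (le_of_eq ?_).trans this
      congr 1
      rw [smul_sub, smul_comm (δ j) (2 : ℝ), smul_inv_smul₀ (hδ0 j).ne']
      module
    have h3 := normSlope_nonpos_of_eventually he hδ0 (hxlim.sub (hWlim.const_smul (2 : ℝ))) h2
    have e2 : k • y + (P - 1) • z + c • e - (2 : ℝ) • (P • z + a • y + b • e) =
        ((k - 2 * a) • y - (P + 1) • z) + (c - 2 * b) • e := by module
    rw [e2, normSlope_add_smul_self he] at h3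
    linarith
  · refine le_of_forall_pos_le_add fun ε hε => ?_
    set c := normSlope e ((k - 2 * a) • y - (P + 1) • z) + ε with hc
    set x : ℕ → E := fun j => (k - 2 * a) • y - (P + 1) • z - c • e + (δ j * c) • z with hx
    have hxlim : Tendsto x atTop (𝓝 ((k - 2 * a) • y - (P + 1) • z - c • e)) := by
      have := (tendsto_const_nhds (x := (k - 2 * a) • y - (P + 1) • z - c • e)).add
        ((hδlim.mul_const c).smul_const z)
      simpa using this
    have h1 := eventually_norm_add_smul_le_one he
      (v := (k - 2 * a) • y - (P + 1) • z - c • e)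
      (by rw [sub_eq_add_neg _ (c • e), ← neg_smul, normSlope_add_smul_self he, hc]; linarith)
      hδ0 hδlim hxlim
    have h2 : ∀ᶠ j in atTop, ‖e + δ j • (x j + (2 : ℝ) • ((δ j)⁻¹ • d j))‖ ≤ 1 := by
      filter_upwards [h1] with j hj
      have e1 : -(e + δ j • x j) = (-(δ j * (k - 2 * a))) • y + (-1 + δ j * c) • e +
          (δ j * (P - (-1 + δ j * c))) • z := by
        simp only [hx]; module
      rw [← norm_neg, e1] at hj
      have := hdref j _ _ hj
      rw [← e1] at this
      refine (le_of_eq ?_).trans this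
      congr 1
      rw [smul_add, smul_comm (δ j) (2 : ℝ), smul_inv_smul₀ (hδ0 j).ne']
      module
    have h3 := normSlope_nonpos_of_eventually he hδ0 (hxlim.add (hWlim.const_smul (2 : ℝ))) h2
    have e2 : (k - 2 * a) • y - (P + 1) • z - c • e + (2 : ℝ) • (P • z + a • y + b • e) =
        (k • y + (P - 1) • z) + (2 * b - c) • e := by module
    rw [e2, normSlope_add_smul_self he] at h3
    linarith

theorem normSlope_eq_of_scaling (he : ‖e‖ = 1) {v g : E} {q : ℝ} (hq0 : 0 < q) (hq1 : q < 1)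
    (h : ∀ k : ℝ, normSlope e (g + (q * k) • v) = q * normSlope e (g + k • v))
    (k : ℝ) {t : ℝ} (ht : 0 < t) : normSlope e (k • v + t • g) = normSlope e (k • v) := by
  have hstep : ∀ t, 0 < t → normSlope e (k • v + (q * t) • g) = normSlope e (k • v + t • g) := by
    intro t ht
    have e1 : k • v + (q * t) • g = (q * t) • (g + (k / (q * t)) • v) := by
      rw [smul_add, smul_smul, mul_div_cancel₀ _ (by positivity)]; abel
    have e2 : k • v + t • g = t • (g + (q * (k / (q * t))) • v) := by
      rw [smul_add, smul_smul]
      have : t * (q * (k / (q * t))) = k := by field_simp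
      rw [this]; abel
    rw [e1, e2, normSlope_smul he (by positivity), normSlope_smul he ht.le, h]
    ring
  have hpow : ∀ n : ℕ, normSlope e (k • v + (q ^ n * t) • g) = normSlope e (k • v + t • g) := by
    intro n
    induction n with
    | zero => simp
    | succ n ih => rw [pow_succ', mul_assoc, hstep _ (by positivity), ih]
  have hlim : Tendsto (fun n : ℕ => normSlope e (k • v + (q ^ n * t) • g)) atTop
      (𝓝 (normSlope e (k • v + ((0 : ℝ) * t) • g))) := by
    refine ((continuous_normSlope he).tendsto _).comp ?_
    exact tendsto_const_nhds.add
      (((tendsto_pow_atTop_nhds_zero_of_lt_one hq0.le hq1).mul_const t).smul_const g)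
  simp only [hpow, zero_mul, zero_smul, add_zero] at hlim
  exact tendsto_nhds_unique tendsto_const_nhds hlim

/-- An affine functional equation for the slope along a line produces a direction along which
the slope is constant. -/
theorem exists_slope_const_of_functional_eq (he : ‖e‖ = 1) {y z : E} {q c₁ c₂ : ℝ}
    (hq0 : 0 < q) (hq1 : q < 1)
    (h : ∀ m : ℝ, normSlope e (z + (q * m + c₁) • y) = q * normSlope e (z + m • y) + c₂) :
    ∃ k₀ c₀ : ℝ, ∀ k t : ℝ, 0 < t →
      normSlope e (k • y + t • (z + k₀ • y + c₀ • e)) = normSlope e (k • y) := by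
  set m₀ := c₁ / (1 - q) with hm₀
  have hm : q * m₀ + c₁ = m₀ := by
    have : 1 - q ≠ 0 := by linarith
    rw [hm₀]; field_simp; ring
  refine ⟨m₀, -normSlope e (z + m₀ • y), fun k t ht =>
    normSlope_eq_of_scaling he hq0 hq1 (fun k => ?_) k ht⟩
  have h0 := h m₀
  rw [hm] at h0
  have h1 := h (m₀ + k)
  have e1 : q * (m₀ + k) + c₁ = m₀ + q * k := by linarith
  rw [e1] at h1
  set c := normSlope e (z + m₀ • y) with hc
  have e2 : ∀ k : ℝ, z + m₀ • y + (-c) • e + k • y = z + (m₀ + k) • y + (-c) • e := by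
    intro k; module
  rw [e2, e2, normSlope_add_smul_self he, normSlope_add_smul_self he, h1]
  linarith

theorem FalseCentre.exists_slope_const [FiniteDimensional ℝ E] (h : FalseCentre e P) (he : ‖e‖ = 1) (hP : 0 < P)
    {y z : E} (hyz : LinearIndependent ℝ ![e, y, z]) :
    ∃ k₀ c₀ : ℝ, ∀ k t : ℝ, 0 < t →
      normSlope e (k • y + t • (z + k₀ • y + c₀ • e)) = normSlope e (k • y) := by
  have hyz' : LinearIndependent ℝ ![e, y, -z] := by
    rw [linearIndependent_triple_iff] at hyz ⊢
    intro a b c habc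
    have := hyz a b (-c) (by rw [← habc]; module)
    simpa using this
  obtain ⟨a, b, -, hS⟩ := h.exists_limit he hP hyz
  obtain ⟨a', b', -, hS'⟩ := h.exists_limit he hP hyz'
  have hP1 : 0 < P + 1 := by linarith
  have e0 : ∀ k, normSlope e ((k - 2 * a') • y - (P + 1) • (-z)) =
      (P + 1) * normSlope e (z + ((k - 2 * a') / (P + 1)) • y) := by
    intro k
    rw [← normSlope_smul he hP1.le, smul_add, smul_smul, mul_div_cancel₀ _ hP1.ne']
    congr 1; module
  have e1 : ∀ k, normSlope e ((k - 2 * a) • y - (P + 1) • z) =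
      (P + 1) * normSlope e (-z + ((k - 2 * a) / (P + 1)) • y) := by
    intro k
    rw [← normSlope_smul he hP1.le, smul_add, smul_smul, mul_div_cancel₀ _ hP1.ne']
    congr 1; module
  rcases lt_trichotomy P 1 with hlt | rfl | hgt
  · refine exists_slope_const_of_functional_eq he (q := (1 - P) / (1 + P))
      (c₁ := -2 * a' / (P + 1)) (c₂ := 2 * b' / (P + 1)) (div_pos (by linarith) (by linarith))
      ((div_lt_one (by linarith)).2 (by linarith)) fun m => ?_
    have h1 := hS' ((1 - P) * m)
    rw [e0] at h1
    have e2 : ((1 - P) * m) • y + (P - 1) • (-z) = (1 - P) • (z + m • y) := by module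
    rw [e2, normSlope_smul he (by linarith)] at h1
    have e3 : ((1 - P) * m - 2 * a') / (P + 1) = (1 - P) / (1 + P) * m + -2 * a' / (P + 1) := by
      rw [add_comm 1 P]; field_simp; ring
    rw [e3] at h1
    rw [add_comm 1 P] at *
    field_simp
    field_simp at h1
    linarith
  · have hf : ∀ k : ℝ, 2 * normSlope e (z + (k / 2 - a') • y) = normSlope e (k • y) + 2 * b' := by
      intro k
      have h1 := hS' k
      rw [e0] at h1
      simp only [sub_self, zero_smul, add_zero] at h1
      rw [← h1]; norm_num; congr 2; ring_nf
    have h0 := hf 0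
    simp only [zero_div, zero_sub, zero_smul, normSlope_zero he, zero_add] at h0
    refine ⟨-a', -normSlope e (z + (-a') • y), fun k t ht => ?_⟩
    have h1 := hf (2 * (k / t))
    have e2 : k • y + t • (z + (-a') • y + (-normSlope e (z + (-a') • y)) • e) =
      t • ((z + (2 * (k / t) / 2 - a') • y) + (-normSlope e (z + (-a') • y)) • e) := by
      have : k = t * (k / t) := by field_simp
      nth_rewrite 1 [this]
      rw [mul_div_cancel_left₀ _ (two_ne_zero)]
      module
    have e3 : (2 * (k / t)) • y = (2 / t) • k • y := by
      rw [smul_smul]; congr 1; ring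
    rw [e3, normSlope_smul he (by positivity)] at h1
    rw [e2, normSlope_smul he ht.le, normSlope_add_smul_self he]
    have : 2 / t * normSlope e (k • y) = 2 * (normSlope e (k • y) / t) := by ring
    rw [this] at h1
    have h2 : normSlope e (z + (2 * (k / t) / 2 - a') • y) + -normSlope e (z + -a' • y) =
      normSlope e (k • y) / t := by linarith
    rw [h2]; field_simp
  · have f1 : ∀ m : ℝ, normSlope e (-z + ((P - 1) / (P + 1) * m + -2 * a / (P + 1)) • y) =
        (P - 1) / (P + 1) * normSlope e (z + m • y) + 2 * b / (P + 1) := by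
      intro m
      have h1 := hS ((P - 1) * m)
      rw [e1] at h1
      have e2 : ((P - 1) * m) • y + (P - 1) • z = (P - 1) • (z + m • y) := by module
      rw [e2, normSlope_smul he (by linarith)] at h1
      have e3 : ((P - 1) * m - 2 * a) / (P + 1) =
          (P - 1) / (P + 1) * m + -2 * a / (P + 1) := by field_simp; ring
      rw [e3] at h1
      have : (P - 1) / (P + 1) * normSlope e (z + m • y) + 2 * b / (P + 1) =
        ((P - 1) * normSlope e (z + m • y) + 2 * b) / (P + 1) := by field_simp
      rw [this, ← h1]; field_simp
    have f2 : ∀ m : ℝ, normSlope e (z + ((P - 1) / (P + 1) * m + -2 * a' / (P + 1)) • y) =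
        (P - 1) / (P + 1) * normSlope e (-z + m • y) + 2 * b' / (P + 1) := by
      intro m
      have h1 := hS' ((P - 1) * m)
      rw [e0] at h1
      have e2 : ((P - 1) * m) • y + (P - 1) • (-z) = (P - 1) • (-z + m • y) := by module
      rw [e2, normSlope_smul he (by linarith)] at h1
      have e3 : ((P - 1) * m - 2 * a') / (P + 1) =
          (P - 1) / (P + 1) * m + -2 * a' / (P + 1) := by field_simp; ring
      rw [e3] at h1
      have : (P - 1) / (P + 1) * normSlope e (-z + m • y) + 2 * b' / (P + 1) =
        ((P - 1) * normSlope e (-z + m • y) + 2 * b') / (P + 1) := by field_simp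
      rw [this, ← h1]; field_simp
    set q := (P - 1) / (P + 1) with hq
    have hq0 : 0 < q := div_pos (by linarith) hP1
    have hq1 : q < 1 := (div_lt_one hP1).2 (by linarith)
    refine exists_slope_const_of_functional_eq he (q := q * q)
      (c₁ := q * (-2 * a / (P + 1)) + -2 * a' / (P + 1))
      (c₂ := q * (2 * b / (P + 1)) + 2 * b' / (P + 1)) (by positivity) (by nlinarith) fun m => ?_
    have := f2 (q * m + -2 * a / (P + 1))
    rw [f1] at this
    rw [show q * q * m + (q * (-2 * a / (P + 1)) + -2 * a' / (P + 1)) =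
      q * (q * m + -2 * a / (P + 1)) + -2 * a' / (P + 1) by ring, this]
    ring

theorem FalseCentre.normSlope_neg [FiniteDimensional ℝ E] (hE : 3 ≤ Module.finrank ℝ E)
    (h : FalseCentre e P) (he : ‖e‖ = 1) (hP : 0 < P) (y : E) :
    normSlope e (-y) = -normSlope e y := by
  by_contra hne
  set α := normSlope e y with hα
  set β := -normSlope e (-y) with hβ
  have hαβ : β < α := by
    have := normSlope_add_le he y (-y)
    rw [add_neg_cancel, normSlope_zero he] at this
    refine lt_of_le_of_ne (by linarith) fun h => hne (by linarith)
  have hpos : ∀ t : ℝ, 0 ≤ t → normSlope e (t • y) = t * α := fun t ht => normSlope_smul he ht y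
  have hneg : ∀ t : ℝ, t ≤ 0 → normSlope e (t • y) = t * β := by
    intro t ht
    have : t • y = (-t) • (-y) := by module
    rw [this, normSlope_smul he (by linarith), hβ]; ring
  have hind : ∀ a b : ℝ, a • e + b • y = 0 → a = 0 ∧ b = 0 := by
    intro a b hab
    have hb : b = 0 := by
      by_contra hb
      have hy : y = (-(a / b)) • e := by
        have : y = b⁻¹ • (b • y) := by rw [inv_smul_smul₀ hb]
        have h2 : b • y = -(a • e) := by rw [eq_neg_iff_add_eq_zero, ← hab]; abel
        rw [this, h2, smul_neg, smul_smul, div_eq_inv_mul, neg_smul]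
      have h1 : α = -(a / b) := by rw [hα, hy, normSlope_smul_self he]
      have h2 : β = -(a / b) := by
        rw [hβ, hy, ← neg_smul, normSlope_smul_self he]; ring
      linarith
    rw [hb, zero_smul, add_zero] at hab
    refine ⟨?_, hb⟩
    have : e ≠ 0 := by rintro rfl; simp at he
    exact (smul_eq_zero.1 hab).resolve_right this
  obtain ⟨z, hz⟩ := exists_linearIndependent_triple hE hind
  obtain ⟨k₀, c₀, hg⟩ := h.exists_slope_const he hP hz
  set g := z + k₀ • y + c₀ • e with hgdef
  rw [linearIndependent_triple_iff] at hz
  have hindg : ∀ η : ℝ, LinearIndependent ℝ ![e, g + η • y, y] := by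
    intro η
    rw [linearIndependent_triple_iff]
    intro a b c habc
    have := hz (a + b * c₀) (b * (k₀ + η) + c) b (by rw [← habc, hgdef]; module)
    obtain ⟨h1, h2, rfl⟩ := this
    exact ⟨by simpa using h1, rfl, by simpa using h2⟩
  have hg0 : g ≠ 0 := by
    intro h0
    have := hz c₀ k₀ 1 (by rw [← h0, hgdef]; module)
    exact one_ne_zero this.2.2
  set c := min P ((P + 1) / 2) with hc
  have hc0 : 0 < c := lt_min hP (by linarith)
  set C := P / c * ‖y‖ + (1 + P / c) * |α| + ‖y‖ with hC
  have hCη : ∀ η > 0, ‖g‖ ≤ C * η := by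
    intro η hη
    obtain ⟨a, b, hL, hS⟩ := h.exists_limit he hP (hindg η)
    have hN : ∀ k, 0 < k → 2 * a < k → normSlope e (((k - 2 * a) * η - (P + 1)) • y) =
        normSlope e ((k * η + (P - 1)) • y) + 2 * b := by
      intro k hk hk2
      have h1 := hS k
      have e1 : (k - 2 * a) • (g + η • y) - (P + 1) • y =
        ((k - 2 * a) * η - (P + 1)) • y + (k - 2 * a) • g := by module
      have e2 : k • (g + η • y) + (P - 1) • y = (k * η + (P - 1)) • y + k • g := by module
      rw [e1, e2, hg _ _ (by linarith), hg _ _ hk] at h1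
      exact h1
    set D := 2 * a * η + 2 * P with hD
    have hN' : ∀ u, P - 1 < u → D - P - 1 < u →
        normSlope e ((u - D) • y) = normSlope e (u • y) + 2 * b := by
      intro u hu1 hu2
      have hu : (u - (P - 1)) / η * η = u - (P - 1) := by field_simp
      have := hN ((u - (P - 1)) / η) (div_pos (by linarith) hη) (by
        rw [lt_div_iff₀ hη]; linarith)
      rw [sub_mul, hu] at this
      rw [show u - D = u - (P - 1) - 2 * a * η - (P + 1) by rw [hD]; ring, this]
      congr 3; ring
    have hb : 2 * b = -(D * α) := by
      set u := |P| + |D| + 2 with hu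
      have h1 := hN' u (by linarith [le_abs_self P, abs_nonneg D])
        (by linarith [neg_abs_le P, le_abs_self D])
      rw [hpos _ (by linarith [abs_nonneg P, le_abs_self D]),
        hpos _ (by positivity)] at h1
      linarith
    have hac : c ≤ -(a * η) := by
      by_contra! hlt
      have hlt1 : -(a * η) < P := lt_of_lt_of_le hlt (min_le_left _ _)
      have hlt2 : -(a * η) < (P + 1) / 2 := lt_of_lt_of_le hlt (min_le_right _ _)
      have hD0 : 0 < D := by rw [hD]; linarith
      have hD1 : P - 1 < D := by rw [hD]; linarith
      set u := (max (P - 1) (D - P - 1) + D) / 2 with hu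
      have hm : max (P - 1) (D - P - 1) < D := max_lt hD1 (by linarith)
      have h1 := hN' u (by have := le_max_left (P - 1) (D - P - 1); linarith)
        (by have := le_max_right (P - 1) (D - P - 1); linarith)
      have huD : u < D := by linarith
      rw [hneg _ (by linarith), hb] at h1
      rcases le_total 0 u with h0 | h0
      · rw [hpos _ h0] at h1
        nlinarith
      · rw [hneg _ h0] at h1
        nlinarith
    have ha0 : a < 0 := by
      by_contra! h0
      nlinarith [mul_nonneg h0 hη.le]
    have hainv : 1 / (-a) ≤ η / c := by
      rw [div_le_div_iff₀ (by linarith) hc0]; linarith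
    have h1 := hL 1 0 (-(1 / a))
    have e1 : (1 : ℝ) • (g + η • y) + (0 : ℝ) • e +
        (-(1 / a)) • (P • y + a • (g + η • y) + b • e) =
        (P * (1 / (-a))) • y + (b * (1 / (-a))) • e := by
      have : (1 / a) * a = 1 := one_div_mul_cancel ha0.ne
      have e2 : (1 : ℝ) • (g + η • y) + (0 : ℝ) • e +
          (-(1 / a)) • (P • y + a • (g + η • y) + b • e) =
          (1 - 1 / a * a) • (g + η • y) + (-(1 / a) * P) • y + (-(1 / a) * b) • e := by module
      rw [e2, this, sub_self, zero_smul, zero_add]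
      congr 2 <;> ring
    rw [e1, one_smul, zero_smul, add_zero] at h1
    have ha1 : 0 < 1 / (-a) := one_div_pos.2 (by linarith)
    have h2 := norm_add_le ((P * (1 / (-a))) • y) ((b * (1 / (-a))) • e)
    rw [norm_smul, norm_smul, he, Real.norm_eq_abs, Real.norm_eq_abs, abs_mul, abs_mul,
      abs_of_pos hP, abs_of_pos ha1, mul_one] at h2
    have hb' : b * (1 / (-a)) = (η - P * (1 / (-a))) * α := by
      have : b = -((a * η + P) * α) := by rw [hD] at hb; linarith
      have hav : a * (1 / (-a)) = -1 := by
        rw [mul_one_div, div_neg, div_self ha0.ne]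
      rw [this]; linear_combination (-(η * α)) * hav
    have hb2 : |b| * (1 / (-a)) ≤ (η + P * (η / c)) * |α| := by
      have e4 : |b| * (1 / (-a)) = |b * (1 / (-a))| := by rw [abs_mul, abs_of_pos ha1]
      rw [e4, hb', abs_mul]
      refine mul_le_mul_of_nonneg_right ?_ (abs_nonneg _)
      refine (abs_sub _ _).trans ?_
      rw [abs_of_pos hη, abs_of_pos (by positivity)]
      have := mul_le_mul_of_nonneg_left hainv hP.le
      linarith
    have h3 : P * (1 / (-a)) * ‖y‖ ≤ P * (η / c) * ‖y‖ :=
      mul_le_mul_of_nonneg_right (mul_le_mul_of_nonneg_left hainv hP.le) (norm_nonneg _)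
    have h4 := norm_sub_le (g + η • y) (η • y)
    rw [add_sub_cancel_right, norm_smul, Real.norm_of_nonneg hη.le] at h4
    have e3 : C * η = P * (η / c) * ‖y‖ + (η + P * (η / c)) * |α| + η * ‖y‖ := by
      rw [hC]; ring
    rw [e3]; linarith
  have hlim : Tendsto (fun η : ℝ => C * η) (𝓝[>] 0) (𝓝 (C * 0)) :=
    (tendsto_const_nhds.mul tendsto_id).mono_left nhdsWithin_le_nhds
  have : ‖g‖ ≤ C * 0 := ge_of_tendsto hlim (eventually_mem_nhdsWithin.mono hCη)
  rw [mul_zero] at this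
  exact hg0 (norm_le_zero_iff.1 this)

end Smooth

section Product

variable {E : Type*} [NormedAddCommGroup E] [NormedSpace ℝ E] {e : E} {P : ℝ}

theorem FalseCentre.exists_functional [FiniteDimensional ℝ E] (hE : 3 ≤ Module.finrank ℝ E)
    (h : FalseCentre e P) (he : ‖e‖ = 1) (hP : 0 < P) :
    ∃ l : E →ₗ[ℝ] ℝ, l e = 1 ∧ (∀ v, |l v| ≤ ‖v‖) ∧ ∀ y z : E, l y = 0 → l z = 0 →
      LinearIndependent ℝ ![e, y, z] →
      ∃ a : ℝ, ∀ s c t : ℝ, ‖s • e + c • y‖ ≤ ‖s • e + c • y + t • (z + a • y)‖ := by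
  have hneg := h.normSlope_neg hE he hP
  have hadd : ∀ v w, normSlope e (v + w) = normSlope e v + normSlope e w := by
    intro v w
    refine le_antisymm (normSlope_add_le he v w) ?_
    have h1 := normSlope_add_le he (v + w) (-w)
    rw [add_neg_cancel_right, hneg] at h1
    linarith
  have hsmul : ∀ (c : ℝ) v, normSlope e (c • v) = c * normSlope e v := by
    intro c v
    rcases le_total 0 c with hc | hc
    · exact normSlope_smul he hc v
    · have : c • v = (-c) • (-v) := by module
      rw [this, normSlope_smul he (by linarith), hneg]; ring
  refine ⟨⟨⟨normSlope e, hadd⟩, hsmul⟩, ?_, ?_, ?_⟩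
  · simpa using normSlope_smul_self he 1
  · intro v
    refine abs_le.2 ⟨?_, normSlope_le_norm he v⟩
    have h1 := normSlope_le_norm he (-v)
    rw [hneg, norm_neg] at h1
    change -‖v‖ ≤ normSlope e v
    linarith
  · intro y z hy hz hyz
    change normSlope e y = 0 at hy
    change normSlope e z = 0 at hz
    obtain ⟨a, b, hL, hS⟩ := h.exists_limit he hP hyz
    have hb : b = 0 := by
      have h1 := hS 0
      rw [sub_eq_add_neg, ← neg_smul, hadd, hadd, hsmul, hsmul, hsmul, hsmul, hy, hz] at h1
      linarith
    refine ⟨a / P, fun s c t => ?_⟩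
    have h1 := hL c s (t / P)
    have e1 : c • y + s • e + (t / P) • (P • z + a • y + b • e) =
        s • e + c • y + t • (z + (a / P) • y) := by
      have h2 : t = t / P * P := by field_simp
      have h3 : t * (a / P) = t / P * a := by ring
      rw [hb, smul_add t, smul_smul t, h3]
      nth_rewrite 2 [h2]
      module
    rw [e1, add_comm (c • y)] at h1
    exact h1

theorem linearIndependent_of_mem_ker {l : E →ₗ[ℝ] ℝ} (hle : l e = 1) {y z : E} (hy : l y = 0)
    (hz : l z = 0) (h : ∀ b c : ℝ, b • y + c • z = 0 → b = 0 ∧ c = 0) :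
    LinearIndependent ℝ ![e, y, z] := by
  rw [linearIndependent_triple_iff]
  intro a b c habc
  have ha : a = 0 := by
    have := congrArg l habc
    simpa [hle, hy, hz] using this
  rw [ha, zero_smul, zero_add] at habc
  exact ⟨ha, h b c habc⟩

theorem exists_mem_ker_independent [FiniteDimensional ℝ E] (hE : 3 ≤ Module.finrank ℝ E)
    {l : E →ₗ[ℝ] ℝ} (hle : l e = 1) {y : E} (hy : l y = 0) (hy0 : y ≠ 0) :
    ∃ z, l z = 0 ∧ ∀ b c : ℝ, b • y + c • z = 0 → b = 0 ∧ c = 0 := by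
  obtain ⟨z, hz⟩ := exists_linearIndependent_triple (x := e) (y := y) hE (by
    intro a b hab
    have ha : a = 0 := by
      have := congrArg l hab
      simpa [hle, hy] using this
    rw [ha, zero_smul, zero_add] at hab
    exact ⟨ha, (smul_eq_zero.1 hab).resolve_right hy0⟩)
  rw [linearIndependent_triple_iff] at hz
  refine ⟨z - l z • e, by simp [hle], fun b c hbc => ?_⟩
  have := hz (-(c * l z)) b c (by rw [← hbc]; module)
  exact this.2

theorem norm_le_of_birkhoff_path {y₁ y₂ : E} {σ : ℝ}
    (hind : ∀ b c : ℝ, b • y₁ + c • y₂ = 0 → b = 0 ∧ c = 0)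
    (h : ∀ t : ℝ, ∃ a : ℝ, ∀ s c τ : ℝ, ‖s • e + c • (y₁ + t • (y₂ - y₁))‖ ≤
      ‖s • e + c • (y₁ + t • (y₂ - y₁)) + τ • ((y₂ - y₁) + a • (y₁ + t • (y₂ - y₁)))‖)
    (hnorm : ‖y₁‖ = ‖y₂‖) : ‖σ • e + y₂‖ ≤ ‖σ • e + y₁‖ := by
  choose a ha using h
  set u : ℝ → E := fun t => y₁ + t • (y₂ - y₁) with hu
  have hucont : Continuous u := by fun_prop
  have hu0 : ∀ t, u t ≠ 0 := by
    intro t ht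
    have := hind (1 - t) t (by rw [← ht, hu]; module)
    linarith [this.1, this.2]
  have hψ : ∀ t, 0 < ‖u t‖ := fun t => norm_pos_iff.2 (hu0 t)
  obtain ⟨t₀, -, hmin⟩ := isCompact_Icc.exists_isMinOn (nonempty_Icc.2 (zero_le_one' ℝ))
    hucont.norm.continuousOn
  set m := ‖u t₀‖ with hm
  have hm0 : 0 < m := hψ t₀
  set N := ‖y₁‖ with hN
  have hN0 : 0 ≤ N := norm_nonneg _
  set F : ℝ → ℝ := fun t => ‖σ • e + (N / ‖u t‖) • u t‖ with hF
  have step : ∀ s t, 0 ≤ s → s ≤ 1 → F t - F s ≤ N / m *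
      (‖u s‖ - ‖u t‖ + (s - t) * (a t * ‖u t‖)) ∧
      0 ≤ ‖u s‖ - ‖u t‖ + (s - t) * (a t * ‖u t‖) := by
    intro s t hs0 hs1
    have hus : u s = (1 - (s - t) * a t) • u t + (s - t) • ((y₂ - y₁) + a t • u t) := by
      simp only [hu]; module
    have h1 : (1 - (s - t) * a t) * ‖u t‖ ≤ ‖u s‖ := by
      have := ha t 0 (1 - (s - t) * a t) (s - t)
      rw [zero_smul, zero_add] at this
      change ‖(1 - (s - t) * a t) • u t‖ ≤ ‖(1 - (s - t) * a t) • u t +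
        (s - t) • ((y₂ - y₁) + a t • u t)‖ at this
      rw [← hus, norm_smul] at this
      exact (mul_le_mul_of_nonneg_right (le_abs_self _) (norm_nonneg _)).trans this
    have h2 : 0 ≤ ‖u s‖ - ‖u t‖ + (s - t) * (a t * ‖u t‖) := by linarith
    refine ⟨?_, h2⟩
    have hNs : 0 ≤ N / ‖u s‖ := div_nonneg hN0 (norm_nonneg _)
    have h3 : ‖σ • e + (N / ‖u s‖ * (1 - (s - t) * a t)) • u t‖ ≤ F s := by
      have := ha t σ (N / ‖u s‖ * (1 - (s - t) * a t)) (N / ‖u s‖ * (s - t))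
      refine this.trans (le_of_eq ?_)
      simp only [hF]
      congr 1
      change σ • e + (N / ‖u s‖ * (1 - (s - t) * a t)) • u t +
        (N / ‖u s‖ * (s - t)) • (y₂ - y₁ + a t • u t) = σ • e + (N / ‖u s‖) • u s
      generalize N / ‖u s‖ = q
      rw [hus]
      module
    have h4 : F t ≤ ‖σ • e + (N / ‖u s‖ * (1 - (s - t) * a t)) • u t‖ +
        N / ‖u s‖ * (‖u s‖ - ‖u t‖ + (s - t) * (a t * ‖u t‖)) := by
      have e1 : σ • e + (N / ‖u t‖) • u t =
          (σ • e + (N / ‖u s‖ * (1 - (s - t) * a t)) • u t) +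
          (N / ‖u t‖ - N / ‖u s‖ * (1 - (s - t) * a t)) • u t := by module
      simp only [hF]
      rw [e1]
      refine (norm_add_le _ _).trans (add_le_add_right (le_of_eq ?_) _)
      rw [norm_smul, Real.norm_eq_abs]
      have e2 : (N / ‖u t‖ - N / ‖u s‖ * (1 - (s - t) * a t)) =
          N / ‖u s‖ * (‖u s‖ - ‖u t‖ + (s - t) * (a t * ‖u t‖)) / ‖u t‖ := by
        have := (hψ s).ne'
        have := (hψ t).ne'
        field_simp
        ring
      rw [e2, abs_of_nonneg (by positivity), div_mul_cancel₀ _ (hψ t).ne']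
    have h5 : N / ‖u s‖ ≤ N / m :=
      div_le_div_of_nonneg_left hN0 hm0 (hmin ⟨hs0, hs1⟩)
    have h6 := mul_le_mul_of_nonneg_right h5 h2
    linarith
  set b : ℝ → ℝ := fun t => a t * ‖u t‖ with hb
  have step2 : ∀ s t, 0 ≤ t → t ≤ 1 → 0 ≤ s → s ≤ 1 →
      F s - F t ≤ N / m * ((s - t) * (b t - b s)) := by
    intro s t ht0 ht1 hs0 hs1
    have h1 := (step t s ht0 ht1).1
    have h2 := (step s t hs0 hs1).2
    refine h1.trans (mul_le_mul_of_nonneg_left ?_ (div_nonneg hN0 hm0.le))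
    simp only [hb]
    linarith
  have hfin : ∀ n : ℕ, F 1 - F 0 ≤ N / m * (b 0 - b 1) * (1 / ((n : ℝ) + 1)) := by
    intro n
    have hn : (0 : ℝ) < (n : ℝ) + 1 := by positivity
    have hk : ∀ k : ℕ, k ≤ n + 1 → F (k / ((n : ℝ) + 1)) - F 0 ≤
        N / m * (b 0 - b (k / ((n : ℝ) + 1))) * (1 / ((n : ℝ) + 1)) := by
      intro k
      induction k with
      | zero => simp
      | succ k ih =>
        intro hk
        have h1 := ih (by omega)
        have hk' : (k : ℝ) + 1 ≤ (n : ℝ) + 1 := by exact_mod_cast hk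
        have h2 := step2 ((k + 1 : ℕ) / ((n : ℝ) + 1)) (k / ((n : ℝ) + 1)) (by positivity)
          ((div_le_one hn).2 (by linarith)) (by positivity)
          ((div_le_one hn).2 (by push_cast; linarith))
        have e1 : ((k + 1 : ℕ) : ℝ) / ((n : ℝ) + 1) - k / ((n : ℝ) + 1) = 1 / ((n : ℝ) + 1) := by
          push_cast; ring
        rw [e1] at h2
        linarith
    have := hk (n + 1) le_rfl
    rwa [show ((n + 1 : ℕ) : ℝ) / ((n : ℝ) + 1) = 1 by push_cast; field_simp] at this
  have hlim : Tendsto (fun n : ℕ => N / m * (b 0 - b 1) * (1 / ((n : ℝ) + 1))) atTop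
      (𝓝 (N / m * (b 0 - b 1) * 0)) :=
    tendsto_const_nhds.mul tendsto_one_div_add_atTop_nhds_zero_nat
  have h10 := ge_of_tendsto' hlim hfin
  rw [mul_zero] at h10
  have e0 : F 0 = ‖σ • e + y₁‖ := by
    have hy : 0 < ‖y₁‖ := by simpa [hu] using hψ 0
    simp [hF, hu, hN, div_self hy.ne']
  have e1 : F 1 = ‖σ • e + y₂‖ := by
    have hy : 0 < ‖y₂‖ := by simpa [hu] using hψ 1
    simp [hF, hu, hnorm, div_self hy.ne']
  linarith

theorem FalseCentre.exists_rotation_invariant [FiniteDimensional ℝ E]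
    (hE : 3 ≤ Module.finrank ℝ E) (h : FalseCentre e P) (he : ‖e‖ = 1) (hP : 0 < P) :
    ∃ l : E →ₗ[ℝ] ℝ, l e = 1 ∧ (∀ v, |l v| ≤ ‖v‖) ∧ ∀ y₁ y₂ : E, l y₁ = 0 → l y₂ = 0 →
      ‖y₁‖ = ‖y₂‖ → ∀ s : ℝ, ‖s • e + y₁‖ = ‖s • e + y₂‖ := by
  obtain ⟨l, hle, hl, hort⟩ := h.exists_functional hE he hP
  refine ⟨l, hle, hl, ?_⟩
  have key : ∀ y₁ y₂ : E, l y₁ = 0 → l y₂ = 0 →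
      (∀ b c : ℝ, b • y₁ + c • y₂ = 0 → b = 0 ∧ c = 0) →
      ‖y₁‖ = ‖y₂‖ → ∀ s : ℝ, ‖s • e + y₂‖ ≤ ‖s • e + y₁‖ := by
    intro y₁ y₂ h1 h2 hind hn s
    refine norm_le_of_birkhoff_path hind (fun t => ?_) hn
    refine hort _ _ (by simp [h1, h2]) (by simp [h1, h2])
      (linearIndependent_of_mem_ker hle (by simp [h1, h2]) (by simp [h1, h2]) ?_)
    intro b c hbc
    have := hind (b * (1 - t) - c) (b * t + c) (by rw [← hbc]; module)
    have hb : b = 0 := by linarith [this.1, this.2]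
    rw [hb] at this
    exact ⟨hb, by linarith [this.2]⟩
  have key2 : ∀ y₁ y₂ : E, l y₁ = 0 → l y₂ = 0 →
      (∀ b c : ℝ, b • y₁ + c • y₂ = 0 → b = 0 ∧ c = 0) →
      ‖y₁‖ = ‖y₂‖ → ∀ s : ℝ, ‖s • e + y₁‖ = ‖s • e + y₂‖ := by
    intro y₁ y₂ h1 h2 hind hn s
    refine le_antisymm (key y₂ y₁ h2 h1 (fun b c hbc => ?_) hn.symm s) (key y₁ y₂ h1 h2 hind hn s)
    exact (hind c b (by rw [← hbc]; abel)).symm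
  intro y₁ y₂ h1 h2 hn s
  by_cases hind : ∀ b c : ℝ, b • y₁ + c • y₂ = 0 → b = 0 ∧ c = 0
  · exact key2 y₁ y₂ h1 h2 hind hn s
  by_cases h0 : y₁ = 0
  · have : y₂ = 0 := by rw [← norm_eq_zero, ← hn, h0, norm_zero]
    rw [h0, this]
  have h0' : y₂ ≠ 0 := by
    intro h
    apply h0
    rw [← norm_eq_zero, hn, h, norm_zero]
  obtain ⟨z, hz, hzi⟩ := exists_mem_ker_independent hE hle h1 h0
  have hz0 : z ≠ 0 := by
    rintro rfl
    exact one_ne_zero (hzi 0 1 (by simp)).2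
  have hznorm := norm_pos_iff.2 hz0
  have hy0 := norm_pos_iff.2 h0
  set k := ‖y₁‖ / ‖z‖ with hk
  have hk0 : 0 < k := div_pos hy0 hznorm
  have hkn : ‖k • z‖ = ‖y₁‖ := by
    rw [norm_smul, Real.norm_of_nonneg hk0.le, hk, div_mul_cancel₀ _ hznorm.ne']
  have hi1 : ∀ b c : ℝ, b • y₁ + c • (k • z) = 0 → b = 0 ∧ c = 0 := by
    intro b c hbc
    rw [smul_smul] at hbc
    have := hzi _ _ hbc
    exact ⟨this.1, (mul_eq_zero.1 this.2).resolve_right hk0.ne'⟩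
  have hi2 : ∀ b c : ℝ, b • y₂ + c • (k • z) = 0 → b = 0 ∧ c = 0 := by
    intro b c hbc
    push Not at hind
    obtain ⟨p, q, hpq, hne⟩ := hind
    have hq : q ≠ 0 := by
      intro hq
      rw [hq, zero_smul, add_zero] at hpq
      exact hne ((smul_eq_zero.1 hpq).resolve_right h0) hq
    have hp : p ≠ 0 := by
      intro hp
      rw [hp, zero_smul, zero_add] at hpq
      exact hq ((smul_eq_zero.1 hpq).resolve_right h0')
    have h3 : (-(b * p)) • y₁ + (q * c) • (k • z) = 0 := by
      have e1 : (-(b * p)) • y₁ = (-b) • (p • y₁) := by module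
      have e2 : p • y₁ = -(q • y₂) := by rw [eq_neg_iff_add_eq_zero, hpq]
      have e3 : (-b) • -(q • y₂) + (q * c) • k • z = q • (b • y₂ + c • k • z) := by module
      rw [e1, e2, e3, hbc, smul_zero]
    have := hi1 _ _ h3
    refine ⟨?_, (mul_eq_zero.1 this.2).resolve_left hq⟩
    have := this.1
    rw [neg_eq_zero] at this
    exact (mul_eq_zero.1 this).resolve_right hp
  rw [key2 y₁ (k • z) h1 (by simp [hz]) hi1 hkn.symm s,
    key2 y₂ (k • z) h2 (by simp [hz]) hi2 (by rw [hkn, hn]) s]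

end Product

section LocalFicken

variable {F : Type*} [NormedAddCommGroup F] [NormedSpace ℝ F]

/-- Slices of the unit ball at small height above a line are symmetric. -/
def SymmetricSlices (F : Type*) [NormedAddCommGroup F] [NormedSpace ℝ F] (τ₀ : ℝ) : Prop :=
  ∀ y z : F, y ≠ 0 → ‖z‖ = 1 → (∀ r : ℝ, ‖z‖ ≤ ‖z + r • y‖) → ∀ τ : ℝ, 0 < τ → τ ≤ τ₀ →
    ∀ r : ℝ, ‖r • y + τ • z‖ ≤ 1 → ‖(-r) • y + τ • z‖ ≤ 1

theorem exists_min_norm_add_smul (v : F) {y : F} (hy : y ≠ 0) :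
    ∃ ρ : ℝ, ∀ r : ℝ, ‖v + ρ • y‖ ≤ ‖v + r • y‖ := by
  have hy0 := norm_pos_iff.2 hy
  set R := 2 * ‖v‖ / ‖y‖ with hR
  have hR0 : 0 ≤ R := by positivity
  have hc : Continuous fun r : ℝ => ‖v + r • y‖ := by fun_prop
  obtain ⟨ρ, -, hρ⟩ := (isCompact_Icc (a := -R) (b := R)).exists_isMinOn
    ⟨0, by constructor <;> linarith⟩ hc.continuousOn
  refine ⟨ρ, fun r => ?_⟩
  by_cases hr : r ∈ Icc (-R) R
  · exact hρ hr
  · have h0 : ‖v + ρ • y‖ ≤ ‖v + (0 : ℝ) • y‖ := hρ (a := 0) ⟨by linarith, by linarith⟩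
    rw [zero_smul, add_zero] at h0
    refine h0.trans ?_
    have h1 : R < |r| := by
      by_contra! h
      exact hr (abs_le.1 h)
    have h2 := norm_sub_le (v + r • y) v
    rw [add_sub_cancel_left, norm_smul, Real.norm_eq_abs] at h2
    have h3 : R * ‖y‖ = 2 * ‖v‖ := by rw [hR]; field_simp
    have h4 := mul_lt_mul_of_pos_right h1 hy0
    linarith

theorem SymmetricSlices.exchange {τ₀ : ℝ} (hτ1 : τ₀ < 1)
    (h : SymmetricSlices F τ₀) {x x' : F} (hx : ‖x‖ = 1) (hx' : ‖x'‖ = 1)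
    (hd : ‖x - x'‖ ≤ 2 * τ₀) {k : ℝ} (hk0 : 0 ≤ k) (hk1 : k ≤ 1) :
    ‖x + k • x'‖ = ‖x' + k • x‖ := by
  rcases hk1.eq_or_lt with rfl | hk1
  · rw [one_smul, one_smul, add_comm]
  have he' : x + x' ≠ 0 := by
    intro h0
    have : x - x' = (2 : ℝ) • x := by
      rw [eq_neg_of_add_eq_zero_right h0]; module
    rw [this, norm_smul, hx, Real.norm_of_nonneg (by norm_num)] at hd
    linarith
  obtain ⟨ρ, hρ⟩ := exists_min_norm_add_smul (x - x') he'
  set e' := x + x' with he'def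
  set z₀ := x - x' + ρ • e' with hz₀
  have hz₀le : ‖z₀‖ ≤ 2 * τ₀ := by
    have := hρ 0
    rw [zero_smul, add_zero] at this
    exact this.trans hd
  by_cases hz0 : z₀ = 0
  · have h1 : (1 + ρ) • x = (1 - ρ) • x' := by
      have : (1 + ρ) • x - (1 - ρ) • x' = z₀ := by rw [hz₀, he'def]; module
      rwa [hz0, sub_eq_zero] at this
    have h2 : |1 + ρ| = |1 - ρ| := by
      have := congrArg norm h1
      rwa [norm_smul, norm_smul, hx, hx', mul_one, mul_one] at this
    have h3 : ρ = 0 := by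
      rcases abs_eq_abs.1 h2 with h | h <;> linarith
    have h4 : x = x' := by simpa [h3] using h1
    rw [h4]
  have hz0p := norm_pos_iff.2 hz0
  set z := ‖z₀‖⁻¹ • z₀ with hz
  set τ := ‖z₀‖ / 2 with hτ
  have hτ0 : 0 < τ := by positivity
  have hττ : τ ≤ τ₀ := by linarith
  have hznorm : ‖z‖ = 1 := by
    rw [hz, norm_smul, norm_inv, norm_norm, inv_mul_cancel₀ hz0p.ne']
  have hzmin : ∀ r : ℝ, ‖z‖ ≤ ‖z + r • e'‖ := by
    intro r
    have e1 : z + r • e' = ‖z₀‖⁻¹ • (x - x' + (ρ + ‖z₀‖ * r) • e') := by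
      have : r = ‖z₀‖⁻¹ * (‖z₀‖ * r) := by rw [inv_mul_cancel_left₀ hz0p.ne']
      nth_rewrite 1 [this]
      rw [hz, hz₀]; module
    rw [e1, hz, norm_smul, norm_smul]
    exact mul_le_mul_of_nonneg_left (hρ _) (norm_nonneg _)
  have hτz : τ • z = (1 / 2 : ℝ) • z₀ := by
    rw [hτ, hz, smul_smul]; congr 1; field_simp
  set α := (1 - ρ) / 2 with hα
  have hxα : x = α • e' + τ • z := by
    rw [hτz, hz₀, hα, he'def]; module
  have hxα' : -x' = (α - 1) • e' + τ • z := by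
    rw [hτz, hz₀, hα, he'def]; module
  have hP := h e' z he' hznorm hzmin
  have hb1 : ‖α • e' + τ • z‖ = 1 := by rw [← hxα, hx]
  have hb2 : ‖(α - 1) • e' + τ • z‖ = 1 := by rw [← hxα', norm_neg, hx']
  have hstrict : ∀ β γ : ℝ, ‖β • e' + τ • z‖ = 1 → ‖γ • e' + τ • z‖ = 1 → ¬ |β| < |γ| := by
    intro β γ hβ hγ hlt
    have hγ0 : γ ≠ 0 := by
      rintro rfl
      rw [abs_zero] at hlt
      exact absurd (abs_nonneg β) (not_le.2 hlt)
    have hmain : ∀ γ : ℝ, γ ≠ 0 → ‖γ • e' + τ • z‖ ≤ 1 → 0 ≤ β / γ → β / γ < 1 → False := by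
      intro γ hγ0 hγ h0 h1
      have e1 : β • e' + τ • z = (β / γ) • (γ • e' + τ • z) + (1 - β / γ) • (τ • z) := by
        have : β = β / γ * γ := by field_simp
        nth_rewrite 1 [this]
        module
      have h2 := norm_add_le ((β / γ) • (γ • e' + τ • z)) ((1 - β / γ) • (τ • z))
      rw [← e1, hβ, norm_smul, norm_smul, norm_smul τ, hznorm, Real.norm_of_nonneg h0,
        Real.norm_of_nonneg hτ0.le, Real.norm_of_nonneg (by linarith)] at h2
      nlinarith
    have habs : |β / γ| < 1 := by
      rw [abs_div, div_lt_one (abs_pos.2 hγ0)]; exact hlt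
    rcases le_total 0 (β / γ) with h0 | h0
    · exact hmain γ hγ0 hγ.le h0 (abs_lt.1 habs).2
    · refine hmain (-γ) (neg_ne_zero.2 hγ0) (hP τ hτ0 hττ γ hγ.le) ?_ ?_
      · rw [div_neg]; linarith
      · rw [div_neg]; linarith [(abs_lt.1 habs).1]
  have hα2 : α = 1 / 2 := by
    have h1 := not_lt.1 (hstrict _ _ hb1 hb2)
    have h2 := not_lt.1 (hstrict _ _ hb2 hb1)
    rcases abs_eq_abs.1 (le_antisymm h1 h2) with h | h <;> linarith
  rw [hα2] at hxα hxα'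
  have e1 : x + k • x' = ((1 + k) / 2) • e' + ((1 - k) * τ) • z := by
    have : x' = -(-x') := (neg_neg _).symm
    rw [this, hxα']; nth_rewrite 1 [hxα]; module
  have e2 : x' + k • x = -((-((1 + k) / 2)) • e' + ((1 - k) * τ) • z) := by
    have : x' = -(-x') := (neg_neg _).symm
    rw [this, hxα']; nth_rewrite 1 [hxα]; module
  have hN : 1 - k ≤ ‖x + k • x'‖ := by
    have := norm_sub_le (x + k • x') (k • x')
    rw [add_sub_cancel_right, norm_smul, hx, hx', Real.norm_of_nonneg hk0] at this
    linarith
  have hN' : 1 - k ≤ ‖x' + k • x‖ := by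
    have := norm_sub_le (x' + k • x) (k • x)
    rw [add_sub_cancel_right, norm_smul, hx, hx', Real.norm_of_nonneg hk0] at this
    linarith
  rw [e1] at hN ⊢
  rw [e2, norm_neg] at hN' ⊢
  have hscale : ∀ r : ℝ, 1 - k ≤ ‖r • e' + ((1 - k) * τ) • z‖ →
      ‖(-r) • e' + ((1 - k) * τ) • z‖ ≤ ‖r • e' + ((1 - k) * τ) • z‖ := by
    intro r hr
    set N := ‖r • e' + ((1 - k) * τ) • z‖ with hN
    have hN0 : 0 < N := by linarith
    have e3 : ∀ r : ℝ, (N⁻¹ * r) • e' + (N⁻¹ * ((1 - k) * τ)) • z =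
      N⁻¹ • (r • e' + ((1 - k) * τ) • z) := by intro r; module
    have h1k : 0 < 1 - k := by linarith
    have h1 := hP (N⁻¹ * ((1 - k) * τ)) (by positivity) (by
      rw [inv_mul_eq_div, div_le_iff₀ hN0]
      nlinarith) (N⁻¹ * r) (by
      rw [e3, norm_smul, ← hN, norm_inv, Real.norm_of_nonneg hN0.le, inv_mul_cancel₀ hN0.ne'])
    rw [← mul_neg, e3, norm_smul, norm_inv, Real.norm_of_nonneg hN0.le, inv_mul_eq_div,
      div_le_one hN0] at h1
    exact h1
  refine le_antisymm ?_ (hscale _ hN)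
  have := hscale _ hN'
  rwa [neg_neg] at this

theorem SymmetricSlices.normSlope_comm {τ₀ : ℝ} (hτ1 : τ₀ < 1)
    (h : SymmetricSlices F τ₀) {x x' : F} (hx : ‖x‖ = 1) (hx' : ‖x'‖ = 1)
    (hd : ‖x - x'‖ ≤ 2 * τ₀) : normSlope x x' = normSlope x' x := by
  have key : ∀ {x x' : F}, ‖x‖ = 1 → ‖x'‖ = 1 → ‖x - x'‖ ≤ 2 * τ₀ →
      normSlope x x' ≤ normSlope x' x := by
    intro x x' hx hx' hd
    refine normSlope_le_of_eventually hx fun ε hε => ?_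
    obtain ⟨t₀, ht₀, h1⟩ := exists_norm_add_smul_le hx' x hε
    refine ⟨min t₀ 1, lt_min ht₀ one_pos, ?_⟩
    have hm : 0 ≤ min t₀ 1 := (lt_min ht₀ one_pos).le
    rw [h.exchange hτ1 hx hx' hd hm (min_le_right _ _)]
    exact h1 _ hm (min_le_left _ _)
  exact le_antisymm (key hx hx' hd) (key hx' hx (by rwa [norm_sub_rev]))

theorem SymmetricSlices.norm_sq_line {τ₀ : ℝ} (hτ0 : 0 < τ₀) (hτ1 : τ₀ < 1)
    (h : SymmetricSlices F τ₀) (a b : F) :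
    ∃ β : ℝ, ∀ t : ℝ, ‖a + t • b‖ ^ 2 = ‖a‖ ^ 2 + β * t + ‖b‖ ^ 2 * t ^ 2 := by
  by_cases h0 : ∃ t : ℝ, a + t • b = 0
  · obtain ⟨t₀, ht₀⟩ := h0
    have ha : a = (-t₀) • b := by
      rw [neg_smul]; exact eq_neg_of_add_eq_zero_left ht₀
    refine ⟨-2 * t₀ * ‖b‖ ^ 2, fun t => ?_⟩
    have e1 : a + t • b = (t - t₀) • b := by rw [ha]; module
    rw [e1, ha, norm_smul, norm_smul, mul_pow, mul_pow, Real.norm_eq_abs, Real.norm_eq_abs,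
      sq_abs, sq_abs]
    ring
  push Not at h0
  set g : ℝ → ℝ := fun t => ‖a + t • b‖ ^ 2 with hg
  have hf0 : ∀ t : ℝ, 0 < ‖a + t • b‖ := fun t => norm_pos_iff.2 (h0 t)
  set X : ℝ → F := fun t => ‖a + t • b‖⁻¹ • (a + t • b) with hX
  have hXn : ∀ t, ‖X t‖ = 1 := by
    intro t
    simp only [hX]
    rw [norm_smul, norm_inv, norm_norm, inv_mul_cancel₀ (hf0 t).ne']
  have hXc : Continuous X := by
    have h1 : Continuous fun t : ℝ => a + t • b := by fun_prop
    exact (h1.norm.inv₀ fun t => (hf0 t).ne').smul h1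
  set D : ℝ → ℝ := fun s => ‖a + s • b‖ * normSlope (X s) b with hD
  set M : ℝ → ℝ := fun s => ‖a + s • b‖ * normSlope (X s) (-b) with hM
  have hrel : ∀ s t, s < t → ‖X s - X t‖ ≤ 2 * τ₀ →
      g s + (t - s) * D s = g t + (t - s) * M t := by
    intro s t hst hd
    have h1 := h.normSlope_comm hτ1 (hXn s) (hXn t) hd
    set p := ‖a + s • b‖ with hp
    set q := ‖a + t • b‖ with hq
    have hp0 : 0 < p := hf0 s
    have hq0 : 0 < q := hf0 t
    have hsX : p • X s = a + s • b := by
      simp only [hX]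
      rw [← hp, smul_inv_smul₀ hp0.ne']
    have htX : q • X t = a + t • b := by
      simp only [hX]
      rw [← hq, smul_inv_smul₀ hq0.ne']
    have e1 : X t = q⁻¹ • ((t - s) • b + p • X s) := by
      rw [hsX, eq_inv_smul_iff₀ hq0.ne', htX]; module
    have e2 : X s = p⁻¹ • ((t - s) • (-b) + q • X t) := by
      rw [htX, eq_inv_smul_iff₀ hp0.ne', hsX]; module
    have e3 : normSlope (X s) (X t) = q⁻¹ * ((t - s) * normSlope (X s) b + p) := by
      nth_rewrite 1 [e1]
      rw [normSlope_smul (hXn s) (inv_nonneg.2 hq0.le), normSlope_add_smul_self (hXn s),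
        normSlope_smul (hXn s) (by linarith)]
    have e4 : normSlope (X t) (X s) = p⁻¹ * ((t - s) * normSlope (X t) (-b) + q) := by
      nth_rewrite 1 [e2]
      rw [normSlope_smul (hXn t) (inv_nonneg.2 hp0.le), normSlope_add_smul_self (hXn t),
        normSlope_smul (hXn t) (by linarith)]
    rw [e3, e4] at h1
    simp only [hg, hD, hM]
    rw [← hp, ← hq]
    field_simp at h1
    linarith
  have hloc : ∀ t₀ : ℝ, ∃ A B C : ℝ, ∀ᶠ t in 𝓝 t₀, g t = A + B * t + C * t ^ 2 := by
    intro t₀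
    have h1 : ∀ᶠ t in 𝓝 t₀, ‖X t - X t₀‖ < τ₀ := by
      have : Tendsto (fun t => ‖X t - X t₀‖) (𝓝 t₀) (𝓝 0) :=
        tendsto_iff_norm_sub_tendsto_zero.1 (hXc.tendsto t₀)
      exact this.eventually (gt_mem_nhds hτ0)
    obtain ⟨η, hη, hη2⟩ := Metric.eventually_nhds_iff.1 h1
    have hclose : ∀ s t, |s - t₀| < η → |t - t₀| < η → ‖X s - X t‖ ≤ 2 * τ₀ := by
      intro s t hs ht
      have h2 := hη2 (y := s) (by rwa [Real.dist_eq])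
      have h3 := hη2 (y := t) (by rwa [Real.dist_eq])
      have h4 : X s - X t = (X s - X t₀) - (X t - X t₀) := by abel
      rw [h4]
      exact (norm_sub_le _ _).trans (by linarith)
    set s₁ := t₀ - 2 * η / 3 with hs₁
    set s₂ := t₀ - η / 3 with hs₂
    have hs₁η : |s₁ - t₀| < η := abs_lt.2 ⟨by rw [hs₁]; linarith, by rw [hs₁]; linarith⟩
    have hs₂η : |s₂ - t₀| < η := abs_lt.2 ⟨by rw [hs₂]; linarith, by rw [hs₂]; linarith⟩
    have hs₁₂ : s₂ - s₁ ≠ 0 := by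
      have : s₂ - s₁ = η / 3 := by rw [hs₁, hs₂]; ring
      rw [this]; positivity
    refine ⟨(s₁ * g s₂ - s₂ * g s₁ - (D s₂ - D s₁) * (s₁ * s₂)) / (s₁ - s₂),
      (g s₁ - g s₂ + (D s₂ - D s₁) * (s₁ + s₂)) / (s₁ - s₂), -(D s₂ - D s₁) / (s₁ - s₂), ?_⟩
    have hev : ∀ᶠ t in 𝓝 t₀, s₂ < t ∧ t < t₀ + η :=
      (lt_mem_nhds (by linarith)).and (gt_mem_nhds (by linarith))
    filter_upwards [hev] with t ht
    have htη : |t - t₀| < η := abs_lt.2 ⟨by linarith [ht.1], by linarith [ht.2]⟩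
    have r1 := hrel s₁ t (by linarith [ht.1]) (hclose _ _ hs₁η htη)
    have r2 := hrel s₂ t ht.1 (hclose _ _ hs₂η htη)
    have hne : s₁ - s₂ ≠ 0 := by
      intro h; exact hs₁₂ (by linarith)
    rw [← mul_left_inj' hne]
    have e1 : ∀ A B C : ℝ, (A / (s₁ - s₂) + B / (s₁ - s₂) * t + C / (s₁ - s₂) * t ^ 2) *
        (s₁ - s₂) = A + B * t + C * t ^ 2 := by
      intro A B C; field_simp
    rw [e1]
    linear_combination (-(t - s₂)) * r1 + (t - s₁) * r2
  have hpoly : ∀ A B C t₀ : ℝ, AnalyticAt ℝ (fun t : ℝ => A + B * t + C * t ^ 2) t₀ := by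
    intro A B C t₀; fun_prop
  have hga : AnalyticOnNhd ℝ g univ := by
    intro t₀ _
    obtain ⟨A, B, C, hABC⟩ := hloc t₀
    exact (hpoly A B C t₀).congr (hABC.mono fun t ht => ht.symm)
  obtain ⟨A, B, C, hABC⟩ := hloc 0
  have hgl : g = fun t => A + B * t + C * t ^ 2 :=
    hga.eq_of_eventuallyEq (fun t _ => hpoly A B C t) hABC
  have hgt : ∀ t : ℝ, ‖a + t • b‖ ^ 2 = A + B * t + C * t ^ 2 := fun t => congrFun hgl t
  have hA : A = ‖a‖ ^ 2 := by simpa using (hgt 0).symm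
  have hC : ‖b‖ ^ 2 = C := by
    have hl : Tendsto (fun s : ℝ => ‖s • a + b‖ ^ 2) (𝓝[>] 0) (𝓝 (‖(0 : ℝ) • a + b‖ ^ 2)) :=
      (Continuous.tendsto (by fun_prop) _).mono_left nhdsWithin_le_nhds
    have hr : Tendsto (fun s : ℝ => A * s ^ 2 + B * s + C) (𝓝[>] 0)
        (𝓝 (A * 0 ^ 2 + B * 0 + C)) :=
      (Continuous.tendsto (by fun_prop) _).mono_left nhdsWithin_le_nhds
    have heq : ∀ s ∈ Ioi (0 : ℝ), A * s ^ 2 + B * s + C = ‖s • a + b‖ ^ 2 := by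
      intro s hs
      have hs : 0 < s := hs
      have e1 : s • a + b = s • (a + s⁻¹ • b) := by
        rw [smul_add, smul_inv_smul₀ hs.ne']
      rw [e1, norm_smul, mul_pow, hgt, Real.norm_of_nonneg hs.le]
      field_simp
    have := tendsto_nhds_unique hl (hr.congr' (eventually_mem_nhdsWithin.mono heq))
    simpa using this
  refine ⟨B, fun t => ?_⟩
  rw [hgt, hA, hC]

end LocalFicken

section Revolution

variable {E : Type*} [NormedAddCommGroup E] [NormedSpace ℝ E] {e : E} {l : E →ₗ[ℝ] ℝ}

/-- The norm is invariant under rotations about the axis `ℝ e`, with equatorial plane `ker l`. -/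
structure IsRevolution (e : E) (l : E →ₗ[ℝ] ℝ) : Prop where
  axis : l e = 1
  abs_le : ∀ v, |l v| ≤ ‖v‖
  rotate : ∀ y₁ y₂ : E, l y₁ = 0 → l y₂ = 0 → ‖y₁‖ = ‖y₂‖ →
    ∀ s : ℝ, ‖s • e + y₁‖ = ‖s • e + y₂‖

/-- The radius of the slice of the unit ball at height `s`. -/
noncomputable def profile (e : E) (l : E →ₗ[ℝ] ℝ) (s : ℝ) : ℝ :=
  sSup ((fun y => ‖y‖) '' {y : E | l y = 0 ∧ ‖s • e + y‖ ≤ 1})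

namespace IsRevolution

theorem norm_axis (he : ‖e‖ = 1) (s : ℝ) : ‖s • e‖ = |s| := by
  rw [norm_smul, he, mul_one, Real.norm_eq_abs]

theorem abs_le_norm (h : IsRevolution e l) {y : E} (hy : l y = 0) (s : ℝ) :
    |s| ≤ ‖s • e + y‖ := by
  have := h.abs_le (s • e + y)
  simpa [h.axis, hy] using this

theorem norm_add_neg (h : IsRevolution e l) {y : E} (hy : l y = 0) (s : ℝ) :
    ‖s • e + -y‖ = ‖s • e + y‖ :=
  h.rotate _ _ (by simp [hy]) hy (norm_neg y) s

theorem norm_neg_add (h : IsRevolution e l) {y : E} (hy : l y = 0) (s : ℝ) :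
    ‖(-s) • e + y‖ = ‖s • e + y‖ := by
  rw [← h.norm_add_neg hy s, ← norm_neg]
  congr 1
  module

theorem norm_le (h : IsRevolution e l) {y : E} (hy : l y = 0) (s : ℝ) :
    ‖y‖ ≤ ‖s • e + y‖ := by
  have h1 := norm_add_le (s • e + y) ((-s) • e + y)
  rw [h.norm_neg_add hy, show s • e + y + ((-s) • e + y) = (2 : ℝ) • y by module,
    norm_smul, Real.norm_ofNat] at h1
  linarith

theorem mono (h : IsRevolution e l) {y₁ y₂ : E} (h1 : l y₁ = 0) (h2 : l y₂ = 0)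
    (hn : ‖y₁‖ ≤ ‖y₂‖) (s : ℝ) : ‖s • e + y₁‖ ≤ ‖s • e + y₂‖ := by
  by_cases h0 : y₂ = 0
  · rw [h0, norm_zero, norm_le_zero_iff] at hn
    rw [h0, hn]
  have hp := norm_pos_iff.2 h0
  set c := ‖y₁‖ / ‖y₂‖ with hc
  have hc0 : 0 ≤ c := by positivity
  have hc1 : c ≤ 1 := (div_le_one hp).2 hn
  have e1 : ‖s • e + y₁‖ = ‖s • e + c • y₂‖ := by
    refine h.rotate _ _ h1 (by simp [h2]) ?_ s
    rw [norm_smul, Real.norm_of_nonneg hc0, hc, div_mul_cancel₀ _ hp.ne']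
  have e2 : s • e + c • y₂ = ((1 + c) / 2) • (s • e + y₂) + ((1 - c) / 2) • (s • e + -y₂) := by
    module
  rw [e1, e2]
  refine (norm_add_le _ _).trans ?_
  rw [norm_smul, norm_smul, h.norm_add_neg h2, Real.norm_of_nonneg (by linarith),
    Real.norm_of_nonneg (by linarith)]
  linarith

theorem profile_neg (h : IsRevolution e l) (s : ℝ) : profile e l (-s) = profile e l s := by
  unfold profile
  congr 2
  ext y
  simp only [mem_ofPred_eq]
  exact and_congr_right fun hy => by rw [h.norm_neg_add hy]

variable [FiniteDimensional ℝ E]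

theorem profile_spec (h : IsRevolution e l) (he : ‖e‖ = 1) {s : ℝ} (hs : |s| ≤ 1) :
    (∃ y, l y = 0 ∧ ‖s • e + y‖ ≤ 1 ∧ ‖y‖ = profile e l s) ∧
      ∀ y, l y = 0 → ‖s • e + y‖ ≤ 1 → ‖y‖ ≤ profile e l s := by
  have hc : IsCompact {y : E | l y = 0 ∧ ‖s • e + y‖ ≤ 1} := by
    have hl : Continuous l := l.continuous_of_finiteDimensional
    refine (isCompact_closedBall (0 : E) 1).of_isClosed_subset ?_ ?_
    · exact (isClosed_eq hl continuous_const).inter 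
        (isClosed_le (f := fun y : E => ‖s • e + y‖) (by fun_prop) continuous_const)
    · rintro y ⟨hy, hy1⟩
      rw [mem_closedBall_zero_iff]
      exact (h.norm_le hy s).trans hy1
  have hne : {y : E | l y = 0 ∧ ‖s • e + y‖ ≤ 1}.Nonempty :=
    ⟨0, by simp, by rwa [add_zero, norm_axis he]⟩
  have hc' := hc.image (f := fun y : E => ‖y‖) continuous_norm
  obtain ⟨y, hy, hys⟩ := hc'.sSup_mem (hne.image _)
  refine ⟨⟨y, hy.1, hy.2, hys⟩, fun z hz hz1 => ?_⟩
  exact le_csSup hc'.bddAbove ⟨z, ⟨hz, hz1⟩, rfl⟩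

theorem norm_le_one_iff (h : IsRevolution e l) (he : ‖e‖ = 1) {s : ℝ} (hs : |s| ≤ 1) {y : E}
    (hy : l y = 0) : ‖s • e + y‖ ≤ 1 ↔ ‖y‖ ≤ profile e l s := by
  obtain ⟨⟨z, hz, hz1, hzn⟩, h2⟩ := h.profile_spec he hs
  exact ⟨h2 y hy, fun h3 => (h.mono hy hz (h3.trans hzn.ge) s).trans hz1⟩

theorem profile_nonneg (h : IsRevolution e l) (he : ‖e‖ = 1) {s : ℝ} (hs : |s| ≤ 1) :
    0 ≤ profile e l s := by
  obtain ⟨⟨z, hz, hz1, hzn⟩, -⟩ := h.profile_spec he hs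
  rw [← hzn]
  exact norm_nonneg _

theorem profile_le_one (h : IsRevolution e l) (he : ‖e‖ = 1) {s : ℝ} (hs : |s| ≤ 1) :
    profile e l s ≤ 1 := by
  obtain ⟨⟨z, hz, hz1, hzn⟩, -⟩ := h.profile_spec he hs
  rw [← hzn]
  exact (h.norm_le hz s).trans hz1

variable {u : E}

theorem one_sub_abs_le_profile (h : IsRevolution e l) (he : ‖e‖ = 1) (hu : l u = 0)
    (hu1 : ‖u‖ = 1) {s : ℝ} (hs : |s| ≤ 1) : 1 - |s| ≤ profile e l s := by
  have h1 : ‖(1 - |s|) • u‖ = 1 - |s| := by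
    rw [norm_smul, hu1, mul_one, Real.norm_of_nonneg (by linarith)]
  rw [← h1, ← h.norm_le_one_iff he hs (by simp [hu])]
  refine (norm_add_le _ _).trans ?_
  rw [h1, norm_axis he]
  linarith

theorem profile_concave (h : IsRevolution e l) (he : ‖e‖ = 1) (hu : l u = 0)
    (hu1 : ‖u‖ = 1) : ConcaveOn ℝ (Icc (-1) 1) (profile e l) := by
  refine ⟨convex_Icc _ _, fun s hs t ht a b ha hb hab => ?_⟩
  have hs' : |s| ≤ 1 := _root_.abs_le.2 hs
  have ht' : |t| ≤ 1 := _root_.abs_le.2 ht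
  have hst : |a * s + b * t| ≤ 1 := _root_.abs_le.2 ((convex_Icc (-1 : ℝ) 1) hs ht ha hb hab)
  have ps := h.profile_nonneg he hs'
  have pt := h.profile_nonneg he ht'
  have hn : ∀ c : ℝ, 0 ≤ c → ‖c • u‖ = c := fun c hc => by
    rw [norm_smul, hu1, mul_one, Real.norm_of_nonneg hc]
  have h1 := (h.norm_le_one_iff he hs' (y := profile e l s • u) (by simp [hu])).2 (hn _ ps).le
  have h2 := (h.norm_le_one_iff he ht' (y := profile e l t • u) (by simp [hu])).2 (hn _ pt).le
  simp only [smul_eq_mul]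
  rw [← hn (a * profile e l s + b * profile e l t) (by positivity),
    ← h.norm_le_one_iff he hst (by simp [hu])]
  have e1 : (a * s + b * t) • e + (a * profile e l s + b * profile e l t) • u =
      a • (s • e + profile e l s • u) + b • (t • e + profile e l t • u) := by module
  rw [e1]
  refine (norm_add_le _ _).trans ?_
  rw [norm_smul, norm_smul, Real.norm_of_nonneg ha, Real.norm_of_nonneg hb]
  nlinarith

theorem profile_pos (h : IsRevolution e l) (he : ‖e‖ = 1) (hu : l u = 0)
    (hu1 : ‖u‖ = 1) {s : ℝ} (hs : |s| < 1) : 0 < profile e l s :=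
  lt_of_lt_of_le (by linarith) (h.one_sub_abs_le_profile he hu hu1 hs.le)

theorem profile_continuousOn (h : IsRevolution e l) (he : ‖e‖ = 1) (hu : l u = 0)
    (hu1 : ‖u‖ = 1) : ContinuousOn (profile e l) (Ioo (-1) 1) :=
  ((h.profile_concave he hu hu1).subset Ioo_subset_Icc_self (convex_Ioo _ _)).continuousOn
    isOpen_Ioo

end IsRevolution

/-- A nonempty bounded set of reals has at most one centre. -/
theorem centre_unique {S : Set ℝ} {C a b : ℝ} (hS : S.Nonempty) (hC : ∀ s ∈ S, |s| ≤ C)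
    (ha : ∀ s ∈ S, 2 * a - s ∈ S) (hb : ∀ s ∈ S, 2 * b - s ∈ S) : a = b := by
  have key : ∀ d : ℝ, (∀ s ∈ S, s + d ∈ S) → d ≤ 0 := by
    intro d hd
    by_contra! h0
    obtain ⟨s, hs⟩ := hS
    have h1 : ∀ n : ℕ, s + n * d ∈ S := by
      intro n
      induction n with
      | zero => simpa using hs
      | succ n ih =>
        have := hd _ ih
        push_cast
        rwa [show s + (n + 1) * d = s + n * d + d by ring]
    obtain ⟨n, hn⟩ := exists_nat_gt ((C - s) / d)
    rw [div_lt_iff₀ h0] at hn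
    have := (le_abs_self _).trans (hC _ (h1 n))
    linarith
  have h1 := key (2 * a - 2 * b) fun s hs => by
    have := ha _ (hb s hs)
    rwa [show 2 * a - (2 * b - s) = s + (2 * a - 2 * b) by ring] at this
  have h2 := key (2 * b - 2 * a) fun s hs => by
    have := hb _ (ha s hs)
    rwa [show 2 * b - (2 * a - s) = s + (2 * b - 2 * a) by ring] at this
  linarith

end Revolution

section UniversalCentre

theorem exists_continuousOn_root {f : ℝ → ℝ → ℝ} (hf : Continuous fun p : ℝ × ℝ => f p.1 p.2)
    (hconv : ∀ δ, ConvexOn ℝ univ (f δ)) {D : Set ℝ} (h0 : ∀ δ ∈ D, f δ 0 < 1)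
    (hb : ∀ δ s, |s| ≤ f δ s) :
    ∃ t : ℝ → ℝ, ContinuousOn t D ∧ ∀ δ ∈ D, 0 < t δ ∧ t δ ≤ 1 ∧
      ∀ s, 0 ≤ s → (f δ s ≤ 1 ↔ s ≤ t δ) := by
  have hex : ∀ δ, ∃ t, δ ∈ D → 0 < t ∧ t ≤ 1 ∧ f δ t = 1 := by
    intro δ
    by_cases hδ : δ ∈ D
    · have hc : ContinuousOn (f δ) (Icc 0 1) :=
        (hf.comp (by fun_prop : Continuous fun s : ℝ => (δ, s))).continuousOn
      have h1 := intermediate_value_Icc zero_le_one hc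
      obtain ⟨t, ht, hft⟩ := h1 ⟨(h0 δ hδ).le, by simpa using hb δ 1⟩
      refine ⟨t, fun _ => ⟨lt_of_le_of_ne ht.1 ?_, ht.2, hft⟩⟩
      rintro rfl
      exact (h0 δ hδ).ne hft
    · exact ⟨0, fun h => (hδ h).elim⟩
  choose t ht using hex
  have hlt : ∀ δ ∈ D, ∀ s, 0 ≤ s → s < t δ → f δ s < 1 := by
    intro δ hδ s hs hst
    obtain ⟨t0, t1, ft⟩ := ht δ hδ
    have := (hconv δ).2 (mem_univ 0) (mem_univ (t δ))
      (show 0 ≤ 1 - s / t δ by rw [sub_nonneg, div_le_one t0]; exact hst.le)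
      (show 0 ≤ s / t δ by positivity) (by ring)
    simp only [smul_eq_mul, mul_zero, zero_add, ft, mul_one, div_mul_cancel₀ _ t0.ne'] at this
    have h2 : 0 < 1 - s / t δ := by rwa [sub_pos, div_lt_one t0]
    nlinarith [h0 δ hδ]
  have hgt : ∀ δ ∈ D, ∀ s, t δ < s → 1 < f δ s := by
    intro δ hδ s hst
    obtain ⟨t0, t1, ft⟩ := ht δ hδ
    have s0 := t0.trans hst
    have := (hconv δ).2 (mem_univ 0) (mem_univ s)
      (show 0 ≤ 1 - t δ / s by rw [sub_nonneg, div_le_one s0]; exact hst.le)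
      (show 0 ≤ t δ / s by have := (ht δ hδ).1; positivity) (by ring)
    simp only [smul_eq_mul, mul_zero, zero_add, div_mul_cancel₀ _ s0.ne'] at this
    rw [ft] at this
    have h2 : 0 < 1 - t δ / s := by rwa [sub_pos, div_lt_one s0]
    have h3 : 0 < t δ / s := by positivity
    nlinarith [h0 δ hδ]
  refine ⟨t, ?_, fun δ hδ => ⟨(ht δ hδ).1, (ht δ hδ).2.1, fun s hs => ⟨fun h => ?_, fun h => ?_⟩⟩⟩
  · intro δ hδ
    have hcs : ∀ s, Tendsto (fun d => f d s) (𝓝[D] δ) (𝓝 (f δ s)) := fun s =>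
      ((hf.comp (by fun_prop : Continuous fun d : ℝ => (d, s))).tendsto δ).mono_left
        nhdsWithin_le_nhds
    refine tendsto_order.2 ⟨fun a ha => ?_, fun a ha => ?_⟩
    · have h1 := hlt δ hδ (max a 0) (le_max_right _ _) (max_lt ha (ht δ hδ).1)
      filter_upwards [(hcs (max a 0)).eventually_lt_const h1, self_mem_nhdsWithin] with d hd hdD
      refine lt_of_le_of_lt (le_max_left a 0) ?_
      by_contra! hle
      rcases hle.eq_or_lt with h | h
      · rw [← h, (ht d hdD).2.2] at hd
        exact lt_irrefl _ hd
      · exact lt_asymm hd (hgt d hdD _ h)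
    · filter_upwards [(hcs a).eventually_const_lt (hgt δ hδ a ha), self_mem_nhdsWithin] with d hd hdD
      by_contra! hle
      rcases hle.eq_or_lt with h | h
      · rw [h, (ht d hdD).2.2] at hd
        exact lt_irrefl _ hd
      · exact lt_asymm hd (hlt d hdD _ ((ht δ hδ).1.le.trans ha.le) h)
  · by_contra! h1
    exact absurd (hgt δ hδ s h1) (not_lt.2 h)
  · rcases h.eq_or_lt with h | h
    · rw [h, (ht δ hδ).2.2]
    · exact (hlt δ hδ s hs h).le

variable {E : Type*} [NormedAddCommGroup E] [NormedSpace ℝ E] {e : E} {l : E →ₗ[ℝ] ℝ} {P : ℝ}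

/-- `z` is a unit vector, Birkhoff orthogonal to `y`, and both lie in the kernel of `l`. -/
structure BirkhoffPair (l : E →ₗ[ℝ] ℝ) (y z : E) : Prop where
  map_left : l y = 0
  map_right : l z = 0
  ne_zero : y ≠ 0
  norm_eq : ‖z‖ = 1
  le_norm : ∀ r : ℝ, ‖z‖ ≤ ‖z + r • y‖

theorem BirkhoffPair.abs_le {y z : E} (h : BirkhoffPair l y z) (r q : ℝ) :
    |q| ≤ ‖r • y + q • z‖ := by
  by_cases hq : q = 0
  · rw [hq, abs_zero]
    exact norm_nonneg _
  · have h1 := h.le_norm (r / q)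
    have h2 : r • y + q • z = q • (z + (r / q) • y) := by
      rw [smul_add, smul_smul, mul_div_cancel₀ _ hq, add_comm]
    rw [h2, norm_smul, Real.norm_eq_abs]
    rw [h.norm_eq] at h1
    nlinarith [abs_nonneg q]

theorem BirkhoffPair.independent {y z : E} (h : BirkhoffPair l y z) (b c : ℝ)
    (hbc : b • y + c • z = 0) : b = 0 ∧ c = 0 := by
  have h1 := h.abs_le b c
  rw [hbc, norm_zero] at h1
  have hc := abs_nonpos_iff.1 h1
  rw [hc, zero_smul, add_zero] at hbc
  exact ⟨(smul_eq_zero.1 hbc).resolve_right h.ne_zero, hc⟩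

theorem BirkhoffPair.ofKer {y z : LinearMap.ker l} (hy : y ≠ 0) (hz : ‖z‖ = 1)
    (h : ∀ r : ℝ, ‖z‖ ≤ ‖z + r • y‖) : BirkhoffPair l (y : E) (z : E) :=
  ⟨y.2, z.2, by simpa using hy, hz, h⟩

theorem exists_birkhoffPair [FiniteDimensional ℝ E] (hE : 3 ≤ Module.finrank ℝ E)
    (hle : l e = 1) {y : E} (hy : l y = 0) (hy0 : y ≠ 0) : ∃ z, BirkhoffPair l y z := by
  obtain ⟨w, hw, hi⟩ := exists_mem_ker_independent hE hle hy hy0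
  obtain ⟨ρ, hρ⟩ := exists_min_norm_add_smul w hy0
  set v := w + ρ • y with hv
  have hv0 : v ≠ 0 := by
    intro h0
    have := hi ρ 1 (by rw [← h0, hv]; module)
    exact one_ne_zero this.2
  have hn := norm_pos_iff.2 hv0
  refine ⟨‖v‖⁻¹ • v, hy, by simp [hv, hw, hy], hy0, ?_, fun r => ?_⟩
  · rw [norm_smul, norm_inv, norm_norm, inv_mul_cancel₀ hn.ne']
  · have e1 : ‖v‖⁻¹ • v + r • y = ‖v‖⁻¹ • (w + (ρ + ‖v‖ * r) • y) := by
      have e2 : r = ‖v‖⁻¹ * (‖v‖ * r) := by field_simp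
      nth_rewrite 1 [e2]
      generalize ‖v‖⁻¹ = k
      generalize ‖v‖ = m
      rw [hv]
      module
    rw [e1, norm_smul, norm_smul]
    exact mul_le_mul_of_nonneg_left (hρ _) (norm_nonneg _)

/-- The heights of the ends of the planar slices `|δ * (P - s)| ≤ profile e l s`, whose midpoint
is the height of the centre of every section with slope `δ`. -/
structure SliceEnds (e : E) (l : E →ₗ[ℝ] ℝ) (P : ℝ) (t₁ t₂ : ℝ → ℝ) : Prop where
  cont₁ : ContinuousOn t₁ {δ | |δ| * P < 1}
  cont₂ : ContinuousOn t₂ {δ | |δ| * P < 1}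
  bounds : ∀ δ, |δ| * P < 1 → 0 < t₁ δ ∧ t₁ δ ≤ 1 ∧ 0 < t₂ δ ∧ t₂ δ ≤ 1
  mem_iff : ∀ δ, |δ| * P < 1 → ∀ s, |s| ≤ 1 →
    (|δ * (P - s)| ≤ profile e l s ↔ -t₂ δ ≤ s ∧ s ≤ t₁ δ)
  reflect : ∀ δ, |δ| * P < 1 → ∀ y z, BirkhoffPair l y z → ∃ rd : ℝ, ∀ r s, |s| ≤ 1 →
    ‖r • y + (δ * (P - s)) • z‖ ≤ profile e l s →
    ‖(2 * rd - r) • y + (δ * (P - (t₁ δ - t₂ δ - s))) • z‖ ≤ profile e l (t₁ δ - t₂ δ - s)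

theorem FalseCentre.exists_universal_centre [FiniteDimensional ℝ E]
    (h : FalseCentre e P) (he : ‖e‖ = 1) (hP : 0 < P)
    (hl : IsRevolution e l) {u : E} (hu : l u = 0) (hu1 : ‖u‖ = 1) :
    ∃ t₁ t₂ : ℝ → ℝ, SliceEnds e l P t₁ t₂ := by
  have hroot : ∀ σ : ℝ, |σ| = 1 → ∃ t : ℝ → ℝ, ContinuousOn t {δ | |δ| * P < 1} ∧
      ∀ δ ∈ {δ | |δ| * P < 1}, 0 < t δ ∧ t δ ≤ 1 ∧
      ∀ s, 0 ≤ s → (‖s • e + (δ * (P - σ * s)) • u‖ ≤ 1 ↔ s ≤ t δ) := by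
    intro σ hσ
    refine exists_continuousOn_root (f := fun δ s => ‖s • e + (δ * (P - σ * s)) • u‖)
      (by fun_prop) (fun δ => ⟨convex_univ, fun x _ y _ a b ha hb hab => ?_⟩) ?_ ?_
    · simp only [smul_eq_mul]
      have hb' : b = 1 - a := by linarith
      have e1 : (a * x + b * y) • e + (δ * (P - σ * (a * x + b * y))) • u =
          a • (x • e + (δ * (P - σ * x)) • u) + b • (y • e + (δ * (P - σ * y)) • u) := by
        subst hb'
        module
      rw [e1]
      refine (norm_add_le _ _).trans (le_of_eq ?_)
      rw [norm_smul, norm_smul, Real.norm_of_nonneg ha, Real.norm_of_nonneg hb]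
    · intro δ hδ
      simpa [norm_smul, hu1, abs_mul, abs_of_pos hP] using hδ
    · intro δ s
      exact hl.abs_le_norm (by simp [hu]) s
  obtain ⟨t₁, ht₁c, ht₁⟩ := hroot 1 (by simp)
  obtain ⟨t₂, ht₂c, ht₂⟩ := hroot (-1) (by simp)
  have hmem : ∀ δ, |δ| * P < 1 → ∀ s, ‖s • e + (δ * (P - s)) • u‖ ≤ 1 ↔
      -t₂ δ ≤ s ∧ s ≤ t₁ δ := by
    intro δ hδ s
    obtain ⟨a1, a2, a3⟩ := ht₁ δ hδ
    obtain ⟨b1, b2, b3⟩ := ht₂ δ hδ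
    rcases le_total 0 s with hs | hs
    · have := a3 s hs
      rw [one_mul] at this
      rw [this]
      exact ⟨fun h => ⟨by linarith, h⟩, fun h => h.2⟩
    · have := b3 (-s) (by linarith)
      rw [hl.norm_neg_add (by simp [hu]), show P - -1 * -s = P - s by ring] at this
      rw [this]
      exact ⟨fun h => ⟨by linarith, by linarith⟩, fun h => by linarith [h.1]⟩
  have hnu : ∀ q : ℝ, ‖q • u‖ = |q| := fun q => by
    rw [norm_smul, hu1, mul_one, Real.norm_eq_abs]
  refine ⟨t₁, t₂, ht₁c, ht₂c, fun δ hδ => ⟨(ht₁ δ hδ).1, (ht₁ δ hδ).2.1, (ht₂ δ hδ).1,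
    (ht₂ δ hδ).2.1⟩, ?_, ?_⟩
  · intro δ hδ s hs
    rw [← hmem δ hδ, hl.norm_le_one_iff he hs (by simp [hu]), hnu]
  · intro δ hδ y z hyz
    obtain ⟨rd, sd, hrd⟩ := h y z (linearIndependent_of_mem_ker hl.axis hyz.map_left
      hyz.map_right hyz.independent) δ (by rwa [hyz.norm_eq, mul_one])
    have hker : ∀ r q : ℝ, l (r • y + q • z) = 0 := by
      intro r q
      simp [hyz.map_left, hyz.map_right]
    have hsd : sd = (t₁ δ - t₂ δ) / 2 := by
      refine centre_unique (S := {s | ‖s • e + (δ * (P - s)) • u‖ ≤ 1}) (C := 1)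
        ⟨0, ?_⟩ ?_ ?_ ?_
      · rw [mem_ofPred_eq, hmem δ hδ]
        exact ⟨by linarith [(ht₂ δ hδ).1], (ht₁ δ hδ).1.le⟩
      · intro s hs
        exact (hl.abs_le_norm (by simp [hu]) s).trans hs
      · intro s hs
        rw [mem_ofPred_eq] at hs ⊢
        have h1 := hrd 0 s (by
          rw [zero_smul, zero_add]
          refine le_trans (hl.rotate _ _ (by simp [hyz.map_right]) (by simp [hu]) ?_ s).le hs
          rw [hnu, norm_smul, hyz.norm_eq, mul_one, Real.norm_eq_abs])
        refine le_trans ?_ h1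
        rw [add_comm ((2 * rd - 0) • y), add_assoc]
        refine hl.mono (by simp [hu]) (hker _ _) ?_ _
        rw [hnu]
        exact hyz.abs_le _ _
      · intro s hs
        rw [mem_ofPred_eq, hmem δ hδ] at hs ⊢
        constructor <;> linarith [hs.1, hs.2]
    have hsd' : ∀ s, 2 * sd - s = t₁ δ - t₂ δ - s := fun s => by rw [hsd]; ring
    refine ⟨rd, fun r s hs hr => ?_⟩
    have h1 := hrd r s (by
      rw [add_comm (r • y), add_assoc]
      exact (hl.norm_le_one_iff he hs (hker _ _)).2 hr)
    rw [hsd', add_comm ((2 * rd - r) • y), add_assoc] at h1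
    exact (hl.norm_le_one_iff he ((hl.abs_le_norm (hker _ _) _).trans h1) (hker _ _)).1 h1

end UniversalCentre

section NoLids

variable {E : Type*} [NormedAddCommGroup E] [NormedSpace ℝ E] {e : E} {l : E →ₗ[ℝ] ℝ} {P : ℝ}
  {t₁ t₂ : ℝ → ℝ} [FiniteDimensional ℝ E]

theorem exists_extreme_in_ker (l : E →ₗ[ℝ] ℝ) {u : E} (hu : l u = 0) (hu1 : ‖u‖ = 1) :
    ∃ y, l y = 0 ∧ ‖y‖ = 1 ∧ ∀ p p' : E, l p = 0 → l p' = 0 → ‖p‖ ≤ 1 → ‖p'‖ ≤ 1 →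
      p + p' = (2 : ℝ) • y → p = y := by
  have hl : Continuous l := l.continuous_of_finiteDimensional
  have hc : IsCompact {y : E | l y = 0 ∧ ‖y‖ ≤ 1} := by
    refine (isCompact_closedBall (0 : E) 1).of_isClosed_subset ?_ ?_
    · exact (isClosed_eq hl continuous_const).inter (isClosed_le continuous_norm continuous_const)
    · rintro y ⟨hy, hy1⟩
      rwa [mem_closedBall_zero_iff]
  obtain ⟨y, hy⟩ := hc.extremePoints_nonempty ⟨0, by simp, by simp⟩
  have hext : ∀ p p' : E, l p = 0 → l p' = 0 → ‖p‖ ≤ 1 → ‖p'‖ ≤ 1 →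
      p + p' = (2 : ℝ) • y → p = y := by
    intro p p' h1 h2 h3 h4 h5
    refine (mem_extremePoints_iff_left.1 hy).2 p ⟨h1, h3⟩ p' ⟨h2, h4⟩
      ⟨1 / 2, 1 / 2, by norm_num, by norm_num, by norm_num, ?_⟩
    rw [← smul_add, h5, smul_smul]
    norm_num
  refine ⟨y, hy.1.1, le_antisymm hy.1.2 ?_, hext⟩
  by_contra! hlt
  have hw : ‖(1 - ‖y‖) • u‖ = 1 - ‖y‖ := by
    rw [norm_smul, hu1, mul_one, Real.norm_of_nonneg (by linarith)]
  have := hext (y + (1 - ‖y‖) • u) (y - (1 - ‖y‖) • u) (by simp [hy.1.1, hu])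
    (by simp [hy.1.1, hu]) ((norm_add_le _ _).trans (by rw [hw]; linarith))
    ((norm_sub_le _ _).trans (by rw [hw]; linarith)) (by module)
  rw [add_eq_left] at this
  rw [this, norm_zero] at hw
  linarith

theorem SliceEnds.profile_one (h : SliceEnds e l P t₁ t₂) (hE : 3 ≤ Module.finrank ℝ E)
    (he : ‖e‖ = 1) (hP : 0 < P)
    (hl : IsRevolution e l) {u : E} (hu : l u = 0) (hu1 : ‖u‖ = 1) : profile e l 1 = 0 := by
  by_contra hne
  set c := profile e l 1 with hc
  have hc0 : 0 < c := lt_of_le_of_ne (hl.profile_nonneg he (by simp)) (Ne.symm hne)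
  have hc1 : c ≤ 1 := hl.profile_le_one he (by simp)
  obtain ⟨y, hy, hy1, hext⟩ := exists_extreme_in_ker l hu hu1
  have hy0 : y ≠ 0 := by
    rintro rfl
    simp at hy1
  obtain ⟨z, hyz⟩ := exists_birkhoffPair hE hl.axis hy hy0
  obtain ⟨s, hs0, hs1, hsP⟩ : ∃ s : ℝ, 0 < s ∧ s < 1 ∧ s < P :=
    ⟨min (1 / 2) (P / 2), by positivity, (min_le_left _ _).trans_lt (by norm_num),
      (min_le_right _ _).trans_lt (by linarith)⟩
  set δ := c / (2 * (P + 1)) with hδ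
  have hδ0 : 0 < δ := by positivity
  have hδc : δ * (P + 1) = c / 2 := by rw [hδ]; field_simp
  have hδP : |δ| * P < 1 := by
    rw [abs_of_pos hδ0]
    nlinarith
  have hb := h.bounds δ hδP
  have ht₁ : t₁ δ = 1 := by
    refine le_antisymm hb.2.1 ((h.mem_iff δ hδP 1 (by simp)).1 ?_).2
    rw [← hc, abs_le]
    constructor <;> nlinarith
  have ht₂ : t₂ δ = 1 := by
    have := ((h.mem_iff δ hδP (-1) (by simp)).1 (by
      rw [hl.profile_neg, ← hc, abs_le]
      constructor <;> nlinarith)).1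
    linarith [hb.2.2.2]
  obtain ⟨rd, hrd⟩ := h.reflect δ hδP y z hyz
  have hsabs : |s| < 1 := by rwa [abs_of_pos hs0]
  set φ := profile e l s with hφ
  have hφ0 : 0 < φ := hl.profile_pos he hu hu1 hsabs
  set τ := δ * (P - s) with hτ
  have hτ0 : 0 < τ := mul_pos hδ0 (by linarith)
  have hτφ : τ ≤ φ := by
    have := (h.mem_iff δ hδP s hsabs.le).2 (by rw [ht₁, ht₂]; constructor <;> linarith)
    rwa [abs_of_pos hτ0] at this
  have hcomp : IsCompact {r : ℝ | ‖r • y + τ • z‖ ≤ φ} := by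
    refine (isCompact_Icc (a := -(φ + τ)) (b := φ + τ)).of_isClosed_subset
      (isClosed_le (by fun_prop) continuous_const) fun r hr => abs_le.1 ?_
    have h1 := norm_sub_le (r • y + τ • z) (τ • z)
    rw [add_sub_cancel_right, norm_smul, norm_smul, hy1, hyz.norm_eq, Real.norm_eq_abs,
      Real.norm_of_nonneg hτ0.le] at h1
    have h2 : ‖r • y + τ • z‖ ≤ φ := hr
    linarith
  have hne' : {r : ℝ | ‖r • y + τ • z‖ ≤ φ}.Nonempty := by
    refine ⟨0, ?_⟩
    rw [mem_ofPred_eq, zero_smul, zero_add, norm_smul, hyz.norm_eq, mul_one,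
      Real.norm_of_nonneg hτ0.le]
    exact hτφ
  obtain ⟨α, hα, hαmin⟩ := hcomp.exists_isLeast hne'
  obtain ⟨β, hβ, hβmax⟩ := hcomp.exists_isGreatest hne'
  rw [mem_ofPred_eq] at hα hβ
  have hrefl : ∀ r, ‖r • y + τ • z‖ ≤ φ → ‖(2 * rd - r) • y + (δ * (P + s)) • z‖ ≤ φ := by
    intro r hr
    have := hrd r s hsabs.le hr
    rwa [ht₁, ht₂, sub_self, zero_sub, hl.profile_neg, sub_neg_eq_add] at this
  set k := (P - s) / (P + s) with hk
  have hk0 : 0 < k := div_pos (by linarith) (by linarith)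
  have hk1 : k < 1 := (div_lt_one (by linarith)).2 (by linarith)
  have hkτ : k * (δ * (P + s)) = τ := by
    have : P + s ≠ 0 := by linarith
    rw [hk, hτ]
    field_simp
  have hconv : ∀ r σ : ℝ, ‖r • y + (δ * (P + s)) • z‖ ≤ φ → |σ| = 1 →
      ‖((1 - k) * (σ * φ) + k * r) • y + τ • z‖ ≤ φ := by
    intro r σ hr hσ
    have e1 : ((1 - k) * (σ * φ) + k * r) • y + τ • z =
        ((1 - k) * (σ * φ)) • y + k • (r • y + (δ * (P + s)) • z) := by
      rw [← hkτ]
      module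
    rw [e1]
    refine (norm_add_le _ _).trans ?_
    rw [norm_smul, norm_smul, hy1, Real.norm_of_nonneg hk0.le, mul_one, norm_mul, norm_mul,
      Real.norm_eq_abs σ, hσ, Real.norm_of_nonneg hφ0.le, Real.norm_of_nonneg (by linarith)]
    nlinarith
  have h1 := hβmax (hconv _ 1 (hrefl α hα) (by simp))
  have h2 := hαmin (hconv _ (-1) (hrefl β hβ) (by simp))
  have h3 : 2 * φ ≤ β - α := by
    have : (1 - k) * (2 * φ) ≤ (1 - k) * (β - α) := by linarith
    exact le_of_mul_le_mul_left this (by linarith)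
  set m := 2 / (β - α) with hm
  have hm0 : 0 < m := div_pos two_pos (by linarith)
  have hmφ : m * φ ≤ 1 := by
    rw [hm, div_mul_eq_mul_div, div_le_one (by linarith)]
    exact h3
  have hbound : ∀ σ r : ℝ, |σ| = 1 → ‖r • y + τ • z‖ ≤ φ → ‖(σ * m) • (r • y + τ • z)‖ ≤ 1 := by
    intro σ r hσ hr
    rw [norm_smul, norm_mul, Real.norm_eq_abs σ, hσ, one_mul, Real.norm_of_nonneg hm0.le]
    exact (mul_le_mul_of_nonneg_left hr hm0.le).trans hmφ
  have hker : ∀ c r q : ℝ, l (c • (r • y + q • z)) = 0 := by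
    intro c r q
    simp [hyz.map_left, hyz.map_right]
  have h4 := hext ((1 * m) • (β • y + τ • z)) ((-1 * m) • (α • y + τ • z)) (hker _ _ _)
    (hker _ _ _) (hbound 1 β (by simp) hβ) (hbound (-1) α (by simp) hα) (by
      have : m * (β - α) = 2 := div_mul_cancel₀ _ (by linarith)
      rw [← this]
      module)
  have h5 := hyz.independent (m * β - 1) (m * τ) (by
    have e1 : (m * β - 1) • y + (m * τ) • z = (1 * m) • (β • y + τ • z) - y := by module
    rw [e1, h4, sub_self])
  exact (mul_pos hm0 hτ0).ne' h5.2

end NoLids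

section SymmetricSlices

variable {E : Type*} [NormedAddCommGroup E] [NormedSpace ℝ E] {e : E} {l : E →ₗ[ℝ] ℝ} {P : ℝ}
  {t₁ t₂ : ℝ → ℝ} [FiniteDimensional ℝ E]

theorem SliceEnds.one_sub_le (h : SliceEnds e l P t₁ t₂) (he : ‖e‖ = 1) (hP : 0 < P)
    (hl : IsRevolution e l) {u : E} (hu : l u = 0) (hu1 : ‖u‖ = 1) {δ ε : ℝ} (hε : ε < 1)
    (hδ : |δ| * (P + 1) ≤ ε) : |δ| * P < 1 ∧ 1 - ε ≤ t₁ δ ∧ 1 - ε ≤ t₂ δ := by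
  have hδ0 := abs_nonneg δ
  have hε0 : 0 ≤ ε := le_trans (by positivity) hδ
  have h1 : |δ| * P < 1 := by nlinarith
  have h2 : ∀ s, |s| = 1 - ε → |δ * (P - s)| ≤ profile e l s := by
    intro s hs
    have h3 := hl.one_sub_abs_le_profile he hu hu1 (s := s) (by linarith)
    have h4 : |P - s| ≤ P + 1 := by
      refine (abs_sub _ _).trans ?_
      rw [abs_of_pos hP]
      linarith
    rw [abs_mul]
    nlinarith
  refine ⟨h1, ?_, ?_⟩
  · exact ((h.mem_iff δ h1 (1 - ε) (by rw [abs_of_nonneg] <;> linarith)).1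
      (h2 _ (abs_of_nonneg (by linarith)))).2
  · have := ((h.mem_iff δ h1 (-(1 - ε)) (by rw [abs_neg, abs_of_nonneg] <;> linarith)).1
      (h2 _ (by rw [abs_neg, abs_of_nonneg]; linarith))).1
    linarith

theorem SliceEnds.profile_end (h : SliceEnds e l P t₁ t₂) (he : ‖e‖ = 1)
    (hl : IsRevolution e l) {u : E} (hu : l u = 0) (hu1 : ‖u‖ = 1) (hlid : profile e l 1 = 0)
    {δ : ℝ} (hδ : |δ| * P < 1) {s : ℝ} (hs : s = t₁ δ ∨ s = -t₂ δ) :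
    profile e l s = |δ * (P - s)| := by
  obtain ⟨b1, b2, b3, b4⟩ := h.bounds δ hδ
  have hs1 : |s| ≤ 1 := by
    rw [abs_le]
    rcases hs with rfl | rfl <;> constructor <;> linarith
  have hle := (h.mem_iff δ hδ s hs1).2 (by rcases hs with rfl | rfl <;> constructor <;> linarith)
  refine le_antisymm ?_ hle
  by_contra! hlt
  have hs2 : |s| < 1 := by
    refine lt_of_le_of_ne hs1 fun h1 => ?_
    have : profile e l s = 0 := by
      rcases abs_choice s with h2 | h2
      · rw [← h2, h1, hlid]
      · rw [← hl.profile_neg, ← h2, h1, hlid]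
    rw [this] at hlt
    exact absurd (abs_nonneg _) (not_le.2 hlt)
  have hcont := (hl.profile_continuousOn he hu hu1).continuousAt (isOpen_Ioo.mem_nhds (abs_lt.1 hs2))
  have hev : ∀ᶠ x in 𝓝 s, -t₂ δ ≤ x ∧ x ≤ t₁ δ := by
    have h1 : ∀ᶠ x in 𝓝 s, |δ * (P - x)| < profile e l x :=
      Tendsto.eventually_lt (by fun_prop : Continuous fun x => |δ * (P - x)|).continuousAt hcont hlt
    filter_upwards [h1, isOpen_Ioo.mem_nhds (abs_lt.1 hs2)] with x hx hx2
    exact (h.mem_iff δ hδ x (abs_lt.2 hx2).le).1 hx.le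
  rcases hs with rfl | rfl
  · obtain ⟨x, hx, hx2⟩ := ((hev.filter_mono nhdsWithin_le_nhds).and
      (self_mem_nhdsWithin (s := Ioi (t₁ δ)))).exists
    exact absurd hx.2 (not_le.2 hx2)
  · obtain ⟨x, hx, hx2⟩ := ((hev.filter_mono nhdsWithin_le_nhds).and
      (self_mem_nhdsWithin (s := Iio (-t₂ δ)))).exists
    exact absurd hx.1 (not_le.2 hx2)

theorem SliceEnds.reflect_neg (h : SliceEnds e l P t₁ t₂) (he : ‖e‖ = 1) (hP : 0 < P)
    (hl : IsRevolution e l) {u : E} (hu : l u = 0) (hu1 : ‖u‖ = 1) (hlid : profile e l 1 = 0)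
    {δ : ℝ} (hδ0 : 0 < δ) (hδ1 : δ * (P + 1) ≤ 1 / 2) (hδ2 : δ * (P + 1) ≤ P) {y z : E}
    (hyz : BirkhoffPair l y z) {r s : ℝ} (hs : |s| ≤ 1)
    (hr : ‖r • y + (δ * (P - s)) • z‖ ≤ profile e l s) :
    ‖(-r) • y + (δ * (P - (t₁ δ - t₂ δ - s))) • z‖ ≤ profile e l (t₁ δ - t₂ δ - s) := by
  obtain ⟨hδ, e1, e2⟩ := h.one_sub_le he hP hl hu hu1 (δ := δ) (ε := δ * (P + 1)) (by linarith)
    (by rw [abs_of_pos hδ0])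
  obtain ⟨b1, b2, b3, b4⟩ := h.bounds δ hδ
  obtain ⟨rd, hrd⟩ := h.reflect δ hδ y z hyz
  suffices h0 : rd = 0 by
    have := hrd r s hs hr
    rwa [h0, mul_zero, zero_sub] at this
  have hcomp : IsCompact {r : ℝ | ‖r • y + z‖ ≤ 1} := by
    have hy := norm_pos_iff.2 hyz.ne_zero
    refine (isCompact_Icc (a := -(2 / ‖y‖)) (b := 2 / ‖y‖)).of_isClosed_subset
      (isClosed_le (by fun_prop) continuous_const) fun r hr => abs_le.1 ?_
    have h1 := norm_sub_le (r • y + z) z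
    rw [add_sub_cancel_right, norm_smul, hyz.norm_eq, Real.norm_eq_abs] at h1
    have h2 : ‖r • y + z‖ ≤ 1 := hr
    rw [le_div_iff₀ hy]
    linarith
  have hne : {r : ℝ | ‖r • y + z‖ ≤ 1}.Nonempty := ⟨0, by simp [hyz.norm_eq]⟩
  obtain ⟨α, hα, hαmin⟩ := hcomp.exists_isLeast hne
  obtain ⟨β, hβ, hβmax⟩ := hcomp.exists_isGreatest hne
  rw [mem_ofPred_eq] at hα hβ
  have hαβ : α ≤ β := hαmin hβ
  have hmem : ∀ q r : ℝ, ‖r • y + z‖ ≤ 1 → ‖(q * r) • y + q • z‖ ≤ |q| := by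
    intro q r hr
    rw [mul_smul, ← smul_add, norm_smul, Real.norm_eq_abs]
    exact mul_le_of_le_one_right (abs_nonneg q) hr
  have hwidth : ∀ q r r' : ℝ, ‖r • y + q • z‖ ≤ |q| → ‖r' • y + q • z‖ ≤ |q| →
      |r - r'| ≤ |q| * (β - α) := by
    intro q r r' hr hr'
    by_cases hq : q = 0
    · have hz : ∀ r : ℝ, ‖r • y + q • z‖ ≤ |q| → r = 0 := by
        intro r hr
        rw [hq, zero_smul, add_zero, abs_zero, norm_le_zero_iff] at hr
        exact (smul_eq_zero.1 hr).resolve_right hyz.ne_zero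
      rw [hz r hr, hz r' hr', hq]
      simp
    · have hI : ∀ r : ℝ, ‖r • y + q • z‖ ≤ |q| → α ≤ r / q ∧ r / q ≤ β := by
        intro r hr
        have h1 : ‖(r / q) • y + z‖ ≤ 1 := by
          have h2 : r • y + q • z = q • ((r / q) • y + z) := by
            rw [smul_add, smul_smul, mul_div_cancel₀ _ hq]
          rw [h2, norm_smul, Real.norm_eq_abs] at hr
          exact le_of_mul_le_mul_left (by linarith) (abs_pos.2 hq)
        exact ⟨hαmin h1, hβmax h1⟩
      have h1 := hI r hr
      have h2 := hI r' hr'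
      have h3 : |r / q - r' / q| ≤ β - α := by
        rw [abs_le]
        constructor <;> linarith
      rw [← sub_div, abs_div, div_le_iff₀ (abs_pos.2 hq)] at h3
      linarith
  have hp1 := h.profile_end he hl hu hu1 hlid hδ (s := t₁ δ) (Or.inl rfl)
  have hp2 := h.profile_end he hl hu hu1 hlid hδ (s := -t₂ δ) (Or.inr rfl)
  set q₁ := δ * (P - t₁ δ) with hq₁
  set q₂ := δ * (P - -t₂ δ) with hq₂
  have hr1 : ∀ r : ℝ, ‖r • y + q₁ • z‖ ≤ |q₁| → ‖(2 * rd - r) • y + q₂ • z‖ ≤ |q₂| := by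
    intro r hr
    have := hrd r (t₁ δ) (abs_le.2 ⟨by linarith, b2⟩) (by rwa [hp1])
    rwa [show t₁ δ - t₂ δ - t₁ δ = -t₂ δ by ring, hp2] at this
  have hr2 : ∀ r : ℝ, ‖r • y + q₂ • z‖ ≤ |q₂| → ‖(2 * rd - r) • y + q₁ • z‖ ≤ |q₁| := by
    intro r hr
    have := hrd r (-t₂ δ) (abs_le.2 ⟨by linarith, by linarith⟩) (by rwa [hp2])
    rwa [show t₁ δ - t₂ δ - -t₂ δ = t₁ δ by ring, hp1] at this
  have k1 : |q₁| * (β - α) ≤ |q₂| * (β - α) := by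
    have := hwidth q₂ _ _ (hr1 _ (hmem q₁ α hα)) (hr1 _ (hmem q₁ β hβ))
    rwa [show 2 * rd - q₁ * α - (2 * rd - q₁ * β) = q₁ * (β - α) by ring, abs_mul,
      abs_of_nonneg (sub_nonneg.2 hαβ)] at this
  have k2 : |q₂| * (β - α) ≤ |q₁| * (β - α) := by
    have := hwidth q₁ _ _ (hr2 _ (hmem q₂ α hα)) (hr2 _ (hmem q₂ β hβ))
    rwa [show 2 * rd - q₂ * α - (2 * rd - q₂ * β) = q₂ * (β - α) by ring, abs_mul,
      abs_of_nonneg (sub_nonneg.2 hαβ)] at this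
  have hD : β - α = 0 := by
    by_contra hD
    have h1 : |q₁| = |q₂| := mul_right_cancel₀ hD (le_antisymm k1 k2)
    rw [hq₁, hq₂, abs_mul, abs_mul] at h1
    have h2 := mul_left_cancel₀ (abs_pos.2 hδ0.ne').ne' h1
    rcases abs_eq_abs.1 h2 with h3 | h3 <;> linarith
  have h1 := hmem q₁ 0 (by simp [hyz.norm_eq])
  have h2 := hmem q₂ 0 (by simp [hyz.norm_eq])
  rw [mul_zero] at h1 h2
  have h3 := hwidth q₂ _ _ (hr1 _ h1) h2
  rw [hD, mul_zero, abs_nonpos_iff] at h3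
  linarith

theorem SliceEnds.symmetricSlices (h : SliceEnds e l P t₁ t₂) (he : ‖e‖ = 1) (hP : 0 < P)
    (hl : IsRevolution e l) {u : E} (hu : l u = 0) (hu1 : ‖u‖ = 1) (hlid : profile e l 1 = 0) :
    ∃ τ₀ : ℝ, 0 < τ₀ ∧ τ₀ < 1 ∧ SymmetricSlices (LinearMap.ker l) τ₀ := by
  set δ₀ := min (1 / 2) P / (P + 1) with hδ₀
  have hδ₀0 : 0 < δ₀ := by positivity
  have hδ₀e : δ₀ * (P + 1) = min (1 / 2) P := div_mul_cancel₀ _ (by linarith)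
  have hsmall : ∀ δ ∈ Icc 0 δ₀, δ * (P + 1) ≤ 1 / 2 ∧ δ * (P + 1) ≤ P := by
    intro δ hδ
    have h1 : δ * (P + 1) ≤ min (1 / 2) P := by
      rw [← hδ₀e]
      exact mul_le_mul_of_nonneg_right hδ.2 (by linarith)
    exact ⟨h1.trans (min_le_left _ _), h1.trans (min_le_right _ _)⟩
  have hends : ∀ δ ∈ Icc 0 δ₀, |δ| * P < 1 ∧ 1 - δ * (P + 1) ≤ t₁ δ ∧ 1 - δ * (P + 1) ≤ t₂ δ :=
    fun δ hδ => h.one_sub_le he hP hl hu hu1 (by linarith [hsmall δ hδ])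
      (by rw [abs_of_nonneg hδ.1])
  set sd : ℝ → ℝ := fun δ => (t₁ δ - t₂ δ) / 2 with hsd
  have hsub : Icc 0 δ₀ ⊆ {δ | |δ| * P < 1} := fun δ hδ => (hends δ hδ).1
  have hsdc : ContinuousOn sd (Icc 0 δ₀) :=
    ((h.cont₁.mono hsub).sub (h.cont₂.mono hsub)).div_const 2
  have hsd1 : ∀ δ ∈ Icc 0 δ₀, |sd δ| < 1 ∧ sd δ < P := by
    intro δ hδ
    obtain ⟨a, b, c⟩ := hends δ hδ
    obtain ⟨b1, b2, b3, b4⟩ := h.bounds δ a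
    have := hsmall δ hδ
    simp only [hsd]
    refine ⟨abs_lt.2 ⟨by linarith, by linarith⟩, by linarith⟩
  set τ : ℝ → ℝ := fun δ => δ * (P - sd δ) / profile e l (sd δ) with hτ
  have hpos : ∀ δ ∈ Icc 0 δ₀, 0 < profile e l (sd δ) := fun δ hδ =>
    hl.profile_pos he hu hu1 (hsd1 δ hδ).1
  have hτc : ContinuousOn τ (Icc 0 δ₀) := by
    refine (continuousOn_id.mul (continuousOn_const.sub hsdc)).div ?_ fun δ hδ => (hpos δ hδ).ne'
    exact (hl.profile_continuousOn he hu hu1).comp hsdc fun δ hδ => abs_lt.1 (hsd1 δ hδ).1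
  have hτ0 : τ 0 = 0 := by simp [hτ]
  have hmem0 : δ₀ ∈ Icc 0 δ₀ := ⟨hδ₀0.le, le_rfl⟩
  have hτpos : 0 < τ δ₀ :=
    div_pos (mul_pos hδ₀0 (by linarith [(hsd1 δ₀ hmem0).2])) (hpos δ₀ hmem0)
  refine ⟨min (1 / 2) (τ δ₀), by positivity, (min_le_left _ _).trans_lt (by norm_num), ?_⟩
  intro y z hy hz hbir t ht0 ht r hr
  obtain ⟨δ, hδ, hδt⟩ := intermediate_value_Icc hδ₀0.le hτc
    (show t ∈ Icc (τ 0) (τ δ₀) from ⟨by rw [hτ0]; exact ht0.le, ht.trans (min_le_right _ _)⟩)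
  have hδ0 : 0 < δ := by
    refine lt_of_le_of_ne hδ.1 fun h0 => ?_
    rw [← h0, hτ0] at hδt
    exact ht0.ne hδt
  have hp := hpos δ hδ
  have hpt : profile e l (sd δ) * t = δ * (P - sd δ) := by
    rw [← hδt]
    exact mul_div_cancel₀ _ hp.ne'
  have hrel : ∀ r : ℝ, ‖(profile e l (sd δ) * r) • (y : E) + (δ * (P - sd δ)) • (z : E)‖ =
      profile e l (sd δ) * ‖r • y + t • z‖ := by
    intro r
    rw [← hpt, mul_smul, mul_smul, ← smul_add, norm_smul, Real.norm_of_nonneg hp.le]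
    rfl
  have h1 := h.reflect_neg he hP hl hu hu1 hlid hδ0 (hsmall δ hδ).1 (hsmall δ hδ).2
    (BirkhoffPair.ofKer hy hz hbir) (r := profile e l (sd δ) * r) (s := sd δ) (hsd1 δ hδ).1.le
    (by rw [hrel]; exact mul_le_of_le_one_right hp.le hr)
  rw [show t₁ δ - t₂ δ - sd δ = sd δ by simp only [hsd]; ring, ← mul_neg, hrel] at h1
  exact le_of_mul_le_mul_left (by linarith) hp

end SymmetricSlices

section NormTheorem

theorem exists_quadratic_of_grid {Φ : ℝ → ℝ} (hΦ : ContinuousOn Φ (Ioo (-1) 1))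
    {h ε A : ℕ → ℝ} (hpos : ∀ k, 0 < h k) (hh : Tendsto h atTop (𝓝 0))
    (hε : Tendsto ε atTop (𝓝 0))
    (hgrid : ∀ k (m : ℕ), m * h k ≤ 1 - ε k → Φ (m * h k) = 1 - A k * (m * h k) ^ 2) :
    ∃ a : ℝ, ∀ s, 0 < s → s < 1 → Φ s = 1 - a * s ^ 2 := by
  have key : ∀ s, 0 < s → s < 1 → Tendsto A atTop (𝓝 ((1 - Φ s) / s ^ 2)) := by
    intro s hs0 hs1
    set x : ℕ → ℝ := fun k => (⌊s / h k⌋₊ : ℝ) * h k with hx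
    have hx1 : ∀ k, x k ≤ s := fun k =>
      (mul_le_mul_of_nonneg_right (Nat.floor_le (div_pos hs0 (hpos k)).le) (hpos k).le).trans
        (div_mul_cancel₀ _ (hpos k).ne').le
    have hx2 : ∀ k, s - h k ≤ x k := by
      intro k
      have h1 := mul_lt_mul_of_pos_right (Nat.lt_floor_add_one (s / h k)) (hpos k)
      rw [div_mul_cancel₀ _ (hpos k).ne'] at h1
      simp only [hx]
      linarith
    have hxt : Tendsto x atTop (𝓝 s) :=
      tendsto_of_tendsto_of_tendsto_of_le_of_le (by simpa using tendsto_const_nhds.sub hh)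
        tendsto_const_nhds hx2 hx1
    have hΦs : Tendsto (fun k => Φ (x k)) atTop (𝓝 (Φ s)) :=
      ((hΦ.continuousAt (isOpen_Ioo.mem_nhds ⟨by linarith, hs1⟩)).tendsto).comp hxt
    have hlim : Tendsto (fun k => (1 - Φ (x k)) / x k ^ 2) atTop (𝓝 ((1 - Φ s) / s ^ 2)) :=
      (tendsto_const_nhds.sub hΦs).div (hxt.pow 2) (by positivity)
    refine hlim.congr' ?_
    filter_upwards [hε.eventually_lt_const (sub_pos.2 hs1), hxt.eventually_const_lt hs0] with k hk hk0
    have := hgrid k ⌊s / h k⌋₊ (by have := hx1 k; simp only [hx] at this; linarith)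
    change Φ (x k) = 1 - A k * x k ^ 2 at this
    rw [this]
    field_simp
    ring
  refine ⟨(1 - Φ (1 / 2)) / (1 / 2) ^ 2, fun s hs0 hs1 => ?_⟩
  rw [tendsto_nhds_unique (key (1 / 2) (by norm_num) (by norm_num)) (key s hs0 hs1)]
  field_simp
  ring

variable {E : Type*} [NormedAddCommGroup E] [NormedSpace ℝ E] {e : E} {l : E →ₗ[ℝ] ℝ} {P : ℝ}
  {t₁ t₂ : ℝ → ℝ} [FiniteDimensional ℝ E]

theorem SliceEnds.profile_sq_sub (h : SliceEnds e l P t₁ t₂) (he : ‖e‖ = 1) (hP : 0 < P)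
    (hl : IsRevolution e l) {u : E} (hu : l u = 0) (hu1 : ‖u‖ = 1) (hlid : profile e l 1 = 0)
    {y z : E} (hyz : BirkhoffPair l y z)
    (hsq : ∀ r q : ℝ, ‖r • y + q • z‖ ^ 2 = r ^ 2 + q ^ 2)
    {δ : ℝ} (hδ0 : 0 < δ) (hδ1 : δ * (P + 1) ≤ 1 / 2) (hδ2 : δ * (P + 1) ≤ P) {s : ℝ}
    (hs1 : -t₂ δ ≤ s) (hs2 : s ≤ t₁ δ) :
    profile e l s ^ 2 - (δ * (P - s)) ^ 2 = profile e l (t₁ δ - t₂ δ - s) ^ 2 -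
      (δ * (P - (t₁ δ - t₂ δ - s))) ^ 2 := by
  obtain ⟨hδ, -, -⟩ := h.one_sub_le he hP hl hu hu1 (δ := δ) (ε := δ * (P + 1)) (by linarith)
    (by rw [abs_of_pos hδ0])
  obtain ⟨b1, b2, b3, b4⟩ := h.bounds δ hδ
  have key : ∀ s, -t₂ δ ≤ s → s ≤ t₁ δ → profile e l s ^ 2 - (δ * (P - s)) ^ 2 ≤
      profile e l (t₁ δ - t₂ δ - s) ^ 2 - (δ * (P - (t₁ δ - t₂ δ - s))) ^ 2 := by
    intro s hs1 hs2
    have hs : |s| ≤ 1 := abs_le.2 ⟨by linarith, by linarith⟩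
    have hφ := hl.profile_nonneg he hs
    have h1 := (h.mem_iff δ hδ s hs).2 ⟨hs1, hs2⟩
    have h2 : 0 ≤ profile e l s ^ 2 - (δ * (P - s)) ^ 2 :=
      sub_nonneg.2 (sq_le_sq.2 (h1.trans (le_abs_self _)))
    have h3 := Real.sq_sqrt h2
    set r := √(profile e l s ^ 2 - (δ * (P - s)) ^ 2) with hr
    have h4 : ‖r • y + (δ * (P - s)) • z‖ ≤ profile e l s := by
      refine abs_le_of_sq_le_sq' ?_ hφ |>.2
      rw [hsq, h3]
      linarith
    have h5 := h.reflect_neg he hP hl hu hu1 hlid hδ0 hδ1 hδ2 hyz hs h4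
    have h6 := pow_le_pow_left₀ (norm_nonneg _) h5 2
    rw [hsq, neg_sq, h3] at h6
    linarith
  refine le_antisymm (key s hs1 hs2) ?_
  have := key (t₁ δ - t₂ δ - s) (by linarith) (by linarith)
  rwa [sub_sub_cancel] at this

theorem SliceEnds.exists_profile_sq (h : SliceEnds e l P t₁ t₂) (he : ‖e‖ = 1) (hP : 0 < P)
    (hl : IsRevolution e l) {u : E} (hu : l u = 0) (hu1 : ‖u‖ = 1) (hlid : profile e l 1 = 0)
    {y z : E} (hyz : BirkhoffPair l y z)
    (hsq : ∀ r q : ℝ, ‖r • y + q • z‖ ^ 2 = r ^ 2 + q ^ 2) :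
    ∃ a : ℝ, ∀ s, 0 < s → s < 1 → profile e l s ^ 2 = 1 - a * s ^ 2 := by
  have hφ0 : profile e l 0 = 1 := le_antisymm (hl.profile_le_one he (by simp))
    (by simpa using hl.one_sub_abs_le_profile he hu hu1 (s := 0) (by simp))
  set ε : ℕ → ℝ := fun k => min (1 / 2) P / ((k : ℝ) + 1) with hε
  set δ : ℕ → ℝ := fun k => ε k / (P + 1) with hδ
  have hε0 : ∀ k, 0 < ε k := fun k => by simp only [hε]; positivity
  have hδ0 : ∀ k, 0 < δ k := fun k => div_pos (hε0 k) (by linarith)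
  have hδε : ∀ k, δ k * (P + 1) = ε k := fun k => div_mul_cancel₀ _ (by linarith)
  have hεle : ∀ k, ε k ≤ min (1 / 2) P := fun k =>
    div_le_self (by positivity) (by have := Nat.cast_nonneg (α := ℝ) k; linarith)
  have hε1 : ∀ k, ε k ≤ 1 / 2 := fun k => (hεle k).trans (min_le_left _ _)
  have hε2 : ∀ k, ε k ≤ P := fun k => (hεle k).trans (min_le_right _ _)
  have hεt : Tendsto ε atTop (𝓝 0) := by
    have := (tendsto_one_div_add_atTop_nhds_zero_nat (𝕜 := ℝ)).const_mul (min (1 / 2) P)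
    rw [mul_zero] at this
    refine this.congr fun k => ?_
    simp only [hε]
    ring
  have hends : ∀ k, |δ k| * P < 1 ∧ 1 - ε k ≤ t₁ (δ k) ∧ 1 - ε k ≤ t₂ (δ k) := fun k =>
    h.one_sub_le he hP hl hu hu1 (by linarith [hε1 k]) (by rw [abs_of_pos (hδ0 k), hδε])
  set d : ℕ → ℝ := fun k => t₁ (δ k) - t₂ (δ k) with hd
  have hdle : ∀ k, |d k| ≤ ε k := by
    intro k
    obtain ⟨a, b, c⟩ := hends k
    obtain ⟨b1, b2, b3, b4⟩ := h.bounds _ a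
    exact abs_le.2 ⟨by simp only [hd]; linarith, by simp only [hd]; linarith⟩
  have hstep : ∀ k s, |s| ≤ 1 - ε k → profile e l s ^ 2 - profile e l (s - d k) ^ 2 =
      δ k ^ 2 * (2 * P - d k) * (d k - 2 * s) := by
    intro k s hs
    obtain ⟨a, b, c⟩ := hends k
    have hs' := abs_le.1 hs
    have h1 := h.profile_sq_sub he hP hl hu hu1 hlid hyz hsq (hδ0 k) (by rw [hδε]; exact hε1 k)
      (by rw [hδε]; exact hε2 k) (s := s) (by linarith) (by linarith)
    change profile e l s ^ 2 - _ = profile e l (d k - s) ^ 2 - (δ k * (P - (d k - s))) ^ 2 at h1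
    rw [← hl.profile_neg (d k - s), neg_sub] at h1
    linarith
  have hC : ∀ k, 0 < δ k ^ 2 * (2 * P - d k) := fun k =>
    mul_pos (pow_pos (hδ0 k) 2) (by linarith [le_abs_self (d k), hdle k, hε2 k])
  have hdne : ∀ k, d k ≠ 0 := by
    intro k hk
    have := hstep k (1 / 2) (by rw [abs_of_pos (by norm_num)]; linarith [hε1 k])
    have h2 := hC k
    rw [hk] at this h2
    rw [sub_zero, sub_self] at this
    linarith
  refine exists_quadratic_of_grid (Φ := fun s => profile e l s ^ 2) (h := fun k => |d k|) (ε := ε)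
    (A := fun k => δ k ^ 2 * (2 * P - d k) / d k)
    ((hl.profile_continuousOn he hu hu1).pow 2) (fun k => abs_pos.2 (hdne k))
    (squeeze_zero (fun k => abs_nonneg _) hdle hεt) hεt ?_
  intro k m hm
  have hsgn : profile e l (m * |d k|) = profile e l (m * d k) := by
    rcases abs_choice (d k) with h1 | h1 <;> rw [h1]
    rw [mul_neg, hl.profile_neg]
  simp only [hsgn]
  rw [mul_pow, sq_abs]
  have hgoal : ∀ m : ℕ, m * |d k| ≤ 1 - ε k → profile e l (m * d k) ^ 2 =
      1 - δ k ^ 2 * (2 * P - d k) * d k * (m : ℝ) ^ 2 := by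
    intro m
    induction m with
    | zero => simp [hφ0]
    | succ m ih =>
      intro hm
      have h0 := abs_nonneg (d k)
      push_cast at hm ⊢
      have h1 := ih (by linarith)
      have h2 := hstep k ((m + 1) * d k) (by
        rw [abs_mul, abs_of_nonneg (by positivity)]
        exact hm)
      rw [show ((m : ℝ) + 1) * d k - d k = m * d k by ring] at h2
      linarith
  rw [hgoal m hm]
  have := hdne k
  field_simp

theorem IsRevolution.norm_sq_eq (hl : IsRevolution e l) (he : ‖e‖ = 1)
    {u : E} (hu : l u = 0) (hu1 : ‖u‖ = 1) (hlid : profile e l 1 = 0) {a : ℝ}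
    (ha : ∀ s, 0 < s → s < 1 → profile e l s ^ 2 = 1 - a * s ^ 2) {y : E} (hy : l y = 0) (s : ℝ) :
    ‖s • e + y‖ ^ 2 = s ^ 2 + ‖y‖ ^ 2 := by
  have ha1 : a ≤ 1 := by
    by_contra! h1
    have h2 := ha ((a + 1) / (2 * a)) (by positivity)
      ((div_lt_one (by positivity)).2 (by linarith))
    have h3 : a * ((a + 1) / (2 * a)) ^ 2 = 1 + (a - 1) ^ 2 / (4 * a) := by
      field_simp
      ring
    have h4 : 0 < (a - 1) ^ 2 / (4 * a) := div_pos (pow_pos (by linarith) 2) (by linarith)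
    nlinarith [sq_nonneg (profile e l ((a + 1) / (2 * a)))]
  have ha0 : 0 ≤ a := by
    have h1 := ha (1 / 2) (by norm_num) (by norm_num)
    have h2 := hl.profile_le_one he (s := 1 / 2) (by rw [abs_of_pos] <;> norm_num)
    have h3 := hl.profile_nonneg he (s := 1 / 2) (by rw [abs_of_pos] <;> norm_num)
    nlinarith
  have ha2 : 1 ≤ a := by
    by_contra! h1
    have hc : 0 < √(1 - a) := Real.sqrt_pos.2 (by linarith)
    have hcs : √(1 - a) ^ 2 = 1 - a := Real.sq_sqrt (by linarith)
    have hcn : ‖√(1 - a) • u‖ = √(1 - a) := by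
      rw [norm_smul, hu1, mul_one, Real.norm_of_nonneg hc.le]
    have h2 : ∀ᶠ s in 𝓝[<] (1 : ℝ), ‖s • e + √(1 - a) • u‖ ≤ 1 := by
      filter_upwards [Ioo_mem_nhdsLT (zero_lt_one' ℝ)] with s hs
      have hs1 : |s| ≤ 1 := _root_.abs_le.2 ⟨by linarith [hs.1], hs.2.le⟩
      rw [hl.norm_le_one_iff he hs1 (by simp [hu]), hcn]
      refine abs_le_of_sq_le_sq' ?_ (hl.profile_nonneg he hs1) |>.2
      rw [hcs, ha s hs.1 hs.2]
      have : s ^ 2 ≤ 1 := by nlinarith [hs.1, hs.2]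
      nlinarith
    have h3 : Tendsto (fun s : ℝ => ‖s • e + √(1 - a) • u‖) (𝓝[<] 1)
        (𝓝 ‖(1 : ℝ) • e + √(1 - a) • u‖) :=
      (by fun_prop : Continuous fun s : ℝ => ‖s • e + √(1 - a) • u‖).continuousAt.tendsto.mono_left
        nhdsWithin_le_nhds
    have h4 := le_of_tendsto h3 h2
    rw [hl.norm_le_one_iff he (by simp) (by simp [hu]), hcn, hlid] at h4
    linarith
  have haeq : a = 1 := le_antisymm ha1 ha2
  have hφ : ∀ s, |s| < 1 → profile e l s ^ 2 = 1 - s ^ 2 := by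
    intro s hs
    rcases lt_trichotomy s 0 with h | h | h
    · rw [abs_of_neg h] at hs
      rw [← hl.profile_neg, ha (-s) (by linarith) hs, haeq]
      ring
    · rw [h, le_antisymm (hl.profile_le_one he (by simp))
        (by simpa using hl.one_sub_abs_le_profile he hu hu1 (s := 0) (by simp))]
      ring
    · rw [abs_of_pos h] at hs
      rw [ha s h hs, haeq]
      ring
  have hiff : ∀ t, |s| < t → (‖s • e + y‖ ≤ t ↔ s ^ 2 + ‖y‖ ^ 2 ≤ t ^ 2) := by
    intro t ht
    have ht0 : 0 < t := (abs_nonneg s).trans_lt ht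
    have h1 : |s / t| < 1 := by
      rw [abs_div, abs_of_pos ht0]
      exact (div_lt_one ht0).2 ht
    have h2 := hl.norm_le_one_iff he h1.le (y := t⁻¹ • y) (by simp [hy])
    have e1 : (s / t) • e + t⁻¹ • y = t⁻¹ • (s • e + y) := by
      rw [smul_add, smul_smul]
      congr 2
      ring
    rw [e1, norm_smul, norm_smul, norm_inv, Real.norm_of_nonneg ht0.le,
      inv_mul_le_iff₀ ht0, mul_one] at h2
    rw [h2, ← sq_le_sq₀ (by positivity) (hl.profile_nonneg he h1.le), hφ _ h1, mul_pow, inv_pow,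
      div_pow, inv_mul_le_iff₀ (by positivity), mul_sub, mul_div_cancel₀ _ (by positivity)]
    constructor <;> intro h <;> linarith
  by_cases hy0 : y = 0
  · rw [hy0, add_zero, norm_axis he, norm_zero, sq_abs]
    ring
  have hyn := norm_pos_iff.2 hy0
  refine le_antisymm ?_ ?_
  · have h0 : 0 ≤ s ^ 2 + ‖y‖ ^ 2 := by positivity
    have h1 : |s| < √(s ^ 2 + ‖y‖ ^ 2) := by
      rw [← Real.sqrt_sq_eq_abs]
      exact Real.sqrt_lt_sqrt (sq_nonneg s) (by nlinarith)
    have h2 := (hiff _ h1).2 (Real.sq_sqrt h0).ge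
    calc ‖s • e + y‖ ^ 2 ≤ √(s ^ 2 + ‖y‖ ^ 2) ^ 2 := pow_le_pow_left₀ (norm_nonneg _) h2 2
      _ = _ := Real.sq_sqrt h0
  · have h1 : √(s ^ 2 + ‖y‖ ^ 2) ≤ ‖s • e + y‖ := by
      refine le_of_forall_gt_imp_ge_of_dense fun t ht => ?_
      have h2 := (hiff t ((hl.abs_le_norm hy s).trans_lt ht)).1 ht.le
      exact Real.sqrt_le_iff.2 ⟨(norm_nonneg _).trans ht.le, h2⟩
    rwa [Real.sqrt_le_left (norm_nonneg _)] at h1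

/-- A normed space whose unit ball has a false centre satisfies the parallelogram law. -/
theorem FalseCentre.parallelogram (hE : 3 ≤ Module.finrank ℝ E) (h : FalseCentre e P)
    (he : ‖e‖ = 1) (hP : 0 < P) (x y : E) :
    ‖x + y‖ ^ 2 + ‖x - y‖ ^ 2 = 2 * ‖x‖ ^ 2 + 2 * ‖y‖ ^ 2 := by
  obtain ⟨l, h1, h2, h3⟩ := h.exists_rotation_invariant hE he hP
  have hl : IsRevolution e l := ⟨h1, h2, h3⟩
  obtain ⟨u, hu, hu1⟩ : ∃ u, l u = 0 ∧ ‖u‖ = 1 := by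
    have he0 : e ≠ 0 := by
      rintro rfl
      simp at he
    obtain ⟨w, hw⟩ := exists_linearIndependent_pair_of_one_lt_finrank (R := ℝ) (M := E)
      (by omega) he0
    have hv0 : w - l w • e ≠ 0 := by
      intro h0
      rw [LinearIndependent.pair_iff] at hw
      have := hw (-(l w)) 1 (by rw [← h0]; module)
      exact one_ne_zero this.2
    refine ⟨‖w - l w • e‖⁻¹ • (w - l w • e), by simp [h1], ?_⟩
    rw [norm_smul, norm_inv, norm_norm, inv_mul_cancel₀ (norm_ne_zero_iff.2 hv0)]
  have hu0 : u ≠ 0 := by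
    rintro rfl
    simp at hu1
  obtain ⟨t₁, t₂, ht⟩ := h.exists_universal_centre he hP hl hu hu1
  have hlid := ht.profile_one hE he hP hl hu hu1
  obtain ⟨τ₀, hτ0, hτ1, hsym⟩ := ht.symmetricSlices he hP hl hu hu1 hlid
  have hline : ∀ a b : E, l a = 0 → l b = 0 → ∃ β : ℝ, ∀ t : ℝ,
      ‖a + t • b‖ ^ 2 = ‖a‖ ^ 2 + β * t + ‖b‖ ^ 2 * t ^ 2 := fun a b ha hb =>
    hsym.norm_sq_line hτ0 hτ1 ⟨a, ha⟩ ⟨b, hb⟩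
  obtain ⟨z, hz⟩ := exists_birkhoffPair hE h1 hu hu0
  obtain ⟨a, ha⟩ := ht.exists_profile_sq he hP hl hu hu1 hlid hz (by
    intro r q
    obtain ⟨β, hβ⟩ := hline (q • z) u (by simp [hz.map_right]) hu
    simp only [norm_smul, hz.norm_eq, hu1, Real.norm_eq_abs, mul_one, sq_abs, one_pow,
      one_mul] at hβ
    have hβ0 : β = 0 := by
      have h4 := hz.abs_le (-(β / 2)) q
      have h5 := pow_le_pow_left₀ (abs_nonneg q) h4 2
      rw [add_comm, hβ, sq_abs] at h5
      nlinarith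
    rw [add_comm, hβ, hβ0]
    ring)
  have hsq : ∀ s y, l y = 0 → ‖s • e + y‖ ^ 2 = s ^ 2 + ‖y‖ ^ 2 := fun s y hy =>
    hl.norm_sq_eq he hu hu1 hlid ha hy s
  set x' := x - l x • e with hx'
  set y' := y - l y • e with hy'
  have kx : l x' = 0 := by simp [hx', h1]
  have ky : l y' = 0 := by simp [hy', h1]
  have ex : x = l x • e + x' := by rw [hx']; abel
  have ey : y = l y • e + y' := by rw [hy']; abel
  have ex2 : ‖x‖ ^ 2 = l x ^ 2 + ‖x'‖ ^ 2 := by rw [← hsq _ _ kx, ← ex]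
  have ey2 : ‖y‖ ^ 2 = l y ^ 2 + ‖y'‖ ^ 2 := by rw [← hsq _ _ ky, ← ey]
  have e1 : x + y = (l x + l y) • e + (x' + y') := by rw [hx', hy']; module
  have e2 : x - y = (l x - l y) • e + (x' - y') := by rw [hx', hy']; module
  rw [ex2, ey2, e1, e2, hsq _ _ (by simp [kx, ky]), hsq _ _ (by simp [kx, ky])]
  obtain ⟨β, hβ⟩ := hline x' y' kx ky
  have b1 := hβ 1
  have b2 := hβ (-1)
  rw [one_smul] at b1
  rw [neg_one_smul, ← sub_eq_add_neg] at b2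
  linarith

end NormTheorem

section Antidiametral

variable {E : Type*} [NormedAddCommGroup E] [NormedSpace ℝ E] {K : Set E}

/-- The points `y` and `κ • y` of `K`, collinear with the origin, lie on parallel support planes. -/
structure Antidiametral (K : Set E) (u : E →ₗ[ℝ] ℝ) (κ : ℝ) (y : E) : Prop where
  neg_one_lt : -1 < κ
  lt_one : κ < 1
  mem : y ∈ K
  smul_mem : κ • y ∈ K
  map_eq : u y = 1
  le_map : ∀ x ∈ K, κ ≤ u x
  map_le : ∀ x ∈ K, u x ≤ 1
  smul_mem_of_neg : κ < 0 → ∀ x ∈ K, κ • x ∈ K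

theorem Convex.mem_of_forall_mem_interior (hconv : Convex ℝ K) (hinter : (interior K).Nonempty)
    {C : Set E} (hC : IsClosed C) (h : interior K ⊆ C) : K ⊆ C := by
  refine subset_closure.trans ?_
  rw [← hconv.closure_interior_eq_closure_of_nonempty_interior hinter]
  exact closure_minimal h hC

theorem exists_antidiametral_of_zero_mem_interior (hc : IsCompact K) (hconv : Convex ℝ K)
    (h0 : (0 : E) ∈ interior K) (hns : ¬ ∀ x ∈ K, -x ∈ K) : ∃ u κ y, Antidiametral K u κ y := by
  have hnhds : K ∈ 𝓝 (0 : E) := mem_interior_iff_mem_nhds.1 h0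
  have hgc : Continuous (gauge K) := continuous_gauge hconv hnhds
  have hle : ∀ x, gauge K x ≤ 1 ↔ x ∈ K := fun x => by
    rw [gauge_le_one_iff_mem_closure hconv hnhds, hc.isClosed.closure_eq]
  have hlt : ∀ x, gauge K x < 1 ↔ x ∈ interior K := fun x =>
    gauge_lt_one_iff_mem_interior hconv hnhds
  obtain ⟨y, hy, hmax⟩ := hc.exists_isMaxOn ⟨0, interior_subset h0⟩
    (f := fun x => gauge K (-x)) (by fun_prop)
  set M := gauge K (-y) with hM
  have hmax' : ∀ x ∈ K, gauge K (-x) ≤ M := fun x hx => hmax hx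
  have hM1 : 1 < M := by
    by_contra! h
    exact hns fun x hx => (hle _).1 ((hmax' x hx).trans h)
  have hM0 : 0 < M := by linarith
  have hg : ∀ x, gauge K ((-M⁻¹) • x) = M⁻¹ * gauge K (-x) := by
    intro x
    rw [neg_smul, ← smul_neg, gauge_smul_of_nonneg (inv_nonneg.2 hM0.le), smul_eq_mul]
  have hsm : ∀ x ∈ K, (-M⁻¹) • x ∈ K := by
    intro x hx
    rw [← hle, hg, inv_mul_le_iff₀ hM0, mul_one]
    exact hmax' x hx
  have hni : (-M⁻¹) • y ∉ interior K := by
    rw [← hlt, hg, ← hM, inv_mul_cancel₀ hM0.ne']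
    exact lt_irrefl 1
  obtain ⟨f, hf⟩ := geometric_hahn_banach_open_point hconv.interior isOpen_interior hni
  have hfK : ∀ x ∈ K, f x ≤ f ((-M⁻¹) • y) := fun x hx =>
    hconv.mem_of_forall_mem_interior ⟨0, h0⟩ (isClosed_le f.continuous continuous_const)
      (fun x hx => (hf x hx).le) hx
  have hi : 0 < M⁻¹ := inv_pos.2 hM0
  have hi1 : M⁻¹ < 1 := inv_lt_one_of_one_lt₀ hM1
  have hfy : f y < 0 := by
    have := hf 0 h0
    rw [map_zero, map_smul, smul_eq_mul] at this
    nlinarith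
  refine ⟨(f y)⁻¹ • f.toLinearMap, -M⁻¹, y, by linarith, by linarith, hy, hsm y hy, ?_, ?_, ?_,
    fun _ => hsm⟩
  · simp [inv_mul_cancel₀ hfy.ne]
  · intro x hx
    have h1 := hfK x hx
    rw [map_smul, smul_eq_mul] at h1
    change _ ≤ (f y)⁻¹ * f x
    rw [inv_mul_eq_div, le_div_iff_of_neg hfy]
    exact h1
  · intro x hx
    have h1 := hfK _ (hsm x hx)
    rw [map_smul, map_smul, smul_eq_mul, smul_eq_mul] at h1
    change (f y)⁻¹ * f x ≤ 1
    rw [inv_mul_eq_div, div_le_one_of_neg hfy]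
    nlinarith

theorem exists_antidiametral_of_zero_mem (hc : IsCompact K) (hconv : Convex ℝ K)
    (hinter : (interior K).Nonempty) (hK : (0 : E) ∈ K) (h0 : (0 : E) ∉ interior K) :
    ∃ u κ y, Antidiametral K u κ y := by
  obtain ⟨f, hf⟩ := geometric_hahn_banach_open_point hconv.interior isOpen_interior h0
  rw [map_zero] at hf
  have hfK : ∀ x ∈ K, f x ≤ 0 := fun x hx =>
    hconv.mem_of_forall_mem_interior hinter (isClosed_le f.continuous continuous_const)
      (fun x hx => (hf x hx).le) hx
  obtain ⟨y, hy, hmin⟩ := hc.exists_isMinOn ⟨0, hK⟩ (f := f) f.continuous.continuousOn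
  have hmin' : ∀ x ∈ K, f y ≤ f x := fun x hx => hmin hx
  obtain ⟨x₀, hx₀⟩ := hinter
  have hfy : f y < 0 := (hmin' _ (interior_subset hx₀)).trans_lt (hf _ hx₀)
  refine ⟨(f y)⁻¹ • f.toLinearMap, 0, y, by norm_num, by norm_num, hy, by rwa [zero_smul], ?_, ?_,
    ?_, fun h => (lt_irrefl _ h).elim⟩
  · simp [inv_mul_cancel₀ hfy.ne]
  · intro x hx
    exact mul_nonneg_of_nonpos_of_nonpos (inv_nonpos.2 hfy.le) (hfK x hx)
  · intro x hx
    change (f y)⁻¹ * f x ≤ 1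
    rw [inv_mul_eq_div, div_le_one_of_neg hfy]
    exact hmin' x hx

theorem exists_antidiametral_of_zero_notMem (hc : IsCompact K) (hconv : Convex ℝ K)
    (hinter : (interior K).Nonempty) (hK : (0 : E) ∉ K) : ∃ u κ y, Antidiametral K u κ y := by
  obtain ⟨x₀, hx₀⟩ := hinter
  have hshrink : ∀ (t : ℝ) (x : E), t • x ∈ interior K → ∀ᶠ s in 𝓝[<] t, s • x ∈ K := by
    intro t x htx
    have : Tendsto (fun s : ℝ => s • x) (𝓝[<] t) (𝓝 (t • x)) :=
      (by fun_prop : Continuous fun s : ℝ => s • x).continuousAt.tendsto.mono_left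
        nhdsWithin_le_nhds
    exact this.eventually (mem_interior_iff_mem_nhds.1 htx)
  set S := {p : ℝ × E | p.1 ∈ Icc (0 : ℝ) 1 ∧ p.2 ∈ K ∧ p.1 • p.2 ∈ K} with hS
  have hScomp : IsCompact S := by
    refine (isCompact_Icc.prod hc).of_isClosed_subset ?_ fun p hp => ⟨hp.1, hp.2.1⟩
    exact (isClosed_Icc.preimage continuous_fst).inter ((hc.isClosed.preimage continuous_snd).inter
      (hc.isClosed.preimage (continuous_fst.smul continuous_snd)))
  have hSne : S.Nonempty := ⟨(1, x₀), by simp, interior_subset hx₀, by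
    simpa using interior_subset hx₀⟩
  obtain ⟨⟨κ, y⟩, ⟨⟨hκ0, hκ1⟩, hy, hκy⟩, hmin⟩ :=
    hScomp.exists_isMinOn hSne continuous_fst.continuousOn
  simp only at hκ0 hκ1 hy hκy
  have hmin' : ∀ t x, 0 ≤ t → t ≤ 1 → x ∈ K → t • x ∈ K → κ ≤ t := fun t x h1 h2 h3 h4 =>
    hmin (a := (t, x)) ⟨⟨h1, h2⟩, h3, h4⟩
  have hκpos : 0 < κ := by
    refine lt_of_le_of_ne hκ0 ?_
    rintro rfl
    exact hK (by simpa using hκy)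
  have hκlt : κ < 1 := by
    have h1 := hshrink 1 x₀ (by rwa [one_smul])
    obtain ⟨s, hs, hs1⟩ := (h1.and (Ioo_mem_nhdsLT (zero_lt_one' ℝ))).exists
    exact (hmin' s x₀ hs1.1.le hs1.2.le (interior_subset hx₀) hs).trans_lt hs1.2
  have hdisj : Disjoint (interior K) ((fun x => κ • x) '' K) := by
    rw [Set.disjoint_left]
    rintro _ hx ⟨x, hxK, rfl⟩
    have h1 := hshrink κ x hx
    obtain ⟨s, hs, hs1⟩ := (h1.and (Ioo_mem_nhdsLT hκpos)).exists
    exact absurd (hmin' s x hs1.1.le (hs1.2.trans hκlt).le hxK hs) (not_le.2 hs1.2)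
  obtain ⟨f, s, hf1, hf2⟩ := geometric_hahn_banach_open hconv.interior isOpen_interior
    (hconv.smul κ) hdisj
  have hfK : ∀ x ∈ K, f x ≤ s := fun x hx =>
    hconv.mem_of_forall_mem_interior ⟨x₀, hx₀⟩ (isClosed_le f.continuous continuous_const)
      (fun x hx => (hf1 x hx).le) hx
  have hfK2 : ∀ x ∈ K, s ≤ κ * f x := by
    intro x hx
    have := hf2 (κ • x) ⟨x, hx, rfl⟩
    rwa [map_smul, smul_eq_mul] at this
  have hs0 : s < 0 := by
    have h1 := hf1 x₀ hx₀
    have h2 := hfK2 x₀ (interior_subset hx₀)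
    have h3 : f x₀ < 0 := by nlinarith
    nlinarith
  have hsy : κ * f y = s := by
    refine le_antisymm ?_ (hfK2 y hy)
    have := hfK _ hκy
    rwa [map_smul, smul_eq_mul] at this
  have hfy : f y < 0 := by nlinarith
  refine ⟨(f y)⁻¹ • f.toLinearMap, κ, y, by linarith, hκlt, hy, hκy, ?_, ?_, ?_,
    fun h => by linarith⟩
  · simp [inv_mul_cancel₀ hfy.ne]
  · intro x hx
    change _ ≤ (f y)⁻¹ * f x
    rw [inv_mul_eq_div, le_div_iff_of_neg hfy, hsy]
    exact hfK x hx
  · intro x hx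
    change (f y)⁻¹ * f x ≤ 1
    rw [inv_mul_eq_div, div_le_one_of_neg hfy]
    have := hfK2 x hx
    rw [← hsy] at this
    exact le_of_mul_le_mul_left this hκpos

theorem exists_antidiametral (hc : IsCompact K) (hconv : Convex ℝ K)
    (hinter : (interior K).Nonempty) (hns : ¬ ∀ x ∈ K, -x ∈ K) : ∃ u κ y, Antidiametral K u κ y := by
  by_cases h0 : (0 : E) ∈ interior K
  · exact exists_antidiametral_of_zero_mem_interior hc hconv h0 hns
  by_cases hK : (0 : E) ∈ K
  · exact exists_antidiametral_of_zero_mem hc hconv hinter hK h0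
  · exact exists_antidiametral_of_zero_notMem hc hconv hinter hK

end Antidiametral

section CentreTheorem

/-- Every plane through the origin that properly cuts `K` has a symmetric section. -/
def PlanarSym {E : Type*} [AddCommGroup E] [Module ℝ E] (K : Set E) : Prop :=
  ∀ f : E →ₗ[ℝ] ℝ, (∃ x ∈ K, f x < 0) → (∃ x ∈ K, 0 < f x) →
    ∃ c, f c = 0 ∧ ∀ x ∈ K, f x = 0 → (2 : ℝ) • c - x ∈ K

variable {E : Type*} [NormedAddCommGroup E] [NormedSpace ℝ E] {K : Set E}
  {u : E →ₗ[ℝ] ℝ} {κ : ℝ} {y : E}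

theorem Antidiametral.map_centre (h : Antidiametral K u κ y) {f : E →ₗ[ℝ] ℝ} {a b c : E}
    (hc : ∀ x ∈ K, f x = 0 → (2 : ℝ) • c - x ∈ K) (hua : u a = 1) (ha : κ • a ∈ K) (hfa : f a = 0)
    (hub : u b = 1) (hb : b ∈ K) (hfb : f b = 0) : u c = (1 + κ) / 2 := by
  have h1 := h.map_le _ (hc _ ha (by simp [hfa]))
  have h2 := h.le_map _ (hc _ hb hfb)
  simp only [map_sub, map_smul, smul_eq_mul, hua, hub] at h1 h2
  linarith

theorem eventually_add_smul_mem {s : Set E} {x : E} (hx : s ∈ 𝓝 x) (v : E) :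
    ∀ᶠ t : ℝ in 𝓝 0, x + t • v ∈ s := by
  have : Tendsto (fun t : ℝ => x + t • v) (𝓝 0) (𝓝 x) := by
    have h : Continuous fun t : ℝ => x + t • v := by fun_prop
    simpa using h.tendsto 0
  exact this hx

theorem exists_add_sub_smul_mem {s : Set E} {x : E} (hx : s ∈ 𝓝 x) (v : E) :
    ∃ t : ℝ, 0 < t ∧ x + t • v ∈ s ∧ x - t • v ∈ s := by
  have h1 := eventually_add_smul_mem hx v
  have h2 := eventually_add_smul_mem hx (-v)
  obtain ⟨t, ⟨h3, h4⟩, ht⟩ := (((h1.and h2).filter_mono nhdsWithin_le_nhds).and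
    (self_mem_nhdsWithin (a := (0 : ℝ)) (s := Ioi 0))).exists
  exact ⟨t, ht, h3, by simpa [sub_eq_add_neg] using h4⟩

theorem Antidiametral.mem_of_forall_mem_line (h : Antidiametral K u κ y)
    (hE : 3 ≤ Module.finrank ℝ E) [FiniteDimensional ℝ E]
    (hc : IsCompact K) (hconv : Convex ℝ K) (hinter : (interior K).Nonempty) (hs : PlanarSym K)
    {v : E} (hv : v ≠ 0) (huv : u v = 0)
    (hline : ∀ w ∈ K, u w = 1 → κ • w ∈ K → ∃ t : ℝ, w = y + t • v) :
    ∀ x ∈ K, (1 + κ) • y - x ∈ K := by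
  have hκ1 := h.neg_one_lt
  have hκ0 : 0 < 1 + κ := by linarith
  obtain ⟨w₀, hw₀⟩ := exists_linearIndependent_triple (x := y) (y := v) hE (by
    intro a b hab
    have h1 := congrArg u hab
    simp only [map_add, map_smul, h.map_eq, huv, smul_eq_mul, map_zero, mul_one, mul_zero,
      add_zero] at h1
    subst h1
    simpa [hv] using hab)
  obtain ⟨d, hd⟩ := exists_dual_of_linearIndependent hw₀
  have hvy : d 1 y = 0 := by simpa using hd 1 0
  have hvv : d 1 v = 1 := by simpa using hd 1 1
  have hgy : d 2 y = 0 := by simpa using hd 2 0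
  have hgv : d 2 v = 0 := by simpa using hd 2 1
  have hgw : d 2 w₀ = 1 := by simpa using hd 2 2
  have key : ∀ x ∈ interior K, d 2 x ≠ 0 → (1 + κ) • y - x ∈ K := by
    intro x hx hgx
    set f : E →ₗ[ℝ] ℝ := (d 1 : E →ₗ[ℝ] ℝ) - (d 1 x / d 2 x) • (d 2 : E →ₗ[ℝ] ℝ) with hf
    have hf' : ∀ z, f z = d 1 z - (d 1 x / d 2 x) * d 2 z := fun z => by simp [hf]
    have hfy : f y = 0 := by simp [hf', hvy, hgy]
    have hfv : f v = 1 := by simp [hf', hvv, hgv]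
    have hfx : f x = 0 := by rw [hf']; field_simp; ring
    obtain ⟨t, ht, h1, h2⟩ := exists_add_sub_smul_mem (mem_interior_iff_mem_nhds.1 hx) v
    obtain ⟨c, hfc, hcs⟩ := hs f ⟨_, h2, by simp [hfx, hfv, ht]⟩ ⟨_, h1, by simp [hfx, hfv, ht]⟩
    have huc : u c = (1 + κ) / 2 := h.map_centre hcs h.map_eq h.smul_mem hfy h.map_eq h.mem hfy
    have hm1 := hcs y h.mem hfy
    have hm2 := hcs _ h.smul_mem (by simp [hfy])
    suffices hcy : (2 : ℝ) • c = (1 + κ) • y by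
      rw [← hcy]; exact hcs x (interior_subset hx) hfx
    rcases le_or_gt 0 κ with hκ | hκ
    · obtain ⟨s, hsw⟩ := hline ((1 + κ)⁻¹ • (2 : ℝ) • c)
        (by
          have := hconv hm2 h.mem (a := (1 + κ)⁻¹) (b := κ / (1 + κ)) (by positivity)
            (by positivity) (by field_simp)
          convert this using 1
          module)
        (by simp [huc]; field_simp)
        (by
          have := hconv h.smul_mem hm1 (a := (1 + κ)⁻¹) (b := κ / (1 + κ)) (by positivity)
            (by positivity) (by field_simp)
          convert this using 1
          module)
      have hs0 := congrArg f hsw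
      simp only [map_add, map_smul, hfy, hfv, hfc, smul_eq_mul, mul_zero, mul_one, zero_add] at hs0
      rw [← hs0, zero_smul, add_zero] at hsw
      rw [← hsw, smul_inv_smul₀ hκ0.ne']
    · obtain ⟨s, hsw⟩ := hline _ hm2
        (by simp [huc, h.map_eq]; ring) (h.smul_mem_of_neg hκ _ hm2)
      have hs0 := congrArg f hsw
      simp only [map_add, map_sub, map_smul, hfy, hfv, hfc, smul_eq_mul, mul_zero, mul_one,
        zero_add, sub_zero] at hs0
      rw [← hs0, zero_smul, add_zero] at hsw
      rw [add_smul, one_smul, ← sub_eq_iff_eq_add, hsw]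
  refine hconv.mem_of_forall_mem_interior hinter (C := {x | (1 + κ) • y - x ∈ K})
    (hc.isClosed.preimage (by fun_prop)) fun x hx => ?_
  by_cases hgx : d 2 x = 0
  · have hev := eventually_add_smul_mem (isOpen_interior.mem_nhds hx) w₀
    have htend : Tendsto (fun t : ℝ => (1 + κ) • y - (x + t • w₀)) (𝓝[>] 0)
        (𝓝 ((1 + κ) • y - x)) := by
      have h : Continuous fun t : ℝ => (1 + κ) • y - (x + t • w₀) := by fun_prop
      simpa using (h.tendsto 0).mono_left nhdsWithin_le_nhds
    refine hc.isClosed.mem_of_tendsto htend ?_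
    filter_upwards [nhdsWithin_le_nhds hev, self_mem_nhdsWithin] with t ht ht0
    exact key _ ht (by simpa [hgx, hgw] using (ne_of_gt ht0))
  · exact key x hx hgx

theorem cross_point_not_common {y₀ y₁ y₂ x b : E} (hy : LinearIndependent ℝ ![y₀, y₁, y₂])
    {f : E →ₗ[ℝ] ℝ} (h0 : f y₀ ≤ 0) (h1 : f y₁ ≤ 0) (hx : 0 < f x)
    (hb0 : (f x - f y₀) • b = f x • y₀ - f y₀ • x) (hb1 : (f x - f y₁) • b = f x • y₁ - f y₁ • x)
    (hb2 : (f x - f y₂) • b = f x • y₂ - f y₂ • x) : False := by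
  rw [linearIndependent_triple_iff] at hy
  set φ := f x
  set α := f y₀
  set β := f y₁
  set γ := f y₂
  have e1 : (φ - β) • y₀ - (φ - α) • y₁ = (α - β) • x := by
    have : φ • ((φ - β) • y₀ - (φ - α) • y₁ - (α - β) • x) = 0 := by
      have : φ • ((φ - β) • y₀ - (φ - α) • y₁ - (α - β) • x) =
        (φ - β) • (φ • y₀ - α • x) - (φ - α) • (φ • y₁ - β • x) := by module
      rw [this, ← hb0, ← hb1]; module
    exact sub_eq_zero.1 ((smul_eq_zero.1 this).resolve_left hx.ne')
  have e2 : (φ - γ) • y₀ - (φ - α) • y₂ = (α - γ) • x := by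
    have : φ • ((φ - γ) • y₀ - (φ - α) • y₂ - (α - γ) • x) = 0 := by
      have : φ • ((φ - γ) • y₀ - (φ - α) • y₂ - (α - γ) • x) =
        (φ - γ) • (φ • y₀ - α • x) - (φ - α) • (φ • y₂ - γ • x) := by module
      rw [this, ← hb0, ← hb2]; module
    exact sub_eq_zero.1 ((smul_eq_zero.1 this).resolve_left hx.ne')
  have hφα : φ - α ≠ 0 := by linarith
  obtain ⟨-, g1, g2⟩ := hy ((α - γ) * (φ - β) - (α - β) * (φ - γ)) (-((α - γ) * (φ - α)))
    ((α - β) * (φ - α)) (by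
      have : (α - γ) • ((φ - β) • y₀ - (φ - α) • y₁) - (α - β) • ((φ - γ) • y₀ - (φ - α) • y₂)
        = 0 := by rw [e1, e2]; module
      rw [← this]; module)
  have hαβ : α - β = 0 := (mul_eq_zero.1 g2).resolve_right hφα
  obtain ⟨g3, -, -⟩ := hy (φ - β) (-(φ - α)) 0 (by
    rw [hαβ, zero_smul] at e1
    rw [← e1]; module)
  linarith

end CentreTheorem

section CentreTheoremInner

variable {E : Type*} [NormedAddCommGroup E] [InnerProductSpace ℝ E]

theorem inner_lt_of_norm_le {z b : E} (h : ‖b‖ ≤ ‖z‖) (hb : b ≠ z) : inner ℝ z b < inner ℝ z z := by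
  have h1 : 0 < ‖b - z‖ := norm_pos_iff.2 (sub_ne_zero.2 hb)
  have h2 := @norm_sub_sq_real E _ _ b z
  rw [real_inner_comm] at h2
  rw [real_inner_self_eq_norm_sq]
  nlinarith [norm_nonneg b, norm_nonneg z]

theorem exists_exposed [CompleteSpace E] {B : Set E} (hB : IsCompact B) (hconv : Convex ℝ B)
    (hne : B.Nonempty) {x : E} (hx : x ∉ B) :
    ∃ z ∈ B, ∃ f : E →ₗ[ℝ] ℝ, (∀ b ∈ B, b ≠ z → f b < f z) ∧ f z < f x := by
  obtain ⟨g, s, hg, hgx⟩ := geometric_hahn_banach_closed_point hconv hB.isClosed hx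
  set v := (InnerProductSpace.toDual ℝ E).symm g with hv
  have hgv : ∀ w, inner ℝ v w = g w := fun w => by
    rw [hv, InnerProductSpace.toDual_symm_apply]
  obtain ⟨R, hR⟩ := hB.isBounded.exists_norm_le
  have hR0 : 0 ≤ R := by
    obtain ⟨b, hb⟩ := hne
    exact (norm_nonneg b).trans (hR b hb)
  have hσ : 0 < g x - s := by linarith
  set t := (R * (‖x‖ + R) + 1) / (g x - s) with ht
  have ht0 : 0 < t := by positivity
  obtain ⟨z, hz, hmax⟩ := hB.exists_isMaxOn hne (f := fun b => ‖b + t • v‖) (by fun_prop)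
  refine ⟨z, hz, (innerSL ℝ (z + t • v)).toLinearMap, fun b hb hbz => ?_, ?_⟩
  · have := inner_lt_of_norm_le (b := b + t • v) (z := z + t • v) (hmax hb) (by simpa using hbz)
    rw [inner_add_right, inner_add_right, add_lt_add_iff_right] at this
    exact this
  · have h1 : -(R * (‖x‖ + R)) ≤ inner ℝ z (x - z) := by
      have h2 := abs_le.1 (abs_real_inner_le_norm z (x - z))
      have h3 : ‖x - z‖ ≤ ‖x‖ + R := (norm_sub_le _ _).trans (by gcongr; exact hR z hz)
      have h4 : ‖z‖ * ‖x - z‖ ≤ R * (‖x‖ + R) := by gcongr; exact hR z hz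
      linarith
    have h2 : t * (g x - s) = R * (‖x‖ + R) + 1 := by rw [ht]; field_simp
    have h3 : t * (g x - s) ≤ t * (g x - g z) := by
      have := hg z hz
      gcongr
    have h4 : 0 < inner ℝ (z + t • v) (x - z) := by
      rw [inner_add_left, real_inner_smul_left, hgv, map_sub]
      linarith
    rw [inner_sub_right, sub_pos] at h4
    exact h4

variable {K : Set E} {u : E →ₗ[ℝ] ℝ} {κ : ℝ} {y y₀ y₁ y₂ : E}

theorem cross_point_mem {f : E →ₗ[ℝ] ℝ} {F : Set E} (hF : Convex ℝ F) {a x : E} (ha : a ∈ F)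
    (hx : x ∈ F) (hfa : f a ≤ 0) (hfx : 0 < f x) :
    ∃ b ∈ F, f b = 0 ∧ (f x - f a) • b = f x • a - f a • x := by
  have h0 : 0 < f x - f a := by linarith
  refine ⟨(f x / (f x - f a)) • a + (-f a / (f x - f a)) • x,
    hF ha hx (by positivity) (div_nonneg (by linarith) h0.le) (by field_simp; ring), ?_, ?_⟩
  · simp only [map_add, map_smul, smul_eq_mul]; field_simp; ring
  · rw [smul_add, smul_smul, smul_smul, mul_div_cancel₀ _ h0.ne', mul_div_cancel₀ _ h0.ne']
    module

/-- The slice of `K` by the hyperplane `u = 1`. -/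
def topSlice (K : Set E) (u : E →ₗ[ℝ] ℝ) : Set E := {x | x ∈ K ∧ u x = 1}

theorem isCompact_topSlice [FiniteDimensional ℝ E] (hc : IsCompact K) :
    IsCompact (topSlice K u) :=
  hc.inter_right (isClosed_eq u.continuous_of_finiteDimensional continuous_const)

theorem convex_topSlice (hconv : Convex ℝ K) : Convex ℝ (topSlice K u) :=
  hconv.inter ((convex_singleton (1 : ℝ)).linear_preimage u)

theorem Antidiametral.false_of_subset (h : Antidiametral K u κ y) [FiniteDimensional ℝ E]
    (hc : IsCompact K) (hconv : Convex ℝ K) (hs : PlanarSym K) (hκ : κ ≠ 0)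
    (hy : LinearIndependent ℝ ![y₀, y₁, y₂]) (h0 : y₀ ∈ topSlice K u) (h1 : y₁ ∈ topSlice K u)
    (h2 : y₂ ∈ topSlice K u) (hκ2 : κ • y₂ ∈ K)
    (hsub : ∀ x, u x = 1 → κ • x ∈ K → x ∈ K) : False := by
  obtain ⟨d, hd⟩ := exists_dual_of_linearIndependent hy
  set f : E →ₗ[ℝ] ℝ := (d 0 : E →ₗ[ℝ] ℝ) - (d 1 : E →ₗ[ℝ] ℝ) with hf
  have hf0 : f y₀ = 1 := by
    have e0 := hd 0 0
    have e1 := hd 1 0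
    simp at e0 e1
    simp [hf, e0, e1]
  have hf1 : f y₁ = -1 := by
    have e0 := hd 0 1
    have e1 := hd 1 1
    simp at e0 e1
    simp [hf, e0, e1]
  have hf2 : f y₂ = 0 := by
    have e0 := hd 0 2
    have e1 := hd 1 2
    simp at e0 e1
    simp [hf, e0, e1]
  obtain ⟨c, hfc, hcs⟩ := hs f ⟨y₁, h1.1, by simp [hf1]⟩ ⟨y₀, h0.1, by simp [hf0]⟩
  have huc : u c = (1 + κ) / 2 := h.map_centre hcs h2.2 hκ2 hf2 h2.2 h2.1 hf2
  set S := topSlice K u ∩ {x | f x = 0} with hS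
  have hScomp : IsCompact S := (isCompact_topSlice hc).inter_right
    (isClosed_eq f.continuous_of_finiteDimensional continuous_const)
  have hy2 : y₂ ∈ S := ⟨h2, hf2⟩
  have hm : (1 / 2 : ℝ) • y₀ + (1 / 2 : ℝ) • y₁ ∈ S :=
    ⟨convex_topSlice hconv h0 h1 (by norm_num) (by norm_num) (by norm_num), by
      simp [hf0, hf1]⟩
  have hne : y₂ ≠ (1 / 2 : ℝ) • y₀ + (1 / 2 : ℝ) • y₁ := by
    intro he
    have := congrArg (d 2) he
    have e0 := hd 2 0
    have e1 := hd 2 1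
    have e2 := hd 2 2
    simp at e0 e1 e2
    simp [e0, e1, e2] at this
  obtain ⟨⟨x, x'⟩, ⟨hx, hx'⟩, hmax⟩ := (hScomp.prod hScomp).exists_isMaxOn ⟨(y₂, y₂), hy2, hy2⟩
    (f := fun q : E × E => ‖q.1 - q.2‖) (by fun_prop)
  have hD : 0 < ‖x - x'‖ :=
    (norm_pos_iff.2 (sub_ne_zero.2 hne)).trans_le (hmax (show (y₂, _) ∈ S ×ˢ S from ⟨hy2, hm⟩))
  have hmem : ∀ w ∈ S, κ⁻¹ • ((2 : ℝ) • c - w) ∈ S := by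
    rintro w ⟨⟨hwK, huw⟩, hfw⟩
    have hu : u (κ⁻¹ • ((2 : ℝ) • c - w)) = 1 := by
      simp only [map_smul, map_sub, huc, huw, smul_eq_mul]; field_simp; ring
    refine ⟨⟨hsub _ hu ?_, hu⟩, ?_⟩
    · rw [smul_inv_smul₀ hκ]; exact hcs w hwK hfw
    · have hfw : f w = 0 := hfw
      simp [hfc, hfw]
  have hle := hmax (show (_, _) ∈ S ×ˢ S from ⟨hmem x hx, hmem x' hx'⟩)
  have he : κ⁻¹ • ((2 : ℝ) • c - x) - κ⁻¹ • ((2 : ℝ) • c - x') = (-κ⁻¹) • (x - x') := by module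
  simp only [mem_ofPred_eq, he, norm_smul, norm_neg, norm_inv, Real.norm_eq_abs] at hle
  have hκa : |κ| < 1 := abs_lt.2 ⟨h.neg_one_lt, h.lt_one⟩
  have := one_lt_inv₀ (abs_pos.2 hκ) |>.2 hκa
  nlinarith

theorem Antidiametral.false_of_not_mem (h : Antidiametral K u κ y) [FiniteDimensional ℝ E]
    (hc : IsCompact K) (hconv : Convex ℝ K) (hs : PlanarSym K) (hκ : κ ≠ 0)
    (hy : LinearIndependent ℝ ![y₀, y₁, y₂]) (h0 : y₀ ∈ topSlice K u) (h1 : y₁ ∈ topSlice K u)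
    (h2 : y₂ ∈ topSlice K u) (hκ0 : κ • y₀ ∈ K) (hκ1 : κ • y₁ ∈ K) (hκ2 : κ • y₂ ∈ K)
    {x : E} (hux : u x = 1) (hκx : κ • x ∈ K) (hx : x ∉ K) : False := by
  obtain ⟨z, hz, g, hgz, hgx⟩ := exists_exposed (isCompact_topSlice (u := u) hc)
    (convex_topSlice hconv) ⟨y₀, h0⟩ (x := x) (fun hx' => hx hx'.1)
  set f : E →ₗ[ℝ] ℝ := g - g z • u with hf
  have hfz : f z = 0 := by simp [hf, hz.2]
  have hfx : 0 < f x := by simp [hf, hux, hgx]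
  have hfneg : ∀ b ∈ topSlice K u, b ≠ z → f b < 0 := fun b hb hbz => by
    simp [hf, hb.2, hgz b hb hbz]
  have hfle : ∀ b ∈ topSlice K u, f b ≤ 0 := fun b hb => by
    by_cases hbz : b = z
    · rw [hbz, hfz]
    · exact (hfneg b hb hbz).le
  obtain ⟨w, hw, hκw, hfw⟩ : ∃ w ∈ topSlice K u, κ • w ∈ K ∧ f w < 0 := by
    by_cases hz0 : y₀ = z
    · refine ⟨y₁, h1, hκ1, hfneg _ h1 fun hz1 => ?_⟩
      exact absurd (hy.injective (a₁ := 0) (a₂ := 1) (hz0.trans hz1.symm)) (by decide)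
    · exact ⟨y₀, h0, hκ0, hfneg _ h0 hz0⟩
  have hpos : ∃ x ∈ K, 0 < f x := by
    rcases lt_or_gt_of_ne hκ with hlt | hgt
    · exact ⟨_, hκw, by simpa using mul_pos_of_neg_of_neg hlt hfw⟩
    · exact ⟨_, hκx, by simpa using mul_pos hgt hfx⟩
  obtain ⟨c, hfc, hcs⟩ := hs f ⟨w, hw.1, hfw⟩ hpos
  set A : Set E := {a | κ • a ∈ K} ∩ {a | u a = 1} with hA
  have hAconv : Convex ℝ A :=
    (hconv.linear_preimage (κ • (LinearMap.id : E →ₗ[ℝ] E))).inter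
      ((convex_singleton (1 : ℝ)).linear_preimage u)
  have key : ∀ a ∈ topSlice K u, κ • a ∈ K →
      (f x - f a) • κ⁻¹ • ((2 : ℝ) • c - z) = f x • a - f a • x := by
    intro a ha hκa
    obtain ⟨b, ⟨hb1, hb2⟩, hfb, hb⟩ := cross_point_mem hAconv (a := a) (x := x) ⟨hκa, ha.2⟩
      ⟨hκx, hux⟩ (hfle a ha) hfx
    have huc := h.map_centre hcs hb2 hb1 hfb hz.2 hz.1 hfz
    have hmem := hcs _ hb1 (by simp [hfb])
    have hb2 : u b = 1 := hb2
    have hbz : (2 : ℝ) • c - κ • b = z := by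
      by_contra hne
      refine (hfneg _ ⟨hmem, ?_⟩ hne).ne ?_
      · simp [huc, hb2]; ring
      · simp [hfc, hfb]
    rw [← hb, ← hbz, sub_sub_cancel, inv_smul_smul₀ hκ]
  exact cross_point_not_common hy (hfle _ h0) (hfle _ h1) hfx (key _ h0 hκ0) (key _ h1 hκ1)
    (key _ h2 hκ2)

end CentreTheoremInner

section CentreTheoremZero

variable {E : Type*} [NormedAddCommGroup E] [InnerProductSpace ℝ E]
variable {K : Set E} {u : E →ₗ[ℝ] ℝ} {κ : ℝ} {y y₀ y₁ y₂ : E}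

theorem linearIndependent_midpoints (hy : LinearIndependent ℝ ![y₀, y₁, y₂]) :
    LinearIndependent ℝ ![midpoint ℝ y₁ y₂, midpoint ℝ y₀ y₂, midpoint ℝ y₀ y₁] := by
  rw [linearIndependent_triple_iff] at hy ⊢
  intro a b c h
  obtain ⟨h0, h1, h2⟩ := hy ((b + c) / 2) ((a + c) / 2) ((a + b) / 2) (by
    rw [← h]; simp only [midpoint_eq_smul_add, invOf_eq_inv]; module)
  exact ⟨by linarith, by linarith, by linarith⟩

theorem Antidiametral.false_of_eq_zero (h : Antidiametral K u 0 y) [FiniteDimensional ℝ E]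
    (hc : IsCompact K) (hconv : Convex ℝ K) (hs : PlanarSym K)
    (hy : LinearIndependent ℝ ![y₀, y₁, y₂]) (h0 : y₀ ∈ topSlice K u) (h1 : y₁ ∈ topSlice K u)
    (h2 : y₂ ∈ topSlice K u) : False := by
  have hFc := isCompact_topSlice (u := u) hc
  have hFconv := convex_topSlice (u := u) hconv
  have hK0 : (0 : E) ∈ K := by simpa using h.smul_mem
  obtain ⟨z, hz, hmax⟩ := hFc.exists_isMaxOn ⟨y₀, h0⟩ (f := fun b : E => ‖b‖) (by fun_prop)
  set g : E →ₗ[ℝ] ℝ := (innerSL ℝ z).toLinearMap with hg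
  have hgz : ∀ b ∈ topSlice K u, b ≠ z → g b < g z := fun b hb hbz =>
    inner_lt_of_norm_le (hmax hb) hbz
  have hgle : ∀ b ∈ topSlice K u, g b ≤ g z := fun b hb => by
    by_cases hbz : b = z
    · rw [hbz]
    · exact (hgz b hb hbz).le
  have hmid : ∀ a ∈ topSlice K u, ∀ b ∈ topSlice K u, a ≠ b →
      midpoint ℝ a b ∈ topSlice K u ∧ g (midpoint ℝ a b) < g z := by
    intro a ha b hb hab
    refine ⟨hFconv.midpoint_mem ha hb, ?_⟩
    have h1 : g a + g b < 2 * g z := by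
      by_cases haz : a = z
      · have := hgz b hb (fun hbz => hab (haz.trans hbz.symm))
        have := hgle a ha
        linarith
      · have := hgz a ha haz
        have := hgle b hb
        linarith
    rw [midpoint_eq_smul_add, map_smul, map_add, invOf_eq_inv, smul_eq_mul]
    linarith
  have hm := linearIndependent_midpoints hy
  have hne : ∀ i j : Fin 3, i ≠ j → ![y₀, y₁, y₂] i ≠ ![y₀, y₁, y₂] j := fun i j hij =>
    hy.injective.ne hij
  obtain ⟨hm0, hm0'⟩ := hmid y₁ h1 y₂ h2 (hne 1 2 (by decide))
  obtain ⟨hm1, hm1'⟩ := hmid y₀ h0 y₂ h2 (hne 0 2 (by decide))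
  obtain ⟨hm2, hm2'⟩ := hmid y₀ h0 y₁ h1 (hne 0 1 (by decide))
  set m₀ := midpoint ℝ y₁ y₂
  set m₁ := midpoint ℝ y₀ y₂
  set m₂ := midpoint ℝ y₀ y₁
  obtain ⟨t, ht, htz⟩ := exists_between (max_lt hm0' (max_lt hm1' hm2'))
  have ht0 : g m₀ < t := (le_max_left _ _).trans_lt ht
  have ht1 : g m₁ < t := ((le_max_left _ _).trans (le_max_right _ _)).trans_lt ht
  have ht2 : g m₂ < t := ((le_max_right _ _).trans (le_max_right _ _)).trans_lt ht
  have hlevel : ∀ s, t ≤ s → s < g z → ∃ c, (g - s • u) c = 0 ∧ u c = 1 / 2 ∧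
      ∀ x ∈ K, (g - s • u) x = 0 → (2 : ℝ) • c - x ∈ K := by
    intro s hts hsz
    have hfz : 0 < (g - s • u) z := by simp [hz.2, hsz]
    have hfm : (g - s • u) m₀ < 0 := by simp [hm0.2, ht0.trans_le hts]
    obtain ⟨c, hfc, hcs⟩ := hs (g - s • u) ⟨m₀, hm0.1, hfm⟩ ⟨z, hz.1, hfz⟩
    obtain ⟨b, hb, hfb, -⟩ := cross_point_mem hFconv hm0 hz hfm.le hfz
    refine ⟨c, hfc, ?_, hcs⟩
    rw [h.map_centre hcs hb.2 (by simpa using hK0) hfb hb.2 hb.1 hfb]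
    norm_num
  set f := g - t • u with hf
  have hfz : 0 < f z := by simp [hf, hz.2, htz]
  have hfm0 : f m₀ ≤ 0 := by simp [hf, hm0.2, ht0.le]
  have hfm1 : f m₁ ≤ 0 := by simp [hf, hm1.2, ht1.le]
  have hfm2 : f m₂ ≤ 0 := by simp [hf, hm2.2, ht2.le]
  obtain ⟨b₀, hb0, hfb0, hb0'⟩ := cross_point_mem hFconv hm0 hz hfm0 hfz
  obtain ⟨b₁, hb1, hfb1, hb1'⟩ := cross_point_mem hFconv hm1 hz hfm1 hfz
  obtain ⟨b₂, hb2, hfb2, hb2'⟩ := cross_point_mem hFconv hm2 hz hfm2 hfz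
  obtain ⟨b, b', hb, hb', hfb, hfb', hbb'⟩ : ∃ b b', b ∈ topSlice K u ∧ b' ∈ topSlice K u ∧
      f b = 0 ∧ f b' = 0 ∧ b ≠ b' := by
    by_cases e1 : b₀ = b₁
    · by_cases e2 : b₀ = b₂
      · subst e1 e2
        exact (cross_point_not_common hm hfm0 hfm1 hfz hb0' hb1' hb2').elim
      · exact ⟨_, _, hb0, hb2, hfb0, hfb2, e2⟩
    · exact ⟨_, _, hb0, hb1, hfb0, hfb1, e1⟩
  have hgt : ∀ w ∈ topSlice K u, f w = 0 → g w = t := by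
    intro w hw hfw
    simpa [hf, hw.2, sub_eq_zero] using hfw
  have hgb := hgt b hb hfb
  have hgb' := hgt b' hb' hfb'
  obtain ⟨c, hfc, huc, hcs⟩ := hlevel t le_rfl htz
  have hgc : g c = t / 2 := by
    have : g c - t * u c = 0 := by simpa using hfc
    rw [huc] at this
    linarith
  have hq := hcs b hb.1 hfb
  have hq' := hcs b' hb'.1 hfb'
  set S := topSlice K u ∩ {p | p - (b - b') ∈ topSlice K u} with hS
  have hScomp : IsCompact S := hFc.inter_right (hFc.isClosed.preimage (by fun_prop))
  have hbS : b ∈ S := ⟨hb, by simpa using hb'⟩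
  obtain ⟨p, hp, hpmax⟩ := hScomp.exists_isMaxOn ⟨b, hbS⟩
    g.continuous_of_finiteDimensional.continuousOn
  have hpt : t ≤ g p := by rw [← hgb]; exact hpmax hbS
  have hpz : g z ≤ g p := by
    by_contra! hlt
    obtain ⟨s, hs1, hs2⟩ := exists_between hlt
    obtain ⟨c', hfc', huc', hcs'⟩ := hlevel s (hpt.trans hs1.le) hs2
    have hgc' : g c' = s / 2 := by
      have : g c' - s * u c' = 0 := by simpa using hfc'
      rw [huc'] at this
      linarith
    have hr := hcs' _ hq (by simp [huc, hb.2, hgc, hgb]; ring)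
    have hr' := hcs' _ hq' (by simp [huc, hb'.2, hgc, hgb']; ring)
    have hrS : (2 : ℝ) • c' - ((2 : ℝ) • c - b) ∈ S := by
      refine ⟨⟨hr, by simp [huc, huc', hb.2]⟩, ?_⟩
      have : (2 : ℝ) • c' - ((2 : ℝ) • c - b) - (b - b') = (2 : ℝ) • c' - ((2 : ℝ) • c - b') := by
        module
      rw [mem_ofPred_eq, this]
      exact ⟨hr', by simp [huc, huc', hb'.2]⟩
    have := hpmax hrS
    simp only [mem_ofPred_eq, map_sub, map_smul, smul_eq_mul, hgc, hgc', hgb] at this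
    linarith
  have hp1 : p = z := by
    by_contra hne
    exact (hgz p hp.1 hne).not_ge hpz
  have hp2 : p - (b - b') = z := by
    by_contra hne
    refine (hgz _ hp.2 hne).not_ge ?_
    rw [map_sub, map_sub, hgb, hgb']
    linarith
  rw [hp1, sub_eq_self, sub_eq_zero] at hp2
  exact hbb' hp2

theorem Antidiametral.mem_of_planarSym (h : Antidiametral K u κ y) [FiniteDimensional ℝ E]
    (hE : 3 ≤ Module.finrank ℝ E) (hc : IsCompact K) (hconv : Convex ℝ K)
    (hinter : (interior K).Nonempty) (hs : PlanarSym K) : ∀ x ∈ K, (1 + κ) • y - x ∈ K := by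
  by_cases hline : ∃ v, v ≠ 0 ∧ u v = 0 ∧
      ∀ w ∈ K, u w = 1 → κ • w ∈ K → ∃ t : ℝ, w = y + t • v
  · obtain ⟨v, hv, huv, hl⟩ := hline
    exact h.mem_of_forall_mem_line hE hc hconv hinter hs hv huv hl
  push Not at hline
  have hker : ∃ v, v ≠ 0 ∧ u v = 0 := by
    by_contra! hk
    have hinj : Function.Injective u := (injective_iff_map_eq_zero u).2 fun a ha => by
      by_contra h0
      exact hk a h0 ha
    have := LinearMap.finrank_le_finrank_of_injective hinj
    rw [Module.finrank_self] at this
    omega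
  obtain ⟨v, hv, huv⟩ := hker
  obtain ⟨w₁, hw1, huw1, hκw1, hne1⟩ := hline v hv huv
  have hne : w₁ - y ≠ 0 := by
    intro he
    exact hne1 0 (by simpa [sub_eq_zero] using he)
  obtain ⟨w₂, hw2, huw2, hκw2, hne2⟩ := hline (w₁ - y) hne (by simp [huw1, h.map_eq])
  have hli : LinearIndependent ℝ ![y, w₁, w₂] := by
    rw [linearIndependent_triple_iff]
    intro a b c habc
    have hu := congrArg u habc
    simp only [map_add, map_smul, h.map_eq, huw1, huw2, smul_eq_mul, mul_one, map_zero] at hu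
    have ha : a = -b - c := by linarith
    subst ha
    have h1 : b • (w₁ - y) + c • (w₂ - y) = 0 := by rw [← habc]; module
    have hc0 : c = 0 := by
      by_contra hc0
      refine hne2 (-b / c) ?_
      have h2 : c • (w₂ - (y + (-b / c) • (w₁ - y))) = 0 := by
        rw [← h1, smul_sub, smul_add, smul_smul, mul_div_cancel₀ _ hc0]; module
      exact sub_eq_zero.1 ((smul_eq_zero.1 h2).resolve_left hc0)
    subst hc0
    have hb0 : b = 0 := by
      rw [zero_smul, add_zero] at h1
      exact (smul_eq_zero.1 h1).resolve_right hne
    subst hb0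
    simp
  exfalso
  have hyT : y ∈ topSlice K u := ⟨h.mem, h.map_eq⟩
  by_cases hκ : κ = 0
  · subst hκ
    exact h.false_of_eq_zero hc hconv hs hli hyT ⟨hw1, huw1⟩ ⟨hw2, huw2⟩
  by_cases hsub : ∀ x, u x = 1 → κ • x ∈ K → x ∈ K
  · exact h.false_of_subset hc hconv hs hκ hli hyT ⟨hw1, huw1⟩ ⟨hw2, huw2⟩ hκw2 hsub
  · push Not at hsub
    obtain ⟨x, hux, hκx, hx⟩ := hsub
    exact h.false_of_not_mem hc hconv hs hκ hli hyT ⟨hw1, huw1⟩ ⟨hw2, huw2⟩ h.smul_mem hκw1 hκw2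
      hux hκx hx

end CentreTheoremZero

section SectionSym

/-- Every `k`-dimensional subspace meeting the interior of `K` has a symmetric section. -/
def SectionSym {E : Type*} [NormedAddCommGroup E] [NormedSpace ℝ E] (K : Set E) (k : ℕ) : Prop :=
  ∀ H : Submodule ℝ E, Module.finrank ℝ H = k → (∃ x ∈ H, x ∈ interior K) →
    ∃ c ∈ H, ∀ x ∈ H, x ∈ K → (2 : ℝ) • c - x ∈ K

variable {E : Type*} [NormedAddCommGroup E] [NormedSpace ℝ E] {K : Set E}

theorem Convex.mem_of_forall_mem_interior_submodule (hconv : Convex ℝ K) {G : Submodule ℝ E}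
    {x₀ : E} (hx₀ : x₀ ∈ interior K) (hx₀G : x₀ ∈ G) {C : Set E} (hC : IsClosed C)
    (h : ∀ x ∈ G, x ∈ interior K → x ∈ C) : ∀ x ∈ G, x ∈ K → x ∈ C := by
  intro x hxG hx
  have htend : Tendsto (fun t : ℝ => x + t • (x₀ - x)) (𝓝[>] 0) (𝓝 x) := by
    have h : Continuous fun t : ℝ => x + t • (x₀ - x) := by fun_prop
    simpa using (h.tendsto 0).mono_left nhdsWithin_le_nhds
  refine hC.mem_of_tendsto htend ?_
  filter_upwards [Ioc_mem_nhdsGT (zero_lt_one' ℝ)] with t ht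
  exact h _ (G.add_mem hxG (G.smul_mem _ (G.sub_mem hx₀G hxG)))
    (hconv.add_smul_sub_mem_interior hx hx₀ ht)

theorem Submodule.exists_dual_pair [FiniteDimensional ℝ E] {G : Submodule ℝ E}
    (hG : Module.finrank ℝ G + 2 ≤ Module.finrank ℝ E) :
    ∃ (α β : E →ₗ[ℝ] ℝ) (a b : E), (∀ x ∈ G, α x = 0) ∧ (∀ x ∈ G, β x = 0) ∧ α a = 1 ∧ α b = 0 ∧
      β a = 0 ∧ β b = 1 := by
  have hd := G.finrank_quotient_add_finrank
  set B := Module.finBasis ℝ (E ⧸ G)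
  set i : Fin (Module.finrank ℝ (E ⧸ G)) := ⟨0, by omega⟩
  set j : Fin (Module.finrank ℝ (E ⧸ G)) := ⟨1, by omega⟩
  have hij : i ≠ j := by simp [i, j]
  obtain ⟨a, ha⟩ := G.mkQ_surjective (B i)
  obtain ⟨b, hb⟩ := G.mkQ_surjective (B j)
  have hz : ∀ x ∈ G, G.mkQ x = 0 := fun x hx => by simpa using hx
  refine ⟨B.coord i ∘ₗ G.mkQ, B.coord j ∘ₗ G.mkQ, a, b, fun x hx => ?_, fun x hx => ?_,
    ?_, ?_, ?_, ?_⟩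
  · rw [LinearMap.comp_apply, hz x hx, map_zero]
  · rw [LinearMap.comp_apply, hz x hx, map_zero]
  · rw [LinearMap.comp_apply, ha]; simp
  · rw [LinearMap.comp_apply, hb]; simp [hij.symm]
  · rw [LinearMap.comp_apply, ha]; simp [hij]
  · rw [LinearMap.comp_apply, hb]; simp

theorem SectionSym.of_succ [FiniteDimensional ℝ E] {m : ℕ} (hc : IsCompact K) (hconv : Convex ℝ K)
    (hm : m + 2 ≤ Module.finrank ℝ E) (hs : SectionSym K (m + 1)) : SectionSym K m := by
  rintro G hG ⟨x₀, hx₀G, hx₀⟩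
  obtain ⟨α, β, a, b, hαG, hβG, hαa, hαb, hβa, hβb⟩ :=
    Submodule.exists_dual_pair (G := G) (by omega)
  have hαc : Continuous α := α.continuous_of_finiteDimensional
  have hβc : Continuous β := β.continuous_of_finiteDimensional
  have hGc : IsClosed (G : Set E) := G.closed_of_finiteDimensional
  set v : ℝ → E := fun θ => Real.cos θ • a + Real.sin θ • b with hv
  have hvc : Continuous v := by fun_prop
  set ρ : ℝ × E → ℝ := fun q => Real.cos q.1 * α q.2 + Real.sin q.1 * β q.2 with hρ
  have hρc : Continuous ρ := by fun_prop
  have hρadd : ∀ θ x x', ρ (θ, x + x') = ρ (θ, x) + ρ (θ, x') := fun θ x x' => by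
    simp only [hρ, map_add]; ring
  have hρsmul : ∀ θ (r : ℝ) x, ρ (θ, r • x) = r * ρ (θ, x) := fun θ r x => by
    simp only [hρ, map_smul, smul_eq_mul]; ring
  have hρG : ∀ θ, ∀ x ∈ G, ρ (θ, x) = 0 := fun θ x hx => by simp [hρ, hαG x hx, hβG x hx]
  have hρv : ∀ θ, ρ (θ, v θ) = 1 := fun θ => by
    simp only [hρ, hv, map_add, map_smul, hαa, hαb, hβa, hβb, smul_eq_mul]
    linear_combination Real.cos_sq_add_sin_sq θ
  set Q : Set (ℝ × E) := {q | q.2 - ρ q • v q.1 ∈ G ∧ ∀ g ∈ G, ∀ r : ℝ,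
    g + r • v q.1 ∈ interior K → (2 : ℝ) • q.2 - (g + r • v q.1) ∈ K} with hQ
  have hQc : IsClosed Q := by
    rw [hQ, ofPred_and]
    refine (hGc.preimage (by fun_prop)).inter ?_
    simp only [ofPred_forall]
    refine isClosed_biInter fun g _ => isClosed_iInter fun r => ?_
    have : {q : ℝ × E | g + r • v q.1 ∈ interior K → (2 : ℝ) • q.2 - (g + r • v q.1) ∈ K} =
      {q : ℝ × E | g + r • v q.1 ∈ interior K}ᶜ ∪
        {q : ℝ × E | (2 : ℝ) • q.2 - (g + r • v q.1) ∈ K} := by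
      ext q; simp [imp_iff_not_or]
    rw [this]
    exact (isOpen_interior.preimage (by fun_prop)).isClosed_compl.union
      (hc.isClosed.preimage (by fun_prop))
  set W : Set E := (fun x => (1 / 2 : ℝ) • (x₀ + x)) '' K with hW
  have hWc : IsCompact W := hc.image (by fun_prop)
  have hcompact : IsCompact (Q ∩ Icc (0 : ℝ) Real.pi ×ˢ W) :=
    (isCompact_Icc.prod hWc).inter_left hQc
  have hmemW : ∀ q ∈ Q, q.2 ∈ W := by
    intro q hq
    refine ⟨_, hq.2 x₀ hx₀G 0 (by simpa using hx₀), ?_⟩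
    simp only [zero_smul]
    module
  have hexists : ∀ θ, ∃ c, (θ, c) ∈ Q := by
    intro θ
    have hv0 : v θ ∉ G := fun hvG => by simpa [hρG θ _ hvG] using hρv θ
    have hfr : Module.finrank ℝ (G ⊔ Submodule.span ℝ {v θ} : Submodule ℝ E) = m + 1 := by
      rw [Submodule.finrank_sup_span_singleton hv0, hG]
    obtain ⟨c, hcH, hcs⟩ := hs _ hfr ⟨x₀, Submodule.mem_sup_left hx₀G, hx₀⟩
    refine ⟨c, ?_, fun g hg r hgr => hcs _ (Submodule.add_mem_sup hg
      (Submodule.smul_mem _ _ (Submodule.mem_span_singleton_self _))) (interior_subset hgr)⟩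
    obtain ⟨g, hg, w, hw, rfl⟩ := Submodule.mem_sup.1 hcH
    obtain ⟨r, rfl⟩ := Submodule.mem_span_singleton.1 hw
    rw [hρadd, hρG θ g hg, hρsmul, hρv]
    simpa using hg
  set P := Prod.fst '' (Q ∩ Icc (0 : ℝ) Real.pi ×ˢ W ∩ {q | 0 ≤ ρ q}) with hP
  set N := Prod.fst '' (Q ∩ Icc (0 : ℝ) Real.pi ×ˢ W ∩ {q | ρ q ≤ 0}) with hN
  have hPc : IsClosed P :=
    ((hcompact.inter_right (isClosed_le continuous_const hρc)).image continuous_fst).isClosed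
  have hNc : IsClosed N :=
    ((hcompact.inter_right (isClosed_le hρc continuous_const)).image continuous_fst).isClosed
  have hPmem : ∀ θ ∈ Icc (0 : ℝ) Real.pi, ∀ c, (θ, c) ∈ Q → 0 ≤ ρ (θ, c) → θ ∈ P :=
    fun θ hθ c hq hr => ⟨(θ, c), ⟨⟨hq, hθ, hmemW _ hq⟩, hr⟩, rfl⟩
  have hNmem : ∀ θ ∈ Icc (0 : ℝ) Real.pi, ∀ c, (θ, c) ∈ Q → ρ (θ, c) ≤ 0 → θ ∈ N :=
    fun θ hθ c hq hr => ⟨(θ, c), ⟨⟨hq, hθ, hmemW _ hq⟩, hr⟩, rfl⟩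
  have h0 : (0 : ℝ) ∈ Icc (0 : ℝ) Real.pi := ⟨le_rfl, Real.pi_pos.le⟩
  have hπ : Real.pi ∈ Icc (0 : ℝ) Real.pi := ⟨Real.pi_pos.le, le_rfl⟩
  have hvπ : v Real.pi = -v 0 := by simp [hv]
  have hρπ : ∀ c, ρ (Real.pi, c) = -ρ (0, c) := fun c => by simp [hρ]
  have hQπ : ∀ c, (0, c) ∈ Q → (Real.pi, c) ∈ Q := by
    rintro c ⟨h1, h2⟩
    refine ⟨?_, fun g hg r hgr => ?_⟩
    · rw [hρπ, hvπ, smul_neg, neg_smul, neg_neg]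
      exact h1
    · have := h2 g hg (-r)
      simp only [hvπ, neg_smul, smul_neg] at this hgr ⊢
      exact this hgr
  obtain ⟨c₀, hc₀⟩ := hexists 0
  obtain ⟨hPne, hNne⟩ : (Icc (0 : ℝ) Real.pi ∩ P).Nonempty ∧ (Icc (0 : ℝ) Real.pi ∩ N).Nonempty := by
    rcases le_total 0 (ρ (0, c₀)) with hr | hr
    · exact ⟨⟨0, h0, hPmem 0 h0 c₀ hc₀ hr⟩,
        ⟨Real.pi, hπ, hNmem _ hπ c₀ (hQπ _ hc₀) (by rw [hρπ]; linarith)⟩⟩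
    · exact ⟨⟨Real.pi, hπ, hPmem _ hπ c₀ (hQπ _ hc₀) (by rw [hρπ]; linarith)⟩,
        ⟨0, h0, hNmem 0 h0 c₀ hc₀ hr⟩⟩
  have hcover : Icc (0 : ℝ) Real.pi ⊆ P ∪ N := by
    intro θ hθ
    obtain ⟨c, hq⟩ := hexists θ
    exact (le_total 0 (ρ (θ, c))).imp (hPmem θ hθ c hq) (hNmem θ hθ c hq)
  obtain ⟨θ, -, ⟨⟨_, c₁⟩, ⟨⟨hq1, -⟩, hr1⟩, rfl⟩, ⟨⟨θ, c₂⟩, ⟨⟨hq2, -⟩, hr2⟩, hθ⟩⟩ :=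
    isPreconnected_closed_iff.1 isPreconnected_Icc P N hPc hNc hcover hPne hNne
  dsimp only at hθ
  subst hθ
  obtain ⟨s, t, hs0, ht0, hst, hρ0⟩ : ∃ s t : ℝ, 0 ≤ s ∧ 0 ≤ t ∧ s + t = 1 ∧
      s * ρ (θ, c₁) + t * ρ (θ, c₂) = 0 := by
    have hr1 : 0 ≤ ρ (θ, c₁) := hr1
    have hr2 : ρ (θ, c₂) ≤ 0 := hr2
    rcases hr1.eq_or_lt with h | h
    · exact ⟨1, 0, by norm_num, by norm_num, by norm_num, by simp [← h]⟩
    · have : 0 < ρ (θ, c₁) - ρ (θ, c₂) := by linarith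
      exact ⟨-ρ (θ, c₂) / (ρ (θ, c₁) - ρ (θ, c₂)), ρ (θ, c₁) / (ρ (θ, c₁) - ρ (θ, c₂)),
        div_nonneg (by linarith) this.le, by positivity, by field_simp; ring, by field_simp; ring⟩
  have hcG : s • c₁ + t • c₂ ∈ G := by
    have := G.add_mem (G.smul_mem s hq1.1) (G.smul_mem t hq2.1)
    have he : s • (c₁ - ρ (θ, c₁) • v θ) + t • (c₂ - ρ (θ, c₂) • v θ) = s • c₁ + t • c₂ -
      (s * ρ (θ, c₁) + t * ρ (θ, c₂)) • v θ := by module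
    rw [hρ0, zero_smul, sub_zero] at he
    rwa [he] at this
  refine ⟨_, hcG, hconv.mem_of_forall_mem_interior_submodule hx₀ hx₀G
    (C := {x | (2 : ℝ) • (s • c₁ + t • c₂) - x ∈ K}) (hc.isClosed.preimage (by fun_prop)) ?_⟩
  intro x hxG hx
  have h1 := hq1.2 x hxG 0 (by simpa using hx)
  have h2 := hq2.2 x hxG 0 (by simpa using hx)
  have := hconv h1 h2 hs0 ht0 hst
  rw [mem_ofPred_eq]
  convert this using 1
  obtain rfl : t = 1 - s := by linarith
  module

theorem SectionSym.two [FiniteDimensional ℝ E] (hc : IsCompact K) (hconv : Convex ℝ K) {k : ℕ}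
    (hk : 2 ≤ k) (hkn : k + 1 ≤ Module.finrank ℝ E) (hs : SectionSym K k) : SectionSym K 2 := by
  induction k, hk using Nat.le_induction with
  | base => exact hs
  | succ k hk ih => exact ih (by omega) (hs.of_succ hc hconv (by omega))

end SectionSym

section Glue

theorem Submodule.exists_le_finrank_eq_add {E : Type*} [AddCommGroup E] [Module ℝ E]
    [FiniteDimensional ℝ E] (S : Submodule ℝ E) (j : ℕ)
    (h : Module.finrank ℝ S + j ≤ Module.finrank ℝ E) :
    ∃ M : Submodule ℝ E, S ≤ M ∧ Module.finrank ℝ M = Module.finrank ℝ S + j := by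
  induction j with
  | zero => exact ⟨S, le_rfl, rfl⟩
  | succ j ih =>
    obtain ⟨M, hSM, hM⟩ := ih (by omega)
    have hne : M ≠ ⊤ := by
      rintro rfl
      rw [finrank_top] at hM
      omega
    obtain ⟨v, -, hv⟩ := SetLike.exists_of_lt (lt_top_iff_ne_top.2 hne)
    exact ⟨M ⊔ Submodule.span ℝ {v}, hSM.trans le_sup_left, by
      rw [Submodule.finrank_sup_span_singleton hv, hM, add_assoc]⟩

variable {E : Type*} [NormedAddCommGroup E] [InnerProductSpace ℝ E] [FiniteDimensional ℝ E]
  {K : Set E} {u : E →ₗ[ℝ] ℝ} {κ : ℝ} {y : E}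

theorem SectionSym.planarSym (hs : SectionSym K 2) (hconv : Convex ℝ K) {M : Submodule ℝ E}
    (hM : Module.finrank ℝ M = 3) {x : M} (hx : (x : E) ∈ interior K) :
    PlanarSym ((↑) ⁻¹' K : Set M) := by
  rintro f ⟨a, ha, hfa⟩ ⟨b, hb, hfb⟩
  have hrange : LinearMap.range f = ⊤ := LinearMap.range_eq_top.2
    (LinearMap.surjective fun h => by simp [h] at hfa)
  have hfr : Module.finrank ℝ ((LinearMap.ker f).map M.subtype) = 2 := by
    rw [Submodule.finrank_map_subtype_eq]
    have := LinearMap.finrank_range_add_finrank_ker f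
    rw [hrange, finrank_top, Module.finrank_self, hM] at this
    omega
  have hpush : ∀ (w : M) (t : ℝ), (w : E) ∈ K → f w + t * (f x - f w) = 0 → t ∈ Ioc (0 : ℝ) 1 →
      ∃ z ∈ (LinearMap.ker f).map M.subtype, z ∈ interior K := by
    intro w t hw hft ht
    exact ⟨_, ⟨w + t • (x - w), by simpa using hft, rfl⟩, by
      simpa using hconv.add_smul_sub_mem_interior hw hx ht⟩
  obtain ⟨_, ⟨c, hfc, rfl⟩, hcs⟩ := hs _ hfr (by
    rcases le_or_gt 0 (f x) with h | h
    · have h1 : 0 < f x - f a := by linarith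
      exact hpush a (-f a / (f x - f a)) ha (by field_simp; ring)
        ⟨div_pos (by linarith) h1, (div_le_one h1).2 (by linarith)⟩
    · have h1 : 0 < f b - f x := by linarith
      exact hpush b (f b / (f b - f x)) hb (by field_simp; ring)
        ⟨by positivity, (div_le_one h1).2 (by linarith)⟩)
  exact ⟨c, hfc, fun w hw hfw => hcs w ⟨w, hfw, rfl⟩ hw⟩

theorem Antidiametral.mem_of_sectionSym (h : Antidiametral K u κ y)
    (hE : 3 ≤ Module.finrank ℝ E) (hc : IsCompact K) (hconv : Convex ℝ K)
    (hinter : (interior K).Nonempty) (hs : SectionSym K 2) : ∀ x ∈ K, (1 + κ) • y - x ∈ K := by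
  refine hconv.mem_of_forall_mem_interior hinter (C := {x | (1 + κ) • y - x ∈ K})
    (hc.isClosed.preimage (by fun_prop)) fun x hx => ?_
  have hfr : Module.finrank ℝ (Submodule.span ℝ {x, y}) ≤ 2 := by
    classical
    have := finrank_span_finset_le_card (R := ℝ) ({x, y} : Finset E)
    rw [Finset.coe_pair] at this
    exact this.trans Finset.card_le_two
  obtain ⟨M, hle, hM⟩ := (Submodule.span ℝ {x, y}).exists_le_finrank_eq_add
    (3 - Module.finrank ℝ (Submodule.span ℝ {x, y})) (by omega)
  have hM : Module.finrank ℝ M = 3 := by omega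
  have hxM : x ∈ M := hle (Submodule.subset_span (by simp))
  have hyM : y ∈ M := hle (Submodule.subset_span (by simp))
  have hA : Antidiametral ((↑) ⁻¹' K : Set M) (u ∘ₗ M.subtype) κ ⟨y, hyM⟩ :=
    ⟨h.neg_one_lt, h.lt_one, h.mem, h.smul_mem, h.map_eq, fun w hw => h.le_map _ hw,
      fun w hw => h.map_le _ hw, fun hκ w hw => h.smul_mem_of_neg hκ _ hw⟩
  have hcM : IsCompact ((↑) ⁻¹' K : Set M) :=
    M.closed_of_finiteDimensional.isClosedEmbedding_subtypeVal.isCompact_preimage hc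
  have hintM : (interior ((↑) ⁻¹' K : Set M)).Nonempty :=
    ⟨⟨x, hxM⟩, mem_interior_iff_mem_nhds.2 (continuous_subtype_val.continuousAt
      (mem_interior_iff_mem_nhds.1 hx))⟩
  exact hA.mem_of_planarSym hM.ge hcM (hconv.linear_preimage M.subtype) hintM
    (hs.planarSym hconv hM (x := ⟨x, hxM⟩) hx) ⟨x, hxM⟩
    (interior_subset (s := K) hx)

end Glue

section NormFromSections

theorem falseCentre_of_sections {V : Type*} [NormedAddCommGroup V] [NormedSpace ℝ V]
    {e : V} {P : ℝ}
    (hs : ∀ H : Submodule ℝ V, Module.finrank ℝ H = 2 → (∃ x ∈ H, ‖x + P • e‖ < 1) →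
      ∃ c ∈ H, ∀ x ∈ H, ‖x + P • e‖ ≤ 1 → ‖(2 : ℝ) • c - x + P • e‖ ≤ 1)
    (hP : 0 ≤ P) : FalseCentre e P := by
  intro y z hli δ hδ
  rw [linearIndependent_triple_iff] at hli
  have hpair : LinearIndependent ℝ ![y, e - δ • z] := by
    rw [LinearIndependent.pair_iff]
    intro s t hst
    obtain ⟨ht, hs, -⟩ := hli t s (-(t * δ)) (by rw [← hst]; module)
    exact ⟨hs, ht⟩
  have hfr := finrank_span_eq_card hpair
  rw [Matrix.range_cons_cons_empty, Fintype.card_fin] at hfr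
  obtain ⟨c, hc, hcs⟩ := hs _ hfr ⟨-P • (e - δ • z),
    Submodule.smul_mem _ _ (Submodule.subset_span (by simp)), by
      have : -P • (e - δ • z) + P • e = (δ * P) • z := by module
      rwa [this, norm_smul, Real.norm_eq_abs, abs_mul, abs_of_nonneg hP]⟩
  obtain ⟨α, β, rfl⟩ := Submodule.mem_span_pair.1 hc
  refine ⟨α, β + P, fun r s hrs => ?_⟩
  have := hcs (r • y + (s - P) • (e - δ • z)) (Submodule.mem_span_pair.2 ⟨_, _, rfl⟩) (by
    convert hrs using 2
    module)
  convert this using 2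
  module

variable {E : Type*} [AddCommGroup E] [Module ℝ E]

theorem Seminorm.core (p : Seminorm ℝ E) (hp : ∀ x, p x = 0 → x = 0) :
    letI : Norm E := ⟨p⟩
    NormedSpace.Core ℝ E :=
  letI : Norm E := ⟨p⟩
  { norm_nonneg := apply_nonneg p
    norm_smul := map_smul_eq_mul p
    norm_triangle := map_add_le_add p
    norm_eq_zero_iff := fun x => ⟨hp x, fun h => h ▸ map_zero p⟩ }

variable [FiniteDimensional ℝ E]

theorem Seminorm.parallelogram_of_sections (p : Seminorm ℝ E) (hp : ∀ x, p x = 0 → x = 0)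
    (hE : 3 ≤ Module.finrank ℝ E) {a : E} (ha : a ≠ 0)
    (hs : ∀ H : Submodule ℝ E, Module.finrank ℝ H = 2 → (∃ x ∈ H, p (x - a) < 1) →
      ∃ c ∈ H, ∀ x ∈ H, p (x - a) ≤ 1 → p ((2 : ℝ) • c - x - a) ≤ 1) (x y : E) :
    p (x + y) ^ 2 + p (x - y) ^ 2 = 2 * p x ^ 2 + 2 * p y ^ 2 := by
  let : Norm E := ⟨p⟩
  let : NormedAddCommGroup E := NormedAddCommGroup.ofCore (p.core hp)
  let : NormedSpace ℝ E := NormedSpace.ofCore (p.core hp)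
  have hna : 0 < ‖a‖ := norm_pos_iff.2 ha
  have he : ‖a‖ • (-(‖a‖⁻¹ • a)) = -a := by rw [smul_neg, smul_inv_smul₀ hna.ne']
  have hfc : FalseCentre (-(‖a‖⁻¹ • a)) ‖a‖ := falseCentre_of_sections (by
    intro H hH hx
    simp only [he, ← sub_eq_add_neg] at hx ⊢
    exact hs H hH hx) hna.le
  exact hfc.parallelogram hE (by rw [norm_neg, norm_smul, norm_inv, norm_norm,
    inv_mul_cancel₀ hna.ne']) hna x y

theorem Seminorm.exists_euclidean (p : Seminorm ℝ E) (hp : ∀ x, p x = 0 → x = 0)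
    (h : ∀ x y, p (x + y) ^ 2 + p (x - y) ^ 2 = 2 * p x ^ 2 + 2 * p y ^ 2) :
    ∃ T : E ≃ₗ[ℝ] EuclideanSpace ℝ (Fin (Module.finrank ℝ E)), ∀ x, ‖T x‖ = p x := by
  let : Norm E := ⟨p⟩
  let : NormedAddCommGroup E := NormedAddCommGroup.ofCore (p.core hp)
  let : NormedSpace ℝ E := NormedSpace.ofCore (p.core hp)
  let : InnerProductSpace ℝ E := InnerProductSpace.ofNorm ℝ fun x y => by
    have := h x y
    change p (x + y) * p (x + y) + p (x - y) * p (x - y) = 2 * (p x * p x + p y * p y)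
    linarith
  exact ⟨(stdOrthonormalBasis ℝ E).repr.toLinearEquiv,
    fun x => (stdOrthonormalBasis ℝ E).repr.norm_map x⟩

end NormFromSections

section Final

theorem exists_seminorm_of_symmetric {E : Type*} [NormedAddCommGroup E] [NormedSpace ℝ E]
    {L : Set E} (hc : IsCompact L) (hconv : Convex ℝ L) (hinter : (interior L).Nonempty)
    (hsym : ∀ x ∈ L, -x ∈ L) : ∃ p : Seminorm ℝ E, (∀ x, p x = 0 → x = 0) ∧
      (∀ x, p x ≤ 1 ↔ x ∈ L) ∧ ∀ x, p x < 1 ↔ x ∈ interior L := by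
  have hneg : -L = L := by
    ext x
    exact ⟨fun h => neg_neg x ▸ hsym _ h, fun h => hsym x h⟩
  obtain ⟨z, hz⟩ := hinter
  have hz' : -z ∈ interior L := by
    have := (Homeomorph.neg E).preimage_interior L
    rw [show Homeomorph.neg E ⁻¹' L = L from hneg] at this
    rw [← this] at hz
    exact hz
  have h0 : (0 : E) ∈ interior L := by
    simpa using hconv.interior.midpoint_mem hz hz'
  have hnhds : L ∈ 𝓝 (0 : E) := mem_interior_iff_mem_nhds.1 h0
  have habs : Absorbent ℝ L := absorbent_nhds_zero hnhds
  refine ⟨gaugeSeminorm ((balanced_iff_neg_mem hconv).2 hsym) hconv habs, fun x hx => ?_,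
    fun x => ?_, fun x => gauge_lt_one_iff_mem_interior hconv hnhds⟩
  · exact (gauge_eq_zero habs (NormedSpace.isVonNBounded_of_isBounded ℝ hc.isBounded)).1 hx
  · change gauge L x ≤ 1 ↔ _
    rw [gauge_le_one_iff_mem_closure hconv hnhds, hc.isClosed.closure_eq]

theorem interior_preimage_const_add {E : Type*} [NormedAddCommGroup E] (a : E) (s : Set E) :
    interior ((fun x => a + x) ⁻¹' s) = (fun x => a + x) ⁻¹' interior s :=
  ((Homeomorph.addLeft a).preimage_interior s).symm

theorem isCompact_preimage_const_add {E : Type*} [NormedAddCommGroup E] (a : E) {s : Set E}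
    (hs : IsCompact s) : IsCompact ((fun x => a + x) ⁻¹' s) :=
  (Homeomorph.addLeft a).isCompact_preimage.2 hs

/-- A convex body with symmetric planar sections through the origin is either symmetric about the
origin or an ellipsoid. -/
theorem SectionSym.symmetric_or_euclidean {E : Type*} [NormedAddCommGroup E]
    [InnerProductSpace ℝ E] [FiniteDimensional ℝ E] {K : Set E} {n : ℕ}
    (hn : Module.finrank ℝ E = n) (hE : 3 ≤ n)
    (hc : IsCompact K) (hconv : Convex ℝ K) (hinter : (interior K).Nonempty)
    (hs : SectionSym K 2) :
    (∀ x ∈ K, -x ∈ K) ∨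
      ∃ (a : E) (T : E ≃ₗ[ℝ] EuclideanSpace ℝ (Fin n)), ∀ x, ‖T x‖ ≤ 1 ↔ a + x ∈ K := by
  subst hn
  refine or_iff_not_imp_left.2 fun hns => ?_
  obtain ⟨u, κ, y, h⟩ := exists_antidiametral hc hconv hinter hns
  have hrefl := h.mem_of_sectionSym hE hc hconv hinter hs
  have hκ := h.neg_one_lt
  obtain ⟨a, ha⟩ : ∃ a, a = ((1 + κ) / 2) • y := ⟨_, rfl⟩
  have ha2 : (1 + κ) • y = (2 : ℝ) • a := by rw [ha]; module
  have ha0 : a ≠ 0 := by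
    intro h0
    have := congrArg u (ha ▸ h0)
    simp only [map_smul, h.map_eq, smul_eq_mul, map_zero] at this
    linarith
  obtain ⟨p, hp0, hple, hplt⟩ := exists_seminorm_of_symmetric (L := (fun x => a + x) ⁻¹' K)
    (isCompact_preimage_const_add a hc) (hconv.translate_preimage_right a)
    (by
      obtain ⟨z, hz⟩ := hinter
      exact ⟨z - a, by rw [interior_preimage_const_add]; simpa using hz⟩)
    (fun x hx => by
      have := hrefl _ hx
      rw [ha2] at this
      rw [mem_preimage]
      convert this using 1
      module)
  have hple' : ∀ x, p (x - a) ≤ 1 ↔ x ∈ K := fun x => by rw [hple]; simp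
  have hplt' : ∀ x, p (x - a) < 1 ↔ x ∈ interior K := fun x => by
    rw [hplt, interior_preimage_const_add]; simp
  obtain ⟨T, hT⟩ := p.exists_euclidean hp0 (p.parallelogram_of_sections hp0 hE ha0 (by
    intro H hH hx
    simp only [hple', hplt'] at hx ⊢
    exact hs H hH hx))
  exact ⟨a, T, fun x => by rw [hT, hple]; rfl⟩

theorem symmWith_of_forall_mem {n : ℕ} {K : Set (EuclideanSpace ℝ (Fin n))}
    {c : EuclideanSpace ℝ (Fin n)} (h : ∀ x ∈ K, (2 : ℝ) • c - x ∈ K) : SymmWith K c := by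
  refine Subset.antisymm (image_subset_iff.2 h) fun x hx => ⟨_, h x hx, ?_⟩
  simp

theorem SymmWith.mem {n : ℕ} {K : Set (EuclideanSpace ℝ (Fin n))}
    {c x : EuclideanSpace ℝ (Fin n)} (h : SymmWith K c) (hx : x ∈ K) : (2 : ℝ) • c - x ∈ K := by
  rw [← h]
  exact mem_image_of_mem _ hx

theorem sectionSym_of_symmWith {n k : ℕ} {K : Set (EuclideanSpace ℝ (Fin n))}
    {p : EuclideanSpace ℝ (Fin n)}
    (hsym : ∀ H : AffineSubspace ℝ (EuclideanSpace ℝ (Fin n)),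
      p ∈ H → Module.finrank ℝ H.direction = k →
      ∃ c, SymmWith ((H : Set (EuclideanSpace ℝ (Fin n))) ∩ K) c) :
    SectionSym ((fun x => p + x) ⁻¹' K) k := by
  rintro H hH ⟨x, hxH, hx⟩
  obtain ⟨c, hc⟩ := hsym (AffineSubspace.mk' p H) (AffineSubspace.self_mem_mk' p H)
    (by rw [AffineSubspace.direction_mk', hH])
  have hmem : ∀ w ∈ H, p + w ∈ K → (2 : ℝ) • (c - p) - w ∈ H ∧ p + ((2 : ℝ) • (c - p) - w) ∈ K := by
    intro w hw hwK
    have h1 := hc.mem (x := p + w) ⟨by simpa [AffineSubspace.mem_mk'] using hw, hwK⟩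
    have he : p + ((2 : ℝ) • (c - p) - w) = (2 : ℝ) • c - (p + w) := by module
    refine ⟨?_, he ▸ h1.2⟩
    have h2 := h1.1
    rw [← he] at h2
    simpa [AffineSubspace.mem_mk'] using h2
  refine ⟨c - p, ?_, fun w hw hwK => (hmem w hw hwK).2⟩
  have h1 := H.add_mem (hmem x hxH (interior_subset (s := (fun x => p + x) ⁻¹' K) hx)).1 hxH
  rw [sub_add_cancel] at h1
  exact (H.smul_mem_iff two_ne_zero).1 h1

end Final

/-- **False Centre Theorem, higher dimensions/codimensions.** Let `n ≥ 3`, `2 ≤ k ≤ n - 1`, and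
let `K` be a convex body in `ℝⁿ`. If every `k`-dimensional affine subspace through `p` meets `K`
in a centrally symmetric section, then either `p` is a centre of symmetry of `K` or `K` is an
ellipsoid (affine image of the closed unit ball). -/
theorem false_centre_theorem_general
    (n k : ℕ) (hn : 3 ≤ n) (hk : 2 ≤ k) (hkn : k ≤ n - 1)
    (K : Set (EuclideanSpace ℝ (Fin n))) (p : EuclideanSpace ℝ (Fin n))
    (hKcomp : IsCompact K) (hKconv : Convex ℝ K) (hKint : (interior K).Nonempty)
    (hsym : ∀ H : AffineSubspace ℝ (EuclideanSpace ℝ (Fin n)),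
      p ∈ H → Module.finrank ℝ H.direction = k →
      ∃ c, SymmWith ((H : Set (EuclideanSpace ℝ (Fin n))) ∩ K) c) :
    SymmWith K p ∨
      ∃ T : EuclideanSpace ℝ (Fin n) ≃ᵃ[ℝ] EuclideanSpace ℝ (Fin n),
        K = T '' Metric.closedBall (0 : EuclideanSpace ℝ (Fin n)) 1 := by
  have hfr : Module.finrank ℝ (EuclideanSpace ℝ (Fin n)) = n := finrank_euclideanSpace_fin
  have hK₀c : IsCompact ((fun x => p + x) ⁻¹' K) := isCompact_preimage_const_add p hKcomp
  have hK₀conv : Convex ℝ ((fun x => p + x) ⁻¹' K) := hKconv.translate_preimage_right p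
  have hK₀int : (interior ((fun x => p + x) ⁻¹' K)).Nonempty := by
    obtain ⟨z, hz⟩ := hKint
    exact ⟨z - p, by rw [interior_preimage_const_add]; simpa using hz⟩
  have hs := (sectionSym_of_symmWith hsym).two hK₀c hK₀conv hk (by omega)
  rcases hs.symmetric_or_euclidean hfr hn hK₀c hK₀conv hK₀int with h | ⟨a, T, hT⟩
  · refine Or.inl (symmWith_of_forall_mem fun x hx => ?_)
    have := h (x - p) (by simpa using hx)
    rw [mem_preimage] at this
    convert this using 1
    module
  · refine Or.inr ⟨T.symm.toAffineEquiv.trans (AffineEquiv.constVAdd ℝ _ (p + a)), ?_⟩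
    ext x
    have key : ∀ w, p + (a + w) ∈ K ↔ ‖T w‖ ≤ 1 := fun w => (hT w).symm
    constructor
    · intro hx
      refine ⟨T (x - (p + a)), ?_, ?_⟩
      · rw [mem_closedBall_zero_iff, ← key, ← add_assoc, add_sub_cancel]
        exact hx
      · simp
        abel
    · rintro ⟨w, hw, rfl⟩
      rw [mem_closedBall_zero_iff] at hw
      have := (key (T.symm w)).2 (by simpa using hw)
      simpa [add_assoc] using this
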